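/- arXiv:2512.05084 — 3 statements merged into one kernel-verified Lean document; each statement's English description precedes it below -/
import Mathlib

section
/- Fix integers d ≥ 1, H ≥ 1, a gradient threshold θ > 0, and a degree bound Δ ≥ 2. Let Π be the set of instances (x, f) with x ∈ ℝ^d and f : ℝ^d → ℝ a real polynomial of degree at most Δ, and let ℓ(η, x, f) be the gradient-descent cost. Then for every ε > 0, every δ ∈ (0,1), every P ⊆ ℝ_{≥0}, and every probability distribution D over Π, (ε, δ)-uniform convergence of the class {(x, f) ↦ ℓ(η, x, f) : η ∈ P} holds with m samples, where m = O((H²/ε²)(H·log Δ + log(1/δ))). -/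
open MeasureTheory

/-- Gradient-descent iterates: `gdIter f x η i` is the `(i+1)`-st iterate `x_{i+1}`,
so `gdIter f x η 0 = x₁ = x` and `x_{i+1} = x_i - η ∇f(x_i)`. -/
noncomputable def gdIter {d : ℕ} (f : EuclideanSpace ℝ (Fin d) → ℝ)
    (x : EuclideanSpace ℝ (Fin d)) (η : ℝ) : ℕ → EuclideanSpace ℝ (Fin d)
  | 0 => x
  | i + 1 => gdIter f x η i - η • gradient f (gdIter f x η i)

/-- Gradient-descent cost: the smallest `i ∈ {1,…,H}` with `‖∇f(x_i)‖ < θ` if it exists,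
and `H` otherwise. -/
noncomputable def gdCost {d : ℕ} (H : ℕ) (θ : ℝ) (f : EuclideanSpace ℝ (Fin d) → ℝ)
    (x : EuclideanSpace ℝ (Fin d)) (η : ℝ) : ℕ :=
  sInf ({i | 1 ≤ i ∧ i ≤ H ∧ ‖gradient f (gdIter f x η (i - 1))‖ < θ} ∪ {H})

/-- `f : ℝ^d → ℝ` is a real polynomial of (total) degree at most `Δ`. -/
def IsPolyDeg {d : ℕ} (Δ : ℕ) (f : EuclideanSpace ℝ (Fin d) → ℝ) : Prop :=
  ∃ P : MvPolynomial (Fin d) ℝ, P.totalDegree ≤ Δ ∧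
    ∀ y : EuclideanSpace ℝ (Fin d), f y = MvPolynomial.eval (fun j => y j) P



lemma pderiv_totalDegree_le {σ : Type*} (P : MvPolynomial σ ℝ) (i : σ) :
    (MvPolynomial.pderiv i P).totalDegree ≤ P.totalDegree := by
  conv_lhs => rw [P.as_sum]
  rw [map_sum]
  refine MvPolynomial.totalDegree_finsetSum_le fun s hs => ?_
  rw [MvPolynomial.pderiv_monomial]
  refine (MvPolynomial.totalDegree_monomial_le _ _).trans ?_
  refine le_trans ?_ (MvPolynomial.le_totalDegree hs)
  show (s - Finsupp.single i 1).degree ≤ s.degree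
  exact Finsupp.degree_mono tsub_le_self

lemma hasFDerivAt_mvpoly {d : ℕ} (P : MvPolynomial (Fin d) ℝ) (y : EuclideanSpace ℝ (Fin d)) :
    HasFDerivAt (fun y : EuclideanSpace ℝ (Fin d) => MvPolynomial.eval (fun j => y j) P)
      (∑ j, (MvPolynomial.eval (fun j => y j) (MvPolynomial.pderiv j P)) •
        (EuclideanSpace.proj j : EuclideanSpace ℝ (Fin d) →L[ℝ] ℝ)) y := by
  induction P using MvPolynomial.induction_on with
  | C a => simpa using hasFDerivAt_const a y
  | add p q hp hq =>
    simp only [map_add, add_smul, Finset.sum_add_distrib]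
    exact hp.add hq
  | mul_X p i hp =>
    simp only [map_mul, MvPolynomial.eval_X]
    have h1 : HasFDerivAt (fun y : EuclideanSpace ℝ (Fin d) => y i)
      (EuclideanSpace.proj i : EuclideanSpace ℝ (Fin d) →L[ℝ] ℝ) y :=
      (EuclideanSpace.proj i : EuclideanSpace ℝ (Fin d) →L[ℝ] ℝ).hasFDerivAt
    refine (hp.mul h1).congr_fderiv ?_
    ext v
    simp [MvPolynomial.pderiv_X, Pi.single_apply, add_mul,
      Finset.sum_add_distrib, Finset.mul_sum, apply_ite, ite_mul]
    exact Finset.sum_congr rfl fun _ _ => by ring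

lemma gradient_mvpoly {d : ℕ} (P : MvPolynomial (Fin d) ℝ) (f : EuclideanSpace ℝ (Fin d) → ℝ)
    (hf : ∀ y : EuclideanSpace ℝ (Fin d), f y = MvPolynomial.eval (fun j => y j) P)
    (y : EuclideanSpace ℝ (Fin d)) (j : Fin d) :
    gradient f y j = MvPolynomial.eval (fun j => y j) (MvPolynomial.pderiv j P) := by
  have hf' : f = fun y : EuclideanSpace ℝ (Fin d) => MvPolynomial.eval (fun j => y j) P := funext hf
  have h : HasGradientAt f (WithLp.toLp 2 fun j =>
      MvPolynomial.eval (fun j => y j) (MvPolynomial.pderiv j P)) y := by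
    rw [hasGradientAt_iff_hasFDerivAt, hf']
    refine (hasFDerivAt_mvpoly P y).congr_fderiv ?_
    ext v
    simp [PiLp.inner_apply]
    exact Finset.sum_congr rfl fun _ _ => by ring
  rw [h.gradient]

lemma eval_aeval_poly {d : ℕ} (p : Fin d → Polynomial ℝ) (G : MvPolynomial (Fin d) ℝ) (t : ℝ) :
    (MvPolynomial.aeval p G).eval t = MvPolynomial.eval (fun j => (p j).eval t) G := by
  induction G using MvPolynomial.induction_on with
  | C a => simp
  | add p q hp hq => simp [hp, hq]
  | mul_X p i hp => simp [hp]

lemma gdIter_poly {d Δ : ℕ} (hΔ : 2 ≤ Δ) (P : MvPolynomial (Fin d) ℝ) (hP : P.totalDegree ≤ Δ)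
    (f : EuclideanSpace ℝ (Fin d) → ℝ)
    (hf : ∀ y : EuclideanSpace ℝ (Fin d), f y = MvPolynomial.eval (fun j => y j) P)
    (x : EuclideanSpace ℝ (Fin d)) (i : ℕ) :
    ∃ p : Fin d → Polynomial ℝ, (∀ j, (p j).natDegree ≤ Δ ^ (2 * i)) ∧
      ∀ η j, gdIter f x η i j = (p j).eval η := by
  induction i with
  | zero => exact ⟨fun j => Polynomial.C (x j), by simp, by simp [gdIter]⟩
  | succ i ih =>
    obtain ⟨p, hp, hpe⟩ := ih
    refine ⟨fun j => p j - Polynomial.X * MvPolynomial.aeval p (MvPolynomial.pderiv j P),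
      fun j => ?_, fun η j => ?_⟩
    · have h1 : (MvPolynomial.aeval p (MvPolynomial.pderiv j P)).natDegree
          ≤ Δ * Δ ^ (2 * i) :=
        MvPolynomial.aeval_natDegree_le _ ((pderiv_totalDegree_le P j).trans hP) _ hp
      have h0 : 1 ≤ Δ ^ (2 * i) := Nat.one_le_pow _ _ (by omega)
      have h2 : 1 + Δ * Δ ^ (2 * i) ≤ Δ ^ (2 * (i + 1)) := by
        rw [show Δ ^ (2 * (i + 1)) = Δ * Δ * Δ ^ (2 * i) by ring]
        nlinarith [Nat.mul_le_mul hΔ h0]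
      refine (Polynomial.natDegree_sub_le _ _).trans (max_le ((hp j).trans ?_) ?_)
      · nlinarith
      · exact (Polynomial.natDegree_mul_le.trans (add_le_add Polynomial.natDegree_X_le h1)).trans h2
    · simp [gdIter, gradient_mvpoly P f hf, eval_aeval_poly, hpe]

lemma gdCost_breaks {d Δ H : ℕ} (hΔ : 2 ≤ Δ) {θ : ℝ} (hθ : 0 < θ)
    (f : EuclideanSpace ℝ (Fin d) → ℝ) (hf : IsPolyDeg Δ f) (x : EuclideanSpace ℝ (Fin d)) :
    ∃ S : Finset ℝ, S.card ≤ H * (2 * Δ ^ (2 * H)) ∧ ∀ η η' : ℝ, η ≤ η' →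
      (∀ t ∈ Set.Icc η η', t ∉ S) → gdCost H θ f x η = gdCost H θ f x η' := by
  classical
  obtain ⟨P, hP, hPe⟩ := hf
  choose p hp hpe using gdIter_poly hΔ P hP f hPe x
  let g : ℕ → Polynomial ℝ := fun i =>
    ∑ j, (MvPolynomial.aeval (p i) (MvPolynomial.pderiv j P)) ^ 2 - Polynomial.C (θ ^ 2)
  have hg : ∀ i η, ‖gradient f (gdIter f x η i)‖ < θ ↔ (g i).eval η < 0 := by
    intro i η
    rw [← sq_lt_sq₀ (norm_nonneg _) hθ.le, EuclideanSpace.norm_sq_eq]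
    simp [g, gradient_mvpoly P f hPe, eval_aeval_poly, hpe, Polynomial.eval_finsetSum]
  have hgd : ∀ i, i < H → (g i).natDegree ≤ 2 * Δ ^ (2 * H) := by
    intro i hi
    refine (Polynomial.natDegree_sub_le _ _).trans (max_le ?_ (by simp))
    refine Polynomial.natDegree_sum_le_of_forall_le _ _ fun j _ => ?_
    refine Polynomial.natDegree_pow_le.trans (Nat.mul_le_mul le_rfl ?_)
    refine (MvPolynomial.aeval_natDegree_le _ ((pderiv_totalDegree_le P j).trans hP) _
      (hp i)).trans ?_
    rw [← pow_succ']
    exact Nat.pow_le_pow_right (by omega) (by omega)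
  refine ⟨(Finset.range H).biUnion fun i => (g i).roots.toFinset, ?_, ?_⟩
  · refine (Finset.card_biUnion_le_card_mul _ _ (2 * Δ ^ (2 * H)) fun i hi => ?_).trans (by simp)
    exact (Multiset.toFinset_card_le _).trans ((Polynomial.card_roots' _).trans
      (hgd i (Finset.mem_range.1 hi)))
  · intro η η' hle hS
    have key : ∀ i < H, ((g i).eval η < 0 ↔ (g i).eval η' < 0) := by
      intro i hi
      by_cases h0 : g i = 0
      · simp [h0]
      have hne : ∀ t ∈ Set.Icc η η', (g i).eval t ≠ 0 := by
        intro t ht h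
        refine hS t ht (Finset.mem_biUnion.2 ⟨i, Finset.mem_range.2 hi, ?_⟩)
        simp [h0, h]
      have hc : ContinuousOn (fun t => (g i).eval t) (Set.Icc η η') :=
        (g i).continuous.continuousOn
      constructor
      · intro h
        by_contra h'
        push Not at h'
        obtain ⟨t, ht, h2⟩ := intermediate_value_Icc hle hc ⟨h.le, h'⟩
        exact hne t ht h2
      · intro h
        by_contra h'
        push Not at h'
        obtain ⟨t, ht, h2⟩ := intermediate_value_Icc' hle hc ⟨h.le, h'⟩
        exact hne t ht h2
    unfold gdCost
    congr 2
    ext i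
    simp only [Set.mem_ofPred_eq]
    refine and_congr_right fun h1 => and_congr_right fun h2 => ?_
    rw [hg, hg]
    exact key _ (by omega)

lemma gdCost_le {d H : ℕ} (θ : ℝ) (f : EuclideanSpace ℝ (Fin d) → ℝ)
    (x : EuclideanSpace ℝ (Fin d)) (η : ℝ) : gdCost H θ f x η ≤ H :=
  Nat.sInf_le (by simp)


def rsgn (b : Bool) : ℝ := if b then 1 else -1

lemma rad_mgf {m : ℕ} (u : Fin m → ℝ) (l : ℝ) :
    ∑ σ : Fin m → Bool, Real.exp (l * ∑ j, rsgn (σ j) * u j)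
      ≤ 2 ^ m * Real.exp (l ^ 2 * (∑ j, u j ^ 2) / 2) := by
  have h1 : ∀ σ : Fin m → Bool, Real.exp (l * ∑ j, rsgn (σ j) * u j)
      = ∏ j, Real.exp (l * (rsgn (σ j) * u j)) := by
    intro σ
    rw [← Real.exp_sum, Finset.mul_sum]
  have h2 := Finset.prod_univ_sum (fun _ : Fin m => (Finset.univ : Finset Bool))
    (fun j b => Real.exp (l * (rsgn b * u j)))
  rw [Fintype.piFinset_univ] at h2
  simp_rw [h1]
  rw [← h2]
  have h3 : ∀ j, ∑ b : Bool, Real.exp (l * (rsgn b * u j))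
      ≤ 2 * Real.exp (l ^ 2 * u j ^ 2 / 2) := by
    intro j
    have := Real.cosh_le_exp_half_sq (l * u j)
    rw [Real.cosh_eq, mul_pow] at this
    simp only [Fintype.sum_bool, rsgn]
    simp
    linarith
  calc _ ≤ ∏ j : Fin m, (2 * Real.exp (l ^ 2 * u j ^ 2 / 2)) :=
        Finset.prod_le_prod (fun j _ => Finset.sum_nonneg fun _ _ => (Real.exp_pos _).le)
          fun j _ => h3 j
    _ = _ := by
        rw [Finset.prod_mul_distrib, ← Real.exp_sum]
        simp [Finset.mul_sum, Finset.sum_div]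

lemma rad_one {m : ℕ} (u : Fin m → ℝ) {V t : ℝ} (hV : 0 < V) (ht : 0 ≤ t)
    (hu : ∑ j, u j ^ 2 ≤ V) :
    ((Finset.univ.filter fun σ : Fin m → Bool => t < ∑ j, rsgn (σ j) * u j).card : ℝ)
      ≤ 2 ^ m * Real.exp (-(t ^ 2 / (2 * V))) := by
  set l := t / V with hl
  have hl0 : 0 ≤ l := by positivity
  have h1 := rad_mgf u l
  have h2 : ((Finset.univ.filter fun σ : Fin m → Bool => t < ∑ j, rsgn (σ j) * u j).card : ℝ)
      * Real.exp (l * t) ≤ ∑ σ : Fin m → Bool, Real.exp (l * ∑ j, rsgn (σ j) * u j) := by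
    calc _ = ∑ σ ∈ (Finset.univ.filter fun σ : Fin m → Bool => t < ∑ j, rsgn (σ j) * u j),
          Real.exp (l * t) := by rw [Finset.sum_const, nsmul_eq_mul]
      _ ≤ ∑ σ ∈ (Finset.univ.filter fun σ : Fin m → Bool => t < ∑ j, rsgn (σ j) * u j),
          Real.exp (l * ∑ j, rsgn (σ j) * u j) := by
          refine Finset.sum_le_sum fun σ hσ => ?_
          rw [Finset.mem_filter] at hσ
          exact Real.exp_le_exp.2 (mul_le_mul_of_nonneg_left hσ.2.le hl0)
      _ ≤ _ := Finset.sum_le_sum_of_subset_of_nonneg (Finset.filter_subset _ _)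
          fun _ _ _ => (Real.exp_pos _).le
  have h3 : Real.exp (l ^ 2 * (∑ j, u j ^ 2) / 2) ≤ Real.exp (l ^ 2 * V / 2) :=
    Real.exp_le_exp.2 (by gcongr)
  have h4 : -(t ^ 2 / (2 * V)) = l ^ 2 * V / 2 - l * t := by
    rw [hl]; field_simp; ring
  rw [h4, Real.exp_sub, ← mul_div_assoc, le_div_iff₀ (Real.exp_pos _)]
  refine h2.trans (h1.trans ?_)
  gcongr

lemma rad_two {m : ℕ} (u : Fin m → ℝ) {V t : ℝ} (hV : 0 < V) (ht : 0 ≤ t)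
    (hu : ∑ j, u j ^ 2 ≤ V) :
    ((Finset.univ.filter fun σ : Fin m → Bool => t < |∑ j, rsgn (σ j) * u j|).card : ℝ)
      ≤ 2 ^ m * (2 * Real.exp (-(t ^ 2 / (2 * V)))) := by
  classical
  have h1 := rad_one u hV ht hu
  have h2 := rad_one (fun j => - u j) hV ht (by simpa using hu)
  have h3 : (Finset.univ.filter fun σ : Fin m → Bool => t < |∑ j, rsgn (σ j) * u j|) ⊆
      (Finset.univ.filter fun σ : Fin m → Bool => t < ∑ j, rsgn (σ j) * u j) ∪
      (Finset.univ.filter fun σ : Fin m → Bool => t < ∑ j, rsgn (σ j) * (- u j)) := by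
    intro σ
    simp only [Finset.mem_filter, Finset.mem_union, Finset.mem_univ, true_and, mul_neg,
      Finset.sum_neg_distrib]
    exact fun h => lt_abs.1 h
  have h4 : ((Finset.univ.filter fun σ : Fin m → Bool => t < |∑ j, rsgn (σ j) * u j|).card : ℝ) ≤
      (Finset.univ.filter fun σ : Fin m → Bool => t < ∑ j, rsgn (σ j) * u j).card +
      (Finset.univ.filter fun σ : Fin m → Bool => t < ∑ j, rsgn (σ j) * (- u j)).card := by
    exact_mod_cast (Finset.card_le_card h3).trans (Finset.card_union_le _ _)
  linarith

lemma chain_num (X : ℝ) (hX : 12 ≤ X) (K L : ℕ) :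
    (2 * K + 1 : ℝ) * (2 * Real.exp (-(64 * X))) +
      ∑ k ∈ Finset.range L, (2 ^ (k + 1) * (2 * K) + 1 : ℝ) *
        (2 * Real.exp (-(X * (9 / 8) ^ k))) ≤ 40 * (K + 1) * Real.exp (-X) := by
  have h0 : Real.exp (-(64 * X)) ≤ Real.exp (-X) := Real.exp_le_exp.2 (by linarith)
  have h4 : Real.exp (-(3 / 2)) ≤ 1 / 4 := by
    have h : (4 : ℝ) ≤ Real.exp (3 / 2) := by
      have h5 := Real.exp_one_gt_d9
      have h6 := Real.add_one_le_exp (1 / 2 : ℝ)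
      rw [show (3 / 2 : ℝ) = 1 + 1 / 2 by norm_num, Real.exp_add]
      nlinarith
    rw [Real.exp_neg, ← one_div]
    exact one_div_le_one_div_of_le (by norm_num) h
  have h1 : ∀ k ∈ Finset.range L, (2 ^ (k + 1) * (2 * K) + 1 : ℝ) *
        (2 * Real.exp (-(X * (9 / 8) ^ k))) ≤
        (2 * (4 * K + 1) * Real.exp (-X)) * (1 / 2) ^ k := by
    intro k _
    have hb : 1 + (k : ℝ) * (1 / 8) ≤ (9 / 8) ^ k := by
      have := one_add_mul_le_pow (show (-2 : ℝ) ≤ 1 / 8 by norm_num) k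
      norm_num at this ⊢
      linarith
    have he : Real.exp (-(X * (9 / 8) ^ k)) ≤ Real.exp (-X) * (1 / 4) ^ k := by
      calc _ ≤ Real.exp (-X + k * (-(3 / 2))) := by
            apply Real.exp_le_exp.2
            have hk : (0 : ℝ) ≤ k := Nat.cast_nonneg k
            nlinarith
        _ = Real.exp (-X) * Real.exp (-(3 / 2)) ^ k := by
            rw [Real.exp_add, Real.exp_nat_mul]
        _ ≤ _ := by gcongr
    have h2k : (1 : ℝ) ≤ 2 ^ k := one_le_pow₀ (by norm_num)
    have h5 : (2 ^ (k + 1) * (2 * K) + 1 : ℝ) ≤ (4 * K + 1) * 2 ^ k := by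
      rw [pow_succ]; nlinarith
    calc _ ≤ ((4 * K + 1) * 2 ^ k) * (2 * (Real.exp (-X) * (1 / 4) ^ k)) := by gcongr
      _ = (2 * (4 * K + 1) * Real.exp (-X)) * (2 ^ k * (1 / 4) ^ k) := by ring
      _ = _ := by rw [← mul_pow]; norm_num
  have h2 : ∑ k ∈ Finset.range L, ((1 : ℝ) / 2) ^ k ≤ 2 := sum_geometric_two_le L
  have hE := Real.exp_pos (-X)
  have h3 := Finset.sum_le_sum h1
  rw [← Finset.mul_sum] at h3
  have h6 : (2 * (4 * K + 1) * Real.exp (-X)) * ∑ k ∈ Finset.range L, ((1 : ℝ) / 2) ^ k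
      ≤ (2 * (4 * K + 1) * Real.exp (-X)) * 2 := by gcongr
  have h7 : (2 * K + 1 : ℝ) * (2 * Real.exp (-(64 * X))) ≤ (2 * K + 1 : ℝ) * (2 * Real.exp (-X)) := by
    gcongr
  have : (0 : ℝ) ≤ K := Nat.cast_nonneg K
  nlinarith [mul_nonneg this hE.le]

lemma chain_lemma {m : ℕ} (hm : 0 < m) (K : ℕ) {H ε : ℝ} (hH : 0 < H) (hε : 0 < ε)
    {I : Type*} [Nonempty I] (v : I → Fin m → ℝ) (hv : ∀ i j, |v i j| ≤ H)
    (c : I → ℕ) (hc : ∀ i, c i ≤ 2 * K * m)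
    (hd : ∀ i i', c i ≤ c i' → (Finset.univ.filter fun j => v i j ≠ v i' j).card ≤ c i' - c i)
    (hX : 12 ≤ m * ε ^ 2 / (2048 * H ^ 2)) :
    (Nat.card {σ : Fin m → Bool // ∃ i, m * ε / 2 < |∑ j, rsgn (σ j) * v i j|} : ℝ)
      ≤ 2 ^ m * (40 * (K + 1) * Real.exp (-(m * ε ^ 2 / (2048 * H ^ 2)))) := by
  classical
  have hmR : (0 : ℝ) < m := by exact_mod_cast hm
  set X := m * ε ^ 2 / (2048 * H ^ 2) with hXdef
  let b : ℕ → I → ℕ := fun k i => 2 ^ k * c i / m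
  have hb2 : ∀ k i, b (k + 1) i / 2 = b k i := by
    intro k i
    simp only [b]
    rw [Nat.div_div_eq_div_mul, pow_succ, mul_comm m 2, mul_comm (2 ^ k) 2, mul_assoc,
      Nat.mul_div_mul_left _ _ (by norm_num)]
  have hbK : ∀ k i, b k i ∈ Finset.range (2 ^ k * (2 * K) + 1) := by
    intro k i
    rw [Finset.mem_range, Nat.lt_succ_iff]
    apply Nat.div_le_of_le_mul
    calc 2 ^ k * c i ≤ 2 ^ k * (2 * K * m) := Nat.mul_le_mul le_rfl (hc i)
      _ = _ := by ring
  have hclose : ∀ k i i', b k i = b k i' →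
      2 ^ k * (Finset.univ.filter fun j => v i j ≠ v i' j).card < m := by
    have aux : ∀ k i i', c i ≤ c i' → b k i = b k i' →
        2 ^ k * (Finset.univ.filter fun j => v i j ≠ v i' j).card < m := by
      intro k i i' hle h
      refine lt_of_le_of_lt (Nat.mul_le_mul le_rfl (hd i i' hle)) ?_
      have h1 := Nat.div_add_mod (2 ^ k * c i) m
      have h2 := Nat.div_add_mod (2 ^ k * c i') m
      have h3 := Nat.mod_lt (2 ^ k * c i') hm
      simp only [b] at h
      rw [h] at h1
      rw [Nat.mul_sub]
      omega
    intro k i i' h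
    rcases le_total (c i) (c i') with hle | hle
    · exact aux k i i' hle h
    · have := aux k i' i hle h.symm
      simpa [ne_comm] using this
  let rep : ℕ → ℕ → I := fun k β =>
    if h : ∃ i, b k i = β then h.choose else Classical.arbitrary I
  have hrep : ∀ k i, b k (rep k (b k i)) = b k i := by
    intro k i
    have h : ∃ i', b k i' = b k i := ⟨i, rfl⟩
    simp only [rep, dif_pos h]
    exact h.choose_spec
  let Bad0 : ℕ → Finset (Fin m → Bool) := fun β => Finset.univ.filter fun σ =>
    m * ε / 4 < |∑ j, rsgn (σ j) * v (rep 0 β) j|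
  let Bad : ℕ → ℕ → Finset (Fin m → Bool) := fun k β => Finset.univ.filter fun σ =>
    m * ε / 16 * (3 / 4) ^ k <
      |∑ j, rsgn (σ j) * (v (rep (k + 1) β) j - v (rep k (β / 2)) j)|
  let T : ℕ → Finset ℕ := fun k =>
    (Finset.range (2 ^ (k + 1) * (2 * K) + 1)).filter fun β => ∃ i, b (k + 1) i = β
  let All : Finset (Fin m → Bool) := (Finset.range (2 * K + 1)).biUnion Bad0 ∪
    (Finset.range m).biUnion fun k => (T k).biUnion (Bad k)
  have hsub : (Finset.univ.filter fun σ : Fin m → Bool =>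
      ∃ i, m * ε / 2 < |∑ j, rsgn (σ j) * v i j|) ⊆ All := by
    intro σ hσ
    by_contra hA
    obtain ⟨i, hi⟩ := (Finset.mem_filter.1 hσ).2
    simp only [All, Finset.mem_union, Finset.mem_biUnion, not_or, not_exists, not_and] at hA
    obtain ⟨hA0, hA1⟩ := hA
    have claim : ∀ k ≤ m, |∑ j, rsgn (σ j) * v (rep k (b k i)) j| ≤
        m * ε / 4 + m * ε / 4 * (1 - (3 / 4) ^ k) := by
      intro k
      induction k with
      | zero =>
        intro _
        have := hA0 (b 0 i) (by simpa using hbK 0 i)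
        simp only [Bad0, Finset.mem_filter, Finset.mem_univ, true_and, not_lt] at this
        simpa using this
      | succ k ih =>
        intro hk
        have h1 := ih (by omega)
        have h2 := hA1 k (Finset.mem_range.2 (by omega)) (b (k + 1) i)
          (Finset.mem_filter.2 ⟨hbK _ _, i, rfl⟩)
        simp only [Bad, Finset.mem_filter, Finset.mem_univ, true_and, not_lt, hb2] at h2
        have h3 : ∑ j, rsgn (σ j) * v (rep (k + 1) (b (k + 1) i)) j =
          ∑ j, rsgn (σ j) * (v (rep (k + 1) (b (k + 1) i)) j - v (rep k (b k i)) j) +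
          ∑ j, rsgn (σ j) * v (rep k (b k i)) j := by
          rw [← Finset.sum_add_distrib]
          exact Finset.sum_congr rfl fun _ _ => by ring
        rw [h3]
        refine (abs_add_le _ _).trans ((add_le_add h2 h1).trans (le_of_eq ?_))
        rw [pow_succ]; ring
    have hfin : ∀ j, v (rep m (b m i)) j = v i j := by
      have h1 := hclose m _ _ (hrep m i)
      have h2 : m < 2 ^ m := Nat.lt_two_pow_self
      have h3 : (Finset.univ.filter fun j => v (rep m (b m i)) j ≠ v i j).card = 0 := by
        by_contra h
        have : 1 ≤ (Finset.univ.filter fun j => v (rep m (b m i)) j ≠ v i j).card := by omega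
        have := Nat.mul_le_mul (le_refl (2 ^ m)) this
        omega
      rw [Finset.card_eq_zero, Finset.filter_eq_empty_iff] at h3
      intro j
      simpa using h3 (Finset.mem_univ j)
    have h1 := claim m le_rfl
    simp only [hfin] at h1
    have : 0 < m * ε / 4 * (3 / 4) ^ m := by positivity
    linarith
  have hBad0 : ∀ β, ((Bad0 β).card : ℝ) ≤ 2 ^ m * (2 * Real.exp (-(64 * X))) := by
    intro β
    have := rad_two (v (rep 0 β)) (V := H ^ 2 * m) (t := m * ε / 4) (by positivity)
      (by positivity) (by
        calc ∑ j, v (rep 0 β) j ^ 2 ≤ ∑ j : Fin m, H ^ 2 :=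
              Finset.sum_le_sum fun j _ => sq_le_sq' (abs_le.1 (hv _ j)).1 (abs_le.1 (hv _ j)).2
          _ = _ := by simp [mul_comm])
    convert this using 5
    rw [hXdef]; field_simp; norm_num
  have hBad : ∀ k, ∀ β ∈ T k, ((Bad k β).card : ℝ) ≤
      2 ^ m * (2 * Real.exp (-(X * (9 / 8) ^ k))) := by
    intro k β hβ
    obtain ⟨i, rfl⟩ := (Finset.mem_filter.1 hβ).2
    have hcl : b k (rep (k + 1) (b (k + 1) i)) = b k (rep k (b (k + 1) i / 2)) := by
      rw [hb2, hrep, ← hb2, hrep, hb2]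
    have h1 := hclose k _ _ hcl
    have h1R : (2 : ℝ) ^ k * ((Finset.univ.filter fun j => v (rep (k + 1) (b (k + 1) i)) j ≠
        v (rep k (b (k + 1) i / 2)) j).card : ℝ) ≤ m := by exact_mod_cast h1.le
    have := rad_two (fun j => v (rep (k + 1) (b (k + 1) i)) j - v (rep k (b (k + 1) i / 2)) j)
      (V := 4 * H ^ 2 * m / 2 ^ k) (t := m * ε / 16 * (3 / 4) ^ k) (by positivity)
      (by positivity) (by
        calc ∑ j, (v (rep (k + 1) (b (k + 1) i)) j - v (rep k (b (k + 1) i / 2)) j) ^ 2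
            ≤ ∑ j, (if v (rep (k + 1) (b (k + 1) i)) j ≠ v (rep k (b (k + 1) i / 2)) j
              then 4 * H ^ 2 else 0) := by
              refine Finset.sum_le_sum fun j _ => ?_
              split_ifs with h
              · have h2 := abs_le.1 (hv (rep (k + 1) (b (k + 1) i)) j)
                have h3 := abs_le.1 (hv (rep k (b (k + 1) i / 2)) j)
                nlinarith
              · push Not at h
                rw [h]; simp
          _ = ((Finset.univ.filter fun j => v (rep (k + 1) (b (k + 1) i)) j ≠
                v (rep k (b (k + 1) i / 2)) j).card : ℝ) * (4 * H ^ 2) := by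
              rw [← Finset.sum_filter, Finset.sum_const, nsmul_eq_mul]
          _ ≤ _ := by
              rw [le_div_iff₀ (by positivity)]
              have : 0 ≤ 4 * H ^ 2 := by positivity
              nlinarith)
    convert this using 5
    rw [hXdef, show (9 / 8 : ℝ) = (3 / 4) * (3 / 4) * 2 by norm_num, mul_pow, mul_pow]
    field_simp
    norm_num
  have hcard : (All.card : ℝ) ≤ 2 ^ m * ((2 * K + 1 : ℝ) * (2 * Real.exp (-(64 * X))) +
      ∑ k ∈ Finset.range m, (2 ^ (k + 1) * (2 * K) + 1 : ℝ) *
        (2 * Real.exp (-(X * (9 / 8) ^ k)))) := by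
    have h1 : (((Finset.range (2 * K + 1)).biUnion Bad0).card : ℝ) ≤
        (2 * K + 1) * (2 ^ m * (2 * Real.exp (-(64 * X)))) := by
      calc _ ≤ ∑ β ∈ Finset.range (2 * K + 1), ((Bad0 β).card : ℝ) := by
            exact_mod_cast Finset.card_biUnion_le
        _ ≤ ∑ β ∈ Finset.range (2 * K + 1), 2 ^ m * (2 * Real.exp (-(64 * X))) :=
            Finset.sum_le_sum fun β _ => hBad0 β
        _ = _ := by simp
    have h2 : ((((Finset.range m).biUnion fun k => (T k).biUnion (Bad k))).card : ℝ) ≤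
        ∑ k ∈ Finset.range m, (2 ^ (k + 1) * (2 * K) + 1 : ℝ) *
          (2 ^ m * (2 * Real.exp (-(X * (9 / 8) ^ k)))) := by
      calc _ ≤ ∑ k ∈ Finset.range m, (((T k).biUnion (Bad k)).card : ℝ) := by
            exact_mod_cast Finset.card_biUnion_le
        _ ≤ _ := by
            refine Finset.sum_le_sum fun k _ => ?_
            calc _ ≤ ∑ β ∈ T k, ((Bad k β).card : ℝ) := by
                  exact_mod_cast Finset.card_biUnion_le
              _ ≤ ∑ β ∈ T k, 2 ^ m * (2 * Real.exp (-(X * (9 / 8) ^ k))) :=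
                  Finset.sum_le_sum fun β hβ => hBad k β hβ
              _ = ((T k).card : ℝ) * (2 ^ m * (2 * Real.exp (-(X * (9 / 8) ^ k)))) := by simp
              _ ≤ _ := by
                  gcongr
                  have : (T k).card ≤ 2 ^ (k + 1) * (2 * K) + 1 :=
                    (Finset.card_filter_le _ _).trans (by simp)
                  exact_mod_cast this
    have h3 : (All.card : ℝ) ≤ (((Finset.range (2 * K + 1)).biUnion Bad0).card : ℝ) +
        ((((Finset.range m).biUnion fun k => (T k).biUnion (Bad k))).card : ℝ) := by
      exact_mod_cast Finset.card_union_le _ _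
    refine h3.trans ((add_le_add h1 h2).trans (le_of_eq ?_))
    rw [mul_add, Finset.mul_sum]
    congr 1
    · ring
    · exact Finset.sum_congr rfl fun _ _ => by ring
  rw [Nat.card_eq_fintype_card, Fintype.card_subtype]
  calc _ ≤ (All.card : ℝ) := by exact_mod_cast Finset.card_le_card hsub
    _ ≤ _ := hcard
    _ ≤ _ := by
      gcongr
      exact chain_num X hX K m


lemma cheb_half {Ω : Type*} [MeasurableSpace Ω] (D : Measure Ω) [IsProbabilityMeasure D]
    {m : ℕ} (hm : 0 < m) {H ε : ℝ} (hH : 0 < H) (hε : 0 < ε) (g : Ω → ℝ) (hg : Measurable g)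
    (hg0 : ∀ z, 0 ≤ g z) (hgH : ∀ z, g z ≤ H)
    (hX : 12 ≤ m * ε ^ 2 / (2048 * H ^ 2)) :
    1 / 2 ≤ (Measure.pi fun _ : Fin m => D)
      {s | |(∑ j, g (s j)) / m - ∫ z, g z ∂D| ≤ ε / 2} := by
  have hmR : (0 : ℝ) < m := by exact_mod_cast hm
  have hmem : MemLp g 2 D :=
    MemLp.of_bound hg.aestronglyMeasurable H
      (Filter.Eventually.of_forall fun z => by rw [Real.norm_eq_abs, abs_of_nonneg (hg0 z)]; exact hgH z)
  have hgint : Integrable g D := hmem.integrable (by norm_num)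
  set μ := (Measure.pi fun _ : Fin m => D) with hμ
  have hmemj : ∀ j : Fin m, MemLp (fun s : Fin m → Ω => g (s j)) 2 μ := fun j =>
    hmem.comp_measurePreserving (measurePreserving_eval (fun _ : Fin m => D) j)
  have hE : ∫ s, (∑ j, fun s : Fin m → Ω => g (s j)) s ∂μ = m * ∫ z, g z ∂D := by
    simp only [Finset.sum_apply]
    rw [integral_finsetSum _ fun j _ => (hmemj j).integrable (by norm_num)]
    have : ∀ j : Fin m, ∫ s, g (s j) ∂μ = ∫ z, g z ∂D := fun j => by
      have h := (measurePreserving_eval (fun _ : Fin m => D) j)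
      rw [← h.map_eq, integral_map h.measurable.aemeasurable hg.aestronglyMeasurable]
    simp [this]
  have hV : ProbabilityTheory.variance (∑ j, fun s : Fin m → Ω => g (s j)) μ ≤ m * (H / 2) ^ 2 := by
    rw [ProbabilityTheory.variance_sum_pi (fun _ => hmem)]
    have := ProbabilityTheory.variance_le_sq_of_bounded (μ := D) (X := g) (a := 0) (b := H)
      (Filter.Eventually.of_forall fun z => ⟨hg0 z, hgH z⟩) hg.aemeasurable
    simp only [Finset.sum_const, Finset.card_univ, Fintype.card_fin, nsmul_eq_mul]
    rw [sub_zero] at this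
    gcongr
  have hc := ProbabilityTheory.meas_ge_le_variance_div_sq (μ := μ)
    (memLp_finsetSum' Finset.univ fun j _ => hmemj j) (c := m * ε / 2) (by positivity)
  rw [hE] at hc
  have hc2 : μ {s | |(∑ j, g (s j)) / m - ∫ z, g z ∂D| ≤ ε / 2}ᶜ ≤ 1 / 2 := by
    refine (measure_mono ?_).trans (hc.trans ?_)
    · intro s hs
      simp only [Set.mem_compl_iff, Set.mem_ofPred_eq, not_le] at hs
      simp only [Set.mem_ofPred_eq, Finset.sum_apply]
      have : (∑ j, g (s j)) - m * ∫ z, g z ∂D = m * ((∑ j, g (s j)) / m - ∫ z, g z ∂D) := by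
        field_simp
      rw [this, abs_mul, abs_of_pos hmR]
      nlinarith
    · rw [show (1 / 2 : ENNReal) = ENNReal.ofReal (1 / 2) by
        rw [ENNReal.ofReal_div_of_pos (by norm_num)]; simp]
      apply ENNReal.ofReal_le_ofReal
      rw [div_le_iff₀ (by positivity)]
      refine hV.trans ?_
      rw [le_div_iff₀ (by positivity)] at hX
      nlinarith [sq_nonneg H, sq_nonneg (m * ε)]
  have hms : MeasurableSet {s : Fin m → Ω | |(∑ j, g (s j)) / m - ∫ z, g z ∂D| ≤ ε / 2} := by
    refine measurableSet_le ?_ measurable_const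
    fun_prop
  rw [prob_compl_eq_one_sub hms] at hc2
  have h1 := tsub_le_iff_right.1 hc2
  have h2 : (1 : ENNReal) / 2 + 1 / 2 ≤
      1 / 2 + μ {s | |(∑ j, g (s j)) / m - ∫ z, g z ∂D| ≤ ε / 2} := by
    rw [ENNReal.add_halves]; exact h1
  exact (ENNReal.add_le_add_iff_left (by simp)).1 h2

lemma sym_bound {Ω : Type*} [MeasurableSpace Ω] (D : Measure Ω) [IsProbabilityMeasure D]
    {m : ℕ} (hm : 0 < m) (K : ℕ) {H ε : ℝ} (hH : 0 < H) (hε : 0 < ε) (Q : Finset ℝ)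
    (f : ℝ → Ω → ℝ) (hf : ∀ q ∈ Q, Measurable (f q))
    (hf0 : ∀ q z, 0 ≤ f q z) (hfH : ∀ q z, f q z ≤ H)
    (c : Ω → ℝ → ℕ) (hmono : ∀ z, Monotone (c z)) (hcK : ∀ z a, c z a ≤ K)
    (hceq : ∀ z a b, c z a = c z b → f a z = f b z)
    (hX : 12 ≤ m * ε ^ 2 / (2048 * H ^ 2)) :
    (Measure.pi fun _ : Fin m => D.prod D)
      {w | ∃ q ∈ Q, m * ε / 2 < |∑ j, (f q (w j).1 - f q (w j).2)|}
      ≤ ENNReal.ofReal (40 * (K + 1) * Real.exp (-(m * ε ^ 2 / (2048 * H ^ 2)))) := by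
  classical
  set ν := (Measure.pi fun _ : Fin m => D.prod D) with hν
  set p := (40 * (K + 1) * Real.exp (-(m * ε ^ 2 / (2048 * H ^ 2)))) with hp
  set B : Set (Fin m → Ω × Ω) :=
    {w | ∃ q ∈ Q, m * ε / 2 < |∑ j, (f q (w j).1 - f q (w j).2)|} with hB
  have hBm : MeasurableSet B := by
    have : B = ⋃ q ∈ Q, {w | m * ε / 2 < |∑ j, (f q (w j).1 - f q (w j).2)|} := by
      ext w; simp [hB]
    rw [this]
    refine Finset.measurableSet_biUnion _ fun q hq => ?_
    have := hf q hq
    refine measurableSet_lt measurable_const ?_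
    fun_prop
  let sw : (Fin m → Bool) → (Fin m → Ω × Ω) → (Fin m → Ω × Ω) := fun σ w j =>
    if σ j then w j else (w j).swap
  have hsw : ∀ σ, MeasurePreserving (sw σ) ν ν := by
    intro σ
    refine measurePreserving_pi (f := fun j (x : Ω × Ω) => if σ j then x else x.swap) _ _ fun j => ?_
    by_cases h : σ j
    · simp only [h, if_true]; exact MeasurePreserving.id _
    · simp only [h]; exact Measure.measurePreserving_swap
  have hcount : ∀ w, (Nat.card {σ : Fin m → Bool // sw σ w ∈ B} : ℝ) ≤ 2 ^ m * p := by
    intro w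
    have hmono' : Monotone fun a => ∑ j, (c (w j).1 a + c (w j).2 a) := fun a b hab =>
      Finset.sum_le_sum fun j _ => add_le_add (hmono _ hab) (hmono _ hab)
    have aux : ∀ a b, a ≤ b → (Finset.univ.filter fun j =>
        f a (w j).1 - f a (w j).2 ≠ f b (w j).1 - f b (w j).2).card ≤
        ∑ j, (c (w j).1 b + c (w j).2 b) - ∑ j, (c (w j).1 a + c (w j).2 a) := by
      intro a b hab
      rw [← Finset.sum_tsub_distrib _ fun j _ => add_le_add (hmono _ hab) (hmono _ hab),
        Finset.card_filter]
      refine Finset.sum_le_sum fun j _ => ?_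
      have h1 := hmono (w j).1 hab
      have h2 := hmono (w j).2 hab
      split_ifs with h
      · by_contra h3
        refine h ?_
        rw [hceq (w j).1 a b (by omega), hceq (w j).2 a b (by omega)]
      · exact Nat.zero_le _
    have := chain_lemma hm K hH hε (I := ℝ) (fun q j => f q (w j).1 - f q (w j).2)
      (fun q j => by
        have h1 := hf0 q (w j).1
        have h2 := hf0 q (w j).2
        have h3 := hfH q (w j).1
        have h4 := hfH q (w j).2
        rw [abs_le]; constructor <;> linarith)
      (fun a => ∑ j, (c (w j).1 a + c (w j).2 a))
      (fun a => by
        calc _ ≤ ∑ j : Fin m, (K + K) :=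
              Finset.sum_le_sum fun j _ => add_le_add (hcK _ _) (hcK _ _)
          _ = _ := by simp; ring)
      (fun a b hab => by
        rcases le_total a b with h | h
        · exact aux a b h
        · have h1 := aux b a h
          have h2 := hmono' h
          simp only at h2 hab
          simp only [ne_comm] at h1 ⊢
          omega) hX
    refine le_trans ?_ this
    rw [Nat.cast_le]
    refine Nat.card_le_card_of_injective
      (fun σ => ⟨σ.1, ?_⟩) (fun σ τ h => Subtype.ext (by simpa using h))
    obtain ⟨q, hq, h⟩ := σ.2
    refine ⟨q, ?_⟩
    convert h using 2
    refine Finset.sum_congr rfl fun j _ => ?_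
    simp only [sw, rsgn]
    by_cases hj : σ.1 j <;> simp [hj]
  have h1 : ∀ σ, ν B = ∫⁻ w, (if sw σ w ∈ B then 1 else 0) ∂ν := by
    intro σ
    rw [← (hsw σ).measure_preimage hBm.nullMeasurableSet,
      ← lintegral_indicator_one ((hsw σ).measurable hBm)]
    refine lintegral_congr fun w => ?_
    simp [Set.indicator_apply]
  have h2 : (2 : ENNReal) ^ m * ν B ≤ 2 ^ m * ENNReal.ofReal p := by
    calc (2 : ENNReal) ^ m * ν B = ∑ σ : Fin m → Bool, ν B := by simp
      _ = ∑ σ : Fin m → Bool, ∫⁻ w, (if sw σ w ∈ B then 1 else 0) ∂ν :=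
          Finset.sum_congr rfl fun σ _ => h1 σ
      _ = ∫⁻ w, ∑ σ : Fin m → Bool, (if sw σ w ∈ B then 1 else 0) ∂ν := by
          rw [lintegral_finsetSum]
          intro σ _
          exact Measurable.ite ((hsw σ).measurable hBm) measurable_const measurable_const
      _ ≤ ∫⁻ w, ENNReal.ofReal (2 ^ m * p) ∂ν := by
          refine lintegral_mono fun w => ?_
          have := hcount w
          rw [Nat.card_eq_fintype_card, Fintype.card_subtype] at this
          rw [Finset.sum_boole, ← ENNReal.ofReal_natCast]
          exact ENNReal.ofReal_le_ofReal this
      _ = ENNReal.ofReal (2 ^ m * p) := by simp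
      _ = _ := by rw [ENNReal.ofReal_mul (by positivity), ENNReal.ofReal_pow (by norm_num)]; simp
  exact (ENNReal.mul_le_mul_iff_right (by simp) (by simp)).1 h2

lemma finite_bound {Ω : Type*} [MeasurableSpace Ω] (D : Measure Ω) [IsProbabilityMeasure D]
    {m : ℕ} (hm : 0 < m) (K : ℕ) {H ε : ℝ} (hH : 0 < H) (hε : 0 < ε) (Q : Finset ℝ)
    (f : ℝ → Ω → ℝ) (hf : ∀ q ∈ Q, Measurable (f q))
    (hf0 : ∀ q z, 0 ≤ f q z) (hfH : ∀ q z, f q z ≤ H)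
    (c : Ω → ℝ → ℕ) (hmono : ∀ z, Monotone (c z)) (hcK : ∀ z a, c z a ≤ K)
    (hceq : ∀ z a b, c z a = c z b → f a z = f b z)
    (hX : 12 ≤ m * ε ^ 2 / (2048 * H ^ 2)) :
    (Measure.pi fun _ : Fin m => D)
      {s | ∃ q ∈ Q, ε < |(∑ j, f q (s j)) / m - ∫ z, f q z ∂D|}
      ≤ ENNReal.ofReal (80 * (K + 1) * Real.exp (-(m * ε ^ 2 / (2048 * H ^ 2)))) := by
  have hmR : (0 : ℝ) < m := by exact_mod_cast hm
  have hsym := sym_bound D hm K hH hε Q f hf hf0 hfH c hmono hcK hceq hX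
  set μ := (Measure.pi fun _ : Fin m => D) with hμ
  set A : Set (Fin m → Ω) := {s | ∃ q ∈ Q, ε < |(∑ j, f q (s j)) / m - ∫ z, f q z ∂D|} with hA
  have hAm : MeasurableSet A := by
    have : A = ⋃ q ∈ Q, {s | ε < |(∑ j, f q (s j)) / m - ∫ z, f q z ∂D|} := by
      ext w; simp [hA]
    rw [this]
    refine Finset.measurableSet_biUnion _ fun q hq => ?_
    have := hf q hq
    refine measurableSet_lt measurable_const ?_
    fun_prop
  set B' : Set ((Fin m → Ω) × (Fin m → Ω)) :=
    {w | ∃ q ∈ Q, m * ε / 2 < |∑ j, (f q (w.1 j) - f q (w.2 j))|} with hB'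
  have hBm : MeasurableSet B' := by
    have : B' = ⋃ q ∈ Q, {w | m * ε / 2 < |∑ j, (f q (w.1 j) - f q (w.2 j))|} := by
      ext w; simp [hB']
    rw [this]
    refine Finset.measurableSet_biUnion _ fun q hq => ?_
    have := hf q hq
    refine measurableSet_lt measurable_const ?_
    fun_prop
  have hBB : (μ.prod μ) B' ≤ ENNReal.ofReal
      (40 * (K + 1) * Real.exp (-(m * ε ^ 2 / (2048 * H ^ 2)))) := by
    refine le_trans (le_of_eq ?_) hsym
    rw [← (measurePreserving_arrowProdEquivProdArrow Ω Ω (Fin m) (fun _ => D)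
      (fun _ => D)).measure_preimage hBm.nullMeasurableSet]
    rfl
  have h1 : μ A ≤ 2 * (μ.prod μ) B' := by
    rw [Measure.prod_apply hBm, ← lintegral_const_mul _ (measurable_measure_prodMk_left hBm),
      ← lintegral_indicator_one hAm]
    refine lintegral_mono fun s => ?_
    by_cases hs : s ∈ A
    · rw [Set.indicator_of_mem hs]
      obtain ⟨q, hq, hdev⟩ := hs
      have hch := cheb_half D hm hH hε (f q) (hf q hq) (hf0 q) (hfH q) hX
      have hle : 1 / 2 ≤ μ (Prod.mk s ⁻¹' B') := by
        refine hch.trans (measure_mono fun s' hs' => ⟨q, hq, ?_⟩)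
        simp only [Set.mem_ofPred_eq] at hs'
        rw [Finset.sum_sub_distrib]
        have h3 : ∑ j, f q (s j) - ∑ j, f q (s' j) =
          m * (((∑ j, f q (s j)) / m - ∫ z, f q z ∂D) - ((∑ j, f q (s' j)) / m - ∫ z, f q z ∂D)) := by
          field_simp
          ring
        simp only
        rw [h3, abs_mul, abs_of_pos hmR]
        have := abs_sub_abs_le_abs_sub ((∑ j, f q (s j)) / m - ∫ z, f q z ∂D)
          ((∑ j, f q (s' j)) / m - ∫ z, f q z ∂D)
        nlinarith
      calc (1 : ENNReal) = 2 * (1 / 2) := by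
            rw [one_div, ENNReal.mul_inv_cancel] <;> simp
        _ ≤ _ := by gcongr
    · rw [Set.indicator_of_notMem hs]; exact zero_le
  refine h1.trans ?_
  calc _ ≤ 2 * ENNReal.ofReal (40 * (K + 1) * Real.exp (-(m * ε ^ 2 / (2048 * H ^ 2)))) := by gcongr
    _ = _ := by
      rw [show (2 : ENNReal) = ENNReal.ofReal 2 by simp, ← ENNReal.ofReal_mul (by norm_num)]
      congr 1; ring


lemma coinc_null {Ω : Type*} [MeasurableSpace Ω] (D : Measure Ω) [IsProbabilityMeasure D]
    (R : Ω → Ω → Prop)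
    (hR : ∀ z, ∃ N, MeasurableSet N ∧ D N = 0 ∧ ∀ z', R z z' → z' ∈ N) :
    ∀ (m : ℕ) (B : Set (Fin m → Ω)), MeasurableSet B →
      (∀ s ∈ B, ∃ j k, j < k ∧ R (s j) (s k)) → (Measure.pi fun _ : Fin m => D) B = 0 := by
  intro m
  induction m with
  | zero =>
    intro B _ hB
    have : B = ∅ := Set.eq_empty_of_forall_notMem fun s hs => by
      obtain ⟨j, _⟩ := hB s hs
      exact j.elim0
    simp [this]
  | succ m ih =>
    intro B hBm hB
    have hmp := (measurePreserving_piFinSuccAbove (fun _ : Fin (m + 1) => D) 0).symm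
    rw [← hmp.measure_preimage hBm.nullMeasurableSet]
    have hm' := hmp.measurable hBm
    rw [Measure.measure_prod_null hm']
    refine Filter.Eventually.of_forall fun z => ?_
    obtain ⟨N, hNm, hN0, hN⟩ := hR z
    simp only [Pi.zero_apply]
    set E := Prod.mk z ⁻¹' ((MeasurableEquiv.piFinSuccAbove (fun _ : Fin (m + 1) => Ω) 0).symm ⁻¹' B)
      with hE
    have hEm : MeasurableSet E := measurable_prodMk_left hm'
    set U : Set (Fin m → Ω) := ⋃ k, {s | s k ∈ N} with hU
    have hUm : MeasurableSet U := MeasurableSet.iUnion fun k => measurable_pi_apply k hNm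
    have hU0 : (Measure.pi fun _ : Fin m => D) U = 0 := by
      rw [hU, measure_iUnion_null_iff]
      intro k
      have := (measurePreserving_eval (fun _ : Fin m => D) k).measure_preimage hNm.nullMeasurableSet
      rw [hN0] at this
      exact this
    have h1 := ih (E \ U) (hEm.diff hUm) (by
      rintro s ⟨hs, hsU⟩
      obtain ⟨j, k, hjk, hr⟩ := hB _ hs
      have e0 : (MeasurableEquiv.piFinSuccAbove (fun _ : Fin (m + 1) => Ω) 0).symm (z, s)
        = (Fin.cons z s : Fin (m + 1) → Ω) := by
        simp [MeasurableEquiv.piFinSuccAbove]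
        rfl
      rw [e0] at hr
      have hk : k ≠ 0 := fun h => by subst h; exact absurd hjk (Fin.not_lt_zero j)
      obtain ⟨k, rfl⟩ := Fin.exists_succ_eq.2 hk
      rcases Fin.eq_zero_or_eq_succ j with rfl | ⟨j, rfl⟩
      · exfalso
        refine hsU (Set.mem_iUnion.2 ⟨k, ?_⟩)
        simpa using hN _ hr
      · exact ⟨j, k, Fin.succ_lt_succ_iff.1 hjk, by simpa using hr⟩)
    refine measure_mono_null (t := (E \ U) ∪ U) (fun s hs => ?_) (measure_union_null h1 hU0)
    by_cases h : s ∈ U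
    · exact Or.inr h
    · exact Or.inl ⟨hs, h⟩

lemma countable_bound {Ω : Type*} [MeasurableSpace Ω] (D : Measure Ω) [IsProbabilityMeasure D]
    {m : ℕ} (hm : 0 < m) (K : ℕ) {H ε : ℝ} (hH : 0 < H) (hε : 0 < ε) (Q : Set ℝ)
    (hQ : Q.Countable)
    (f : ℝ → Ω → ℝ) (hf : ∀ q ∈ Q, Measurable (f q))
    (hf0 : ∀ q z, 0 ≤ f q z) (hfH : ∀ q z, f q z ≤ H)
    (c : Ω → ℝ → ℕ) (hmono : ∀ z, Monotone (c z)) (hcK : ∀ z a, c z a ≤ K)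
    (hceq : ∀ z a b, c z a = c z b → f a z = f b z)
    (hX : 12 ≤ m * ε ^ 2 / (2048 * H ^ 2)) :
    (Measure.pi fun _ : Fin m => D)
      {s | ∃ q ∈ Q, ε < |(∑ j, f q (s j)) / m - ∫ z, f q z ∂D|}
      ≤ ENNReal.ofReal (80 * (K + 1) * Real.exp (-(m * ε ^ 2 / (2048 * H ^ 2)))) := by
  classical
  rcases Q.eq_empty_or_nonempty with rfl | hne
  · simp
  obtain ⟨e, rfl⟩ := hQ.exists_eq_range hne
  have h1 : {s : Fin m → Ω | ∃ q ∈ Set.range e, ε < |(∑ j, f q (s j)) / m - ∫ z, f q z ∂D|} =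
      ⋃ n : ℕ, {s | ∃ q ∈ (Finset.range n).image e,
        ε < |(∑ j, f q (s j)) / m - ∫ z, f q z ∂D|} := by
    ext s
    simp only [Set.mem_ofPred_eq, Set.mem_iUnion, Set.mem_range, Finset.mem_image,
      Finset.mem_range]
    constructor
    · rintro ⟨q, ⟨n, rfl⟩, h⟩
      exact ⟨n + 1, e n, ⟨n, Nat.lt_succ_self n, rfl⟩, h⟩
    · rintro ⟨n, q, ⟨k, _, rfl⟩, h⟩
      exact ⟨_, ⟨k, rfl⟩, h⟩
  rw [h1, Monotone.measure_iUnion]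
  · refine iSup_le fun n => finite_bound D hm K hH hε _ f ?_ hf0 hfH c hmono hcK hceq hX
    intro q hq
    obtain ⟨k, _, rfl⟩ := Finset.mem_image.1 hq
    exact hf _ ⟨k, rfl⟩
  · rintro n n' hn s ⟨q, hq, h⟩
    refine ⟨q, ?_, h⟩
    exact Finset.image_subset_image (Finset.range_mono hn) hq

lemma breaks_to_count {Ω : Type*} (f : ℝ → Ω → ℝ) (S : Ω → Finset ℝ) (K : ℕ)
    (hSK : ∀ z, (S z).card ≤ K)
    (hS : ∀ z a b, a ≤ b → (∀ t ∈ Set.Icc a b, t ∉ S z) → f a z = f b z) :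
    ∃ c : Ω → ℝ → ℕ, (∀ z, Monotone (c z)) ∧ (∀ z a, c z a ≤ 2 * K) ∧
      ∀ z a b, c z a = c z b → f a z = f b z := by
  classical
  have m1 : ∀ z (a b : ℝ), a ≤ b → (S z).filter (· ≤ a) ⊆ (S z).filter (· ≤ b) := by
    intro z a b h t
    simp only [Finset.mem_filter]
    exact fun h' => ⟨h'.1, h'.2.trans h⟩
  have m2 : ∀ z (a b : ℝ), a ≤ b → (S z).filter (· < a) ⊆ (S z).filter (· < b) := by
    intro z a b h t
    simp only [Finset.mem_filter]
    exact fun h' => ⟨h'.1, h'.2.trans_le h⟩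
  refine ⟨fun z a => ((S z).filter (· ≤ a)).card + ((S z).filter (· < a)).card, ?_, ?_, ?_⟩
  · intro z a b h
    exact add_le_add (Finset.card_le_card (m1 z a b h)) (Finset.card_le_card (m2 z a b h))
  · intro z a
    have h1 := Finset.card_filter_le (S z) (· ≤ a)
    have h2 := Finset.card_filter_le (S z) (· < a)
    have h3 := hSK z
    simp only
    omega
  · have key : ∀ z a b, a < b → ((S z).filter (· ≤ a)).card + ((S z).filter (· < a)).card =
        ((S z).filter (· ≤ b)).card + ((S z).filter (· < b)).card → f a z = f b z := by
      intro z a b hab h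
      have c1 := Finset.card_le_card (m1 z a b hab.le)
      have c2 := Finset.card_le_card (m2 z a b hab.le)
      have e1 := Finset.eq_of_subset_of_card_le (m1 z a b hab.le) (by omega)
      have e2 := Finset.eq_of_subset_of_card_le (m2 z a b hab.le) (by omega)
      refine hS z a b hab.le fun t ht htS => ?_
      rcases ht.1.eq_or_lt with h0 | h0
      · have : t ∈ (S z).filter (· < b) := Finset.mem_filter.2 ⟨htS, h0 ▸ hab⟩
        rw [← e2] at this
        exact absurd (Finset.mem_filter.1 this).2 (by simp [h0])
      · have : t ∈ (S z).filter (· ≤ b) := Finset.mem_filter.2 ⟨htS, ht.2⟩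
        rw [← e1] at this
        exact absurd (Finset.mem_filter.1 this).2 (by simp [h0])
    intro z a b h
    rcases lt_trichotomy a b with hab | rfl | hab
    · exact key z a b hab h
    · rfl
    · exact (key z b a hab h.symm).symm

lemma abstract_bound {Ω : Type*} [MeasurableSpace Ω] (D : Measure Ω) [IsProbabilityMeasure D]
    {m : ℕ} (hm : 0 < m) (K : ℕ) {H ε : ℝ} (hH : 0 < H) (hε : 0 < ε) (P : Set ℝ)
    (f : ℝ → Ω → ℝ) (hf : ∀ q ∈ P, Measurable (f q))
    (hf0 : ∀ q z, 0 ≤ f q z) (hfH : ∀ q z, f q z ≤ H)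
    (S : Ω → Finset ℝ) (hSK : ∀ z, (S z).card ≤ K)
    (hS : ∀ z a b, a ≤ b → (∀ t ∈ Set.Icc a b, t ∉ S z) → f a z = f b z)
    (hX : 12 ≤ m * (ε / 2) ^ 2 / (2048 * H ^ 2)) (hHm : H / m ≤ ε / 2)
    (hA : MeasurableSet {s : Fin m → Ω | ∀ η ∈ P,
      |(∑ j, f η (s j)) / m - ∫ z, f η z ∂D| ≤ ε}) :
    (Measure.pi fun _ : Fin m => D) {s : Fin m → Ω | ∀ η ∈ P,
      |(∑ j, f η (s j)) / m - ∫ z, f η z ∂D| ≤ ε}ᶜ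
      ≤ ENNReal.ofReal (80 * ((2 * K : ℕ) + 1) *
          Real.exp (-(m * (ε / 2) ^ 2 / (2048 * H ^ 2)))) := by
  classical
  have hmR : (0 : ℝ) < m := by exact_mod_cast hm
  obtain ⟨c, hmono, hcK, hceq⟩ := breaks_to_count f S K hSK hS
  obtain ⟨Q0, hQ0P, hQ0c, hQ0d⟩ :=
    (TopologicalSpace.IsSeparable.of_separableSpace P).exists_countable_dense_subset
  let M : ℝ → Set Ω := fun η =>
    {z | ∀ n : ℕ, ∃ q ∈ Q0, |q - η| < 1 / ((n : ℝ) + 1) ∧ f q z ≠ f η z}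
  have hMm : ∀ η ∈ P, MeasurableSet (M η) := by
    intro η hη
    have : M η = ⋂ n : ℕ, ⋃ q ∈ Q0, {z | |q - η| < 1 / ((n : ℝ) + 1) ∧ f q z ≠ f η z} := by
      ext z
      simp only [M, Set.mem_ofPred_eq, Set.mem_iInter, Set.mem_iUnion, exists_prop]
    rw [this]
    refine MeasurableSet.iInter fun n => MeasurableSet.biUnion hQ0c fun q hq => ?_
    refine (MeasurableSet.const _).inter ?_
    exact (measurableSet_eq_fun (hf q (hQ0P hq)) (hf η hη)).compl
  have hMS : ∀ η z, z ∈ M η → η ∈ S z := by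
    intro η z hz
    by_contra hη
    have hcl : IsOpen ((S z : Set ℝ)ᶜ) := (S z).finite_toSet.isClosed.isOpen_compl
    obtain ⟨r, hr, hball⟩ := Metric.isOpen_iff.1 hcl η (by simpa using hη)
    obtain ⟨n, hn⟩ := exists_nat_one_div_lt hr
    obtain ⟨q, hq, hqd, hne⟩ := hz n
    have hqr := abs_lt.1 (hqd.trans hn)
    have hfree : ∀ t, |t - η| < r → t ∉ S z := fun t ht h =>
      hball (show t ∈ Metric.ball η r by rw [Metric.mem_ball, Real.dist_eq]; exact ht)
        (by simpa using h)
    rcases le_total q η with h | h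
    · refine hne (hS z q η h fun t ht => hfree t ?_)
      rw [abs_lt]; constructor <;> linarith [ht.1, ht.2]
    · refine hne (hS z η q h fun t ht => hfree t ?_).symm
      rw [abs_lt]; constructor <;> linarith [ht.1, ht.2]
  have hsum : ∑' η : P, D (M η) ≤ K := by
    rw [ENNReal.tsum_eq_iSup_sum]
    refine iSup_le fun T => ?_
    calc ∑ η ∈ T, D (M η) = ∑ η ∈ T, ∫⁻ z, (M (η : ℝ)).indicator 1 z ∂D :=
          Finset.sum_congr rfl fun η _ => (lintegral_indicator_one (hMm η η.2)).symm
      _ = ∫⁻ z, ∑ η ∈ T, (M (η : ℝ)).indicator 1 z ∂D := by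
          rw [lintegral_finsetSum]
          exact fun η _ => measurable_one.indicator (hMm η η.2)
      _ ≤ ∫⁻ z, (K : ENNReal) ∂D := by
          refine lintegral_mono fun z => ?_
          simp only [Set.indicator_apply, Pi.one_apply]
          rw [Finset.sum_boole]
          have : (T.filter fun η : P => z ∈ M (η : ℝ)).card ≤ (S z).card := by
            refine Finset.card_le_card_of_injOn (fun η => (η : ℝ)) ?_ ?_
            · intro η hη
              exact hMS _ _ (Finset.mem_filter.1 hη).2
            · intro a _ b _ h
              exact Subtype.ext h
          exact_mod_cast this.trans (hSK z)
      _ = K := by simp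
  have hCc : (Function.support fun η : P => D (M η)).Countable :=
    Summable.countable_support_ennreal (ne_top_of_le_ne_top (by simp) hsum)
  set Q : Set ℝ := Q0 ∪ (fun η : P => (η : ℝ)) '' (Function.support fun η : P => D (M η)) with hQdef
  have hQc : Q.Countable := hQ0c.union (hCc.image _)
  have hQP : Q ⊆ P := by
    rintro q (h | ⟨η, _, rfl⟩)
    · exact hQ0P h
    · exact η.2
  have hnull : ∀ η ∈ P, η ∉ Q → D (M η) = 0 := by
    intro η hη h
    by_contra h0
    exact h (Or.inr ⟨⟨η, hη⟩, h0, rfl⟩)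
  have hcb := countable_bound D hm (2 * K) hH (half_pos hε) Q hQc f (fun q hq => hf q (hQP hq))
    hf0 hfH c hmono hcK hceq hX
  set A : Set (Fin m → Ω) := {s | ∀ η ∈ P, |(∑ j, f η (s j)) / m - ∫ z, f η z ∂D| ≤ ε} with hAdef
  set F : Set (Fin m → Ω) :=
    {s | ∃ q ∈ Q, ε / 2 < |(∑ j, f q (s j)) / m - ∫ z, f q z ∂D|} with hFdef
  have hFm : MeasurableSet F := by
    have : F = ⋃ q ∈ Q, {s | ε / 2 < |(∑ j, f q (s j)) / m - ∫ z, f q z ∂D|} := by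
      ext w; simp [hFdef]
    rw [this]
    refine MeasurableSet.biUnion hQc fun q hq => ?_
    have := hf q (hQP hq)
    refine measurableSet_lt measurable_const ?_
    fun_prop
  have hzero : (Measure.pi fun _ : Fin m => D) (Aᶜ \ F) = 0 := by
    refine coinc_null D (fun z z' => ∃ η ∈ P, η ∉ Q ∧ z ∈ M η ∧ z' ∈ M η) ?_ m _
      (hA.compl.diff hFm) ?_
    · intro z
      refine ⟨⋃ η ∈ (S z).filter (fun η => η ∈ P ∧ η ∉ Q), M η, ?_, ?_, ?_⟩
      · exact Finset.measurableSet_biUnion _ fun η hη => hMm η (Finset.mem_filter.1 hη).2.1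
      · refine (measure_biUnion_null_iff
          (Finset.countable_toSet ((S z).filter (fun η => η ∈ P ∧ η ∉ Q)))).2 fun η hη => ?_
        have := (Finset.mem_filter.1 hη).2
        exact hnull η this.1 this.2
      · rintro z' ⟨η, hη, hηQ, hz, hz'⟩
        simp only [Set.mem_iUnion]
        exact ⟨η, Finset.mem_filter.2 ⟨hMS _ _ hz, hη, hηQ⟩, hz'⟩
    · rintro s ⟨hsA, hsF⟩
      by_contra hcon
      refine hsA fun η hη => ?_
      have hdev : ∀ q ∈ Q, |(∑ j, f q (s j)) / m - ∫ z, f q z ∂D| ≤ ε / 2 := by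
        intro q hq
        by_contra h
        exact hsF ⟨q, hq, not_le.1 h⟩
      by_cases hηQ : η ∈ Q
      · linarith [hdev η hηQ]
      have hD0 := hnull η hη hηQ
      have hone : ∀ j k, s j ∈ M η → s k ∈ M η → j = k := by
        intro j k hj hk
        rcases lt_trichotomy j k with h | h | h
        · exact absurd ⟨j, k, h, η, hη, hηQ, hj, hk⟩ hcon
        · exact h
        · exact absurd ⟨k, j, h, η, hη, hηQ, hk, hj⟩ hcon
      have hex : ∀ n : ℕ, ∃ q ∈ Q0, |q - η| < 1 / ((n : ℝ) + 1) := by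
        intro n
        obtain ⟨q, hq, hd⟩ := Metric.mem_closure_iff.1 (hQ0d hη) (1 / ((n : ℝ) + 1))
          Nat.one_div_pos_of_nat
        exact ⟨q, hq, by rwa [dist_comm, Real.dist_eq] at hd⟩
      choose u hu hud using hex
      have hev : ∀ z, z ∉ M η → ∀ᶠ n in Filter.atTop, f (u n) z = f η z := by
        intro z hz
        simp only [M, Set.mem_ofPred_eq, not_forall, not_exists, not_and, not_not] at hz
        obtain ⟨n0, hn0⟩ := hz
        filter_upwards [Filter.eventually_ge_atTop n0] with n hn
        exact hn0 (u n) (hu n) ((hud n).trans_le (Nat.one_div_le_one_div hn))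
      have hlim : Filter.Tendsto (fun n => ∫ z, f (u n) z ∂D) Filter.atTop
          (nhds (∫ z, f η z ∂D)) := by
        refine tendsto_integral_of_dominated_convergence (fun _ => H)
          (fun n => (hf _ (hQ0P (hu n))).aestronglyMeasurable) (integrable_const _)
          (fun n => Filter.Eventually.of_forall fun z => ?_) ?_
        · rw [Real.norm_eq_abs, abs_of_nonneg (hf0 _ _)]; exact hfH _ _
        · have : ∀ᵐ z ∂D, z ∉ M η := measure_eq_zero_iff_ae_notMem.1 hD0
          filter_upwards [this] with z hz
          exact tendsto_const_nhds.congr' ((hev z hz).mono fun n hn => hn.symm)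
      have hlim2 : Filter.Tendsto (fun n => ε + |∫ z, f (u n) z ∂D - ∫ z, f η z ∂D|)
          Filter.atTop (nhds ε) := by
        have := ((hlim.sub_const (∫ z, f η z ∂D)).abs).const_add ε
        simpa using this
      refine ge_of_tendsto hlim2 ?_
      have hall : ∀ᶠ n in Filter.atTop, ∀ j, s j ∉ M η → f (u n) (s j) = f η (s j) := by
        rw [Filter.eventually_all]
        intro j
        by_cases h : s j ∈ M η
        · exact Filter.Eventually.of_forall fun n h' => absurd h h'
        · exact (hev _ h).mono fun n hn _ => hn
      filter_upwards [hall] with n hn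
      have hdiff : |∑ j, f η (s j) - ∑ j, f (u n) (s j)| ≤ H := by
        rw [← Finset.sum_sub_distrib]
        by_cases hj : ∃ j, s j ∈ M η
        · obtain ⟨j0, hj0⟩ := hj
          rw [Finset.sum_eq_single j0]
          · have h1 := hf0 η (s j0)
            have h2 := hf0 (u n) (s j0)
            have h3 := hfH η (s j0)
            have h4 := hfH (u n) (s j0)
            rw [abs_le]; constructor <;> linarith
          · intro j _ hjj
            rw [hn j fun h => hjj (hone _ _ h hj0), sub_self]
          · simp
        · push Not at hj
          rw [Finset.sum_eq_zero fun j _ => by rw [hn j (hj j), sub_self]]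
          simpa using hH.le
      have hq := hdev (u n) (Or.inl (hu n))
      have hdiff2 : |(∑ j, f η (s j)) / m - (∑ j, f (u n) (s j)) / m| ≤ ε / 2 := by
        rw [← sub_div, abs_div, abs_of_pos hmR]
        exact (div_le_div_of_nonneg_right hdiff hmR.le).trans hHm
      have e : (∑ j, f η (s j)) / m - ∫ z, f η z ∂D =
        ((∑ j, f η (s j)) / m - (∑ j, f (u n) (s j)) / m) +
        ((∑ j, f (u n) (s j)) / m - ∫ z, f (u n) z ∂D) +
        (∫ z, f (u n) z ∂D - ∫ z, f η z ∂D) := by ring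
      rw [e]
      refine (abs_add_three _ _ _).trans ?_
      linarith
  calc _ ≤ (Measure.pi fun _ : Fin m => D) ((Aᶜ \ F) ∪ F) := measure_mono fun s hs => by
        by_cases h : s ∈ F
        · exact Or.inr h
        · exact Or.inl ⟨hs, h⟩
    _ ≤ _ := measure_union_le _ _
    _ ≤ _ := by rw [hzero, zero_add]; exact hcb

lemma final_arith {H Δ m : ℕ} (hH : 1 ≤ H) (hΔ : 2 ≤ Δ) {ε δ : ℝ} (hε : 0 < ε) (hδ : 0 < δ)
    (hδ1 : δ < 1)
    (hm : 163840 * ((H : ℝ) ^ 2 / ε ^ 2 * ((H : ℝ) * Real.log Δ + Real.log (1 / δ))) ≤ m) :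
    0 < m ∧ 12 ≤ (m : ℝ) * (ε / 2) ^ 2 / (2048 * (H : ℝ) ^ 2) ∧ (H : ℝ) / m ≤ ε / 2 ∧
    80 * (((2 * (H * (2 * Δ ^ (2 * H))) : ℕ) : ℝ) + 1) *
      Real.exp (-((m : ℝ) * (ε / 2) ^ 2 / (2048 * (H : ℝ) ^ 2))) ≤ δ := by
  have hHR : (1 : ℝ) ≤ H := by exact_mod_cast hH
  have hΔR : (2 : ℝ) ≤ Δ := by exact_mod_cast hΔ
  set A := (H : ℝ) * Real.log Δ with hA
  set B := Real.log (1 / δ) with hB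
  have hB0 : 0 < B := Real.log_pos (by rw [lt_div_iff₀ hδ]; linarith)
  have hlog : (0.69 : ℝ) ≤ Real.log Δ := by
    have h1 := Real.log_two_gt_d9
    have h2 := Real.log_le_log (by norm_num) hΔR
    linarith
  have hA0 : (0.69 : ℝ) ≤ A := by nlinarith
  have hH2 : (0 : ℝ) < (H : ℝ) ^ 2 := by positivity
  have hε2 : (0 : ℝ) < ε ^ 2 := by positivity
  set r := (H : ℝ) / ε with hr
  have hr0 : 0 < r := by positivity
  have hrr : (H : ℝ) ^ 2 / ε ^ 2 = r ^ 2 := by rw [hr, div_pow]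
  rw [hrr] at hm
  have hmpos : (0 : ℝ) < m := lt_of_lt_of_le (by positivity) hm
  have hm0 : 0 < m := by exact_mod_cast hmpos
  have hm1 : (1 : ℝ) ≤ m := by exact_mod_cast hm0
  have hXeq : (m : ℝ) * (ε / 2) ^ 2 / (2048 * (H : ℝ) ^ 2) = m / (8192 * r ^ 2) := by
    rw [hr]; field_simp; norm_num
  have hX : 20 * (A + B) ≤ (m : ℝ) / (8192 * r ^ 2) := by
    rw [le_div_iff₀ (by positivity)]
    nlinarith [hm]
  rw [hXeq]
  refine ⟨hm0, by linarith, ?_, ?_⟩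
  · have h4 : 4 * r ^ 2 ≤ m := by
      have : r ^ 2 * 0.69 ≤ r ^ 2 * (A + B) :=
        mul_le_mul_of_nonneg_left (by linarith) (by positivity)
      nlinarith [sq_nonneg r]
    have h2 : 2 * r ≤ m := by nlinarith [sq_nonneg (2 * r - 1)]
    have hHe : (H : ℝ) = r * ε := by rw [hr]; field_simp
    rw [div_le_iff₀ hmpos, hHe]
    nlinarith
  · have hK : 80 * (2 * (H * (2 * Δ ^ (2 * H))) + 1) ≤ Δ ^ (12 * H) := by
      have hHΔ : H ≤ Δ ^ H := (Nat.lt_pow_self (by omega)).le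
      have h9 : 512 ≤ Δ ^ (9 * H) := by
        calc 512 = 2 ^ 9 := by norm_num
          _ ≤ Δ ^ 9 := Nat.pow_le_pow_left hΔ 9
          _ ≤ Δ ^ (9 * H) := Nat.pow_le_pow_right (by omega) (by omega)
      have h1 : 1 ≤ H * Δ ^ (2 * H) := Nat.mul_pos hH (Nat.pow_pos (by omega))
      calc 80 * (2 * (H * (2 * Δ ^ (2 * H))) + 1)
          ≤ 512 * (H * Δ ^ (2 * H)) := by nlinarith
        _ ≤ Δ ^ (9 * H) * (Δ ^ H * Δ ^ (2 * H)) := by gcongr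
        _ = Δ ^ (12 * H) := by rw [← pow_add, ← pow_add]; congr 1; ring
    have hKR : 80 * (((2 * (H * (2 * Δ ^ (2 * H))) : ℕ) : ℝ) + 1) ≤ Real.exp (12 * A) := by
      have e : Real.exp (12 * A) = (Δ : ℝ) ^ (12 * H) := by
        rw [← Real.exp_log (show (0 : ℝ) < (Δ : ℝ) ^ (12 * H) by positivity), Real.log_pow, hA]
        congr 1; push_cast; ring
      rw [e]
      exact_mod_cast hK
    have hδe : δ = Real.exp (-B) := by
      rw [hB, one_div, Real.log_inv, neg_neg, Real.exp_log hδ]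
    calc _ ≤ Real.exp (12 * A) * Real.exp (-((m : ℝ) / (8192 * r ^ 2))) := by gcongr
      _ = Real.exp (12 * A - (m : ℝ) / (8192 * r ^ 2)) := by rw [← Real.exp_add]; rfl
      _ ≤ Real.exp (-B) := Real.exp_le_exp.2 (by linarith)
      _ = δ := hδe.symm

/-- Uniform convergence for tuning the gradient-descent step size over polynomial
instances of degree at most `Δ`, with sample complexity
`m = O((H²/ε²)(H log Δ + log(1/δ)))`. -/
theorem gd_poly_stepsize_uniform_convergence :
    ∃ C : ℝ, 0 < C ∧
      ∀ (d H Δ : ℕ), 1 ≤ d → 1 ≤ H → 2 ≤ Δ →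
      ∀ θ : ℝ, 0 < θ →
      ∀ (Ω : Type) (_ : MeasurableSpace Ω)
        (inst : Ω → (EuclideanSpace ℝ (Fin d)) × (EuclideanSpace ℝ (Fin d) → ℝ)),
        (∀ z : Ω, IsPolyDeg Δ (inst z).2) →
      ∀ P : Set ℝ, P ⊆ Set.Ici (0 : ℝ) →
        (∀ η ∈ P, Measurable fun z : Ω => (gdCost H θ (inst z).2 (inst z).1 η : ℝ)) →
      ∀ (D : Measure Ω), IsProbabilityMeasure D →
      ∀ ε δ : ℝ, 0 < ε → 0 < δ → δ < 1 →
        (∀ (m : ℕ) (t : ℝ), MeasurableSet {s : Fin m → Ω | ∀ η ∈ P,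
          |(∑ j : Fin m, (gdCost H θ (inst (s j)).2 (inst (s j)).1 η : ℝ)) / m
            - ∫ z, (gdCost H θ (inst z).2 (inst z).1 η : ℝ) ∂D| ≤ t}) →
      ∀ m : ℕ,
        C * ((H : ℝ) ^ 2 / ε ^ 2 * ((H : ℝ) * Real.log Δ + Real.log (1 / δ))) ≤ m →
        ENNReal.ofReal (1 - δ) ≤
          (Measure.pi fun _ : Fin m => D)
            {s : Fin m → Ω | ∀ η ∈ P,
              |(∑ j : Fin m, (gdCost H θ (inst (s j)).2 (inst (s j)).1 η : ℝ)) / m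
                - ∫ z, (gdCost H θ (inst z).2 (inst z).1 η : ℝ) ∂D| ≤ ε} := by
  refine ⟨163840, by norm_num, ?_⟩
  intro d H Δ _ hH hΔ θ hθ Ω _ inst hinst P _ hmeas D hD ε δ hε hδ hδ1 hA m hm
  obtain ⟨hm0, hX, hHm, hfin⟩ := final_arith hH hΔ hε hδ hδ1 hm
  choose S hSc hS using fun z => gdCost_breaks (H := H) hΔ hθ (inst z).2 (hinst z) (inst z).1
  have hb := abstract_bound D hm0 (H * (2 * Δ ^ (2 * H))) (H := (H : ℝ)) (ε := ε)
    (by exact_mod_cast hH) hε P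
    (fun η z => (gdCost H θ (inst z).2 (inst z).1 η : ℝ)) hmeas
    (fun q z => Nat.cast_nonneg _) (fun q z => by exact_mod_cast gdCost_le θ _ _ q)
    S hSc (fun z a b hab h => by exact_mod_cast hS z a b hab h) hX hHm (hA m ε)
  have hb2 := hb.trans (ENNReal.ofReal_le_ofReal hfin)
  rw [prob_compl_eq_one_sub (hA m ε)] at hb2
  rw [ENNReal.ofReal_sub _ hδ.le, ENNReal.ofReal_one]
  exact tsub_le_iff_tsub_le.1 hb2
end

section
/- Let f : ℝ^d → ℝ be a Pfaffian function of degree at most Δ ≥ 1 over a Pfaffian chain f_1, …, f_q : ℝ^d → ℝ of length q and Pfaffian degree at most M ≥ 1, fix x ∈ ℝ^d, and for η ∈ ℝ define the gradient-descent iterates x_1(η) = x and x_{i+1}(η) = x_i(η) − η∇f(x_i(η)). Then for every i ≥ 2, the functions η ↦ (x_l(η))_j for 2 ≤ l ≤ i−1, j ∈ {1,…,d}, together with η ↦ f_k(x_l(η)) for k ∈ {1,…,q}, 2 ≤ l ≤ i−1, and the functions η ↦ f_k(x) (constants), form a Pfaffian chain in the single variable η of length at most q + (q+1)d(i−2), and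 each coordinate η ↦ (x_i(η))_j is a polynomial of degree at most (Δ + M)^{i−2} in η and the functions of this chain. -/
/-- A Pfaffian chain of length `q` and Pfaffian degree at most `M` on `ℝ^d`: continuously
differentiable functions whose partial derivatives are polynomials (of degree ≤ `M`) in the
variables and the previous chain functions (triangularity). -/
def IsPfaffianChain {d q : ℕ} (M : ℕ)
    (c : Fin q → (EuclideanSpace ℝ (Fin d) → ℝ)) : Prop :=
  (∀ j, ContDiff ℝ 1 (c j)) ∧
  ∃ P : Fin d → Fin q → MvPolynomial (Fin d ⊕ Fin q) ℝ,
    ∀ i j, (P i j).totalDegree ≤ M ∧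
      (∀ k : Fin q, Sum.inr k ∈ (P i j).vars → (k : ℕ) ≤ (j : ℕ)) ∧
      ∀ a : EuclideanSpace ℝ (Fin d),
        fderiv ℝ (c j) a (EuclideanSpace.single i 1) =
          MvPolynomial.eval (Sum.elim (fun i' => a i') (fun k => c k a)) (P i j)

/-- A Pfaffian chain in a single real variable (of unspecified Pfaffian degree):
continuously differentiable functions `ℝ → ℝ` whose derivatives are polynomials in the
variable and the previous chain functions (triangularity). -/
def IsPfaffianChain1 {n : ℕ} (c : Fin n → (ℝ → ℝ)) : Prop :=
  (∀ j, ContDiff ℝ 1 (c j)) ∧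
  ∃ P : Fin n → MvPolynomial (Unit ⊕ Fin n) ℝ,
    ∀ j, (∀ k : Fin n, Sum.inr k ∈ (P j).vars → (k : ℕ) ≤ (j : ℕ)) ∧
      ∀ η : ℝ,
        deriv (c j) η = MvPolynomial.eval (Sum.elim (fun _ => η) (fun k => c k η)) (P j)

/-- The algebra of functions polynomial in the variable and the functions of `S`. -/
noncomputable def polyAlg (S : Set (ℝ → ℝ)) : Subalgebra ℝ (ℝ → ℝ) :=
  Algebra.adjoin ℝ (insert (fun η => η) S)

lemma polyAlg_mono {S T : Set (ℝ → ℝ)} (h : S ⊆ T) : polyAlg S ≤ polyAlg T :=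
  Algebra.adjoin_mono (Set.insert_subset_insert h)

lemma polyAlg_id (S : Set (ℝ → ℝ)) : (fun η : ℝ => η) ∈ polyAlg S :=
  Algebra.subset_adjoin (Set.mem_insert _ _)

lemma polyAlg_of_mem {S : Set (ℝ → ℝ)} {h : ℝ → ℝ} (hh : h ∈ S) : h ∈ polyAlg S :=
  Algebra.subset_adjoin (Set.mem_insert_of_mem _ hh)

lemma polyAlg_const (S : Set (ℝ → ℝ)) (r : ℝ) : (fun _ : ℝ => r) ∈ polyAlg S :=
  (polyAlg S).algebraMap_mem r

lemma eval_mem_of_vars {σ : Type*} (A : Subalgebra ℝ (ℝ → ℝ)) (v : σ → ℝ → ℝ)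
    (p : MvPolynomial σ ℝ) (hv : ∀ s ∈ p.vars, v s ∈ A) :
    (fun η => MvPolynomial.eval (fun s => v s η) p) ∈ A := by
  have : (fun η => MvPolynomial.eval (fun s => v s η) p) =
      ∑ m ∈ p.support, (p.coeff m) • ∏ s ∈ m.support, v s ^ m s := by
    funext η
    rw [MvPolynomial.eval_eq]
    simp
  rw [this]
  refine A.sum_mem fun m hm => A.smul_mem (A.prod_mem fun s hs => A.pow_mem (hv s ?_) _) _
  exact (MvPolynomial.mem_vars_iff_mem_support s).2 ⟨m, hm, hs⟩

lemma exists_poly_of_mem {n : ℕ} (ch : Fin n → ℝ → ℝ) {g : ℝ → ℝ}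
    (hg : g ∈ polyAlg (Set.range ch)) :
    ∃ p : MvPolynomial (Unit ⊕ Fin n) ℝ, ∀ η : ℝ,
      g η = MvPolynomial.eval (Sum.elim (fun _ => η) (fun k => ch k η)) p := by
  have hr : insert (fun η : ℝ => η) (Set.range ch) =
      Set.range (Sum.elim (fun _ : Unit => (fun η : ℝ => η)) ch) := by
    rw [Set.Sum.elim_range]; simp
  unfold polyAlg at hg
  rw [hr, Algebra.adjoin_range_eq_range_aeval] at hg
  obtain ⟨p, rfl⟩ := hg
  refine ⟨p, fun η => ?_⟩
  have := MvPolynomial.comp_aeval_apply (R := ℝ) (Sum.elim (fun _ : Unit => (fun η : ℝ => η)) ch)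
    (Pi.evalAlgHom ℝ (fun _ : ℝ => ℝ) η) p
  simp only [Pi.evalAlgHom_apply] at this
  refine this.trans ?_
  rw [MvPolynomial.aeval_eq_eval]
  congr 2
  funext s
  cases s <;> rfl

/-- `S` is the set of functions of a one-variable Pfaffian chain of length `n`. -/
def ChainSet (n : ℕ) (S : Set (ℝ → ℝ)) : Prop :=
  ∃ ch : Fin n → (ℝ → ℝ), IsPfaffianChain1 ch ∧ Set.range ch = S

lemma chainSet_nil : ChainSet 0 ∅ :=
  ⟨Fin.elim0, ⟨fun j => j.elim0, fun _ => 0, fun j => j.elim0⟩, by simp⟩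

lemma ChainSet.snoc {n : ℕ} {S : Set (ℝ → ℝ)} (hS : ChainSet n S) {h : ℝ → ℝ}
    (hh : ContDiff ℝ 1 h) (hd : deriv h ∈ polyAlg (insert h S)) :
    ChainSet (n + 1) (insert h S) := by
  obtain ⟨ch, ⟨hC, P, hP⟩, rfl⟩ := hS
  have hr : Set.range (Fin.snoc ch h : Fin (n + 1) → ℝ → ℝ) = insert h (Set.range ch) := by
    rw [Fin.range_snoc]
  rw [← hr] at hd
  obtain ⟨p, hp⟩ := exists_poly_of_mem _ hd
  refine ⟨Fin.snoc ch h, ⟨?_, Fin.snoc (α := fun _ => MvPolynomial (Unit ⊕ Fin (n + 1)) ℝ)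
    (fun j => MvPolynomial.rename (Sum.map id Fin.castSucc) (P j)) p, ?_⟩, hr⟩
  · intro j
    refine Fin.lastCases ?_ (fun j => ?_) j
    · simpa using hh
    · simpa using hC j
  · intro j
    refine Fin.lastCases ?_ (fun j => ?_) j
    · refine ⟨fun k _ => ?_, ?_⟩
      · simp only [Fin.val_last]; omega
      · simpa using hp
    · simp only [Fin.snoc_castSucc]
      refine ⟨fun k hk => ?_, fun η => ?_⟩
      · classical
        have := MvPolynomial.vars_rename _ _ hk
        rw [Finset.mem_image] at this
        obtain ⟨a, ha, hak⟩ := this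
        rcases a with a | a
        · simp at hak
        · simp only [Sum.map_inr, Sum.inr.injEq] at hak
          subst hak
          simpa using (hP j).1 a ha
      · rw [(hP j).2 η, MvPolynomial.eval_rename]
        congr 2
        funext s
        cases s <;> simp

lemma ChainSet.append {n m : ℕ} {S : Set (ℝ → ℝ)} (hS : ChainSet n S) (h : Fin m → ℝ → ℝ)
    (hh : ∀ k, ContDiff ℝ 1 (h k))
    (hd : ∀ k, deriv (h k) ∈ polyAlg (S ∪ h '' {k' | k' ≤ k})) :
    ChainSet (n + m) (S ∪ Set.range h) := by
  have key : ∀ t, t ≤ m → ChainSet (n + t) (S ∪ h '' {k | (k : ℕ) < t}) := by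
    intro t
    induction t with
    | zero => intro _; simpa using hS
    | succ t ih =>
      intro ht
      have h1 := ih (by omega)
      have e : S ∪ h '' {k : Fin m | (k : ℕ) < t + 1} =
          insert (h ⟨t, ht⟩) (S ∪ h '' {k | (k : ℕ) < t}) := by
        have : {k : Fin m | (k : ℕ) < t + 1} = insert (⟨t, ht⟩ : Fin m) {k : Fin m | (k : ℕ) < t} := by
          ext k
          simp only [Set.mem_ofPred_eq, Set.mem_insert_iff, Fin.ext_iff]
          omega
        rw [this, Set.image_insert_eq, Set.union_insert]
      rw [e]
      refine h1.snoc (hh _) ?_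
      rw [← e]
      refine polyAlg_mono ?_ (hd ⟨t, ht⟩)
      refine Set.union_subset_union_right _ (Set.image_mono fun k hk => ?_)
      have : (k : ℕ) ≤ t := hk
      exact Nat.lt_succ_of_le this
  have := key m le_rfl
  simpa using this

lemma ChainSet.contDiff_deriv {n : ℕ} {S : Set (ℝ → ℝ)} (hS : ChainSet n S) {g : ℝ → ℝ}
    (hg : g ∈ polyAlg S) : ContDiff ℝ 1 g ∧ deriv g ∈ polyAlg S := by
  unfold polyAlg at hg
  induction hg using Algebra.adjoin_induction with
  | mem g hg =>
    rcases hg with rfl | hg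
    · refine ⟨contDiff_id, ?_⟩
      have : deriv (fun η : ℝ => η) = fun _ => 1 := by funext η; simp
      rw [this]; exact polyAlg_const _ _
    · obtain ⟨ch, ⟨hC, P, hP⟩, rfl⟩ := hS
      obtain ⟨j, rfl⟩ := hg
      refine ⟨hC j, ?_⟩
      have : deriv (ch j) = fun η => MvPolynomial.eval
          (fun s => (Sum.elim (fun _ : Unit => (fun η : ℝ => η)) ch) s η) (P j) := by
        funext η
        rw [(hP j).2 η]
        congr 2
        funext s
        cases s <;> rfl
      rw [this]
      refine eval_mem_of_vars _ _ _ fun s _ => ?_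
      rcases s with s | s
      · exact polyAlg_id _
      · exact polyAlg_of_mem ⟨s, rfl⟩
  | algebraMap r =>
    refine ⟨contDiff_const (c := r), ?_⟩
    have : deriv (algebraMap ℝ (ℝ → ℝ) r) = fun _ => 0 := by
      funext η; exact deriv_const η r
    rw [this]; exact polyAlg_const _ _
  | add a b ha hb iha ihb =>
    refine ⟨iha.1.add ihb.1, ?_⟩
    have : deriv (a + b) = deriv a + deriv b := by
      funext η
      exact deriv_add (iha.1.differentiable one_ne_zero η) (ihb.1.differentiable one_ne_zero η)
    rw [this]; exact add_mem iha.2 ihb.2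
  | mul a b ha hb iha ihb =>
    refine ⟨iha.1.mul ihb.1, ?_⟩
    have : deriv (a * b) = deriv a * b + a * deriv b := by
      funext η
      exact deriv_mul (iha.1.differentiable one_ne_zero η) (ihb.1.differentiable one_ne_zero η)
    rw [this]; exact add_mem (mul_mem iha.2 hb) (mul_mem ha ihb.2)

lemma totalDegree_pderiv_le' {σ : Type*} (s : σ) (p : MvPolynomial σ ℝ) :
    (MvPolynomial.pderiv s p).totalDegree ≤ p.totalDegree - 1 := by
  classical
  rw [MvPolynomial.totalDegree, Finset.sup_le_iff]
  intro m hm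
  rw [MvPolynomial.mem_support_iff, MvPolynomial.coeff_pderiv] at hm
  have h1 : m + Finsupp.single s 1 ∈ p.support := by
    rw [MvPolynomial.mem_support_iff]
    exact left_ne_zero_of_mul hm
  have h2 := MvPolynomial.le_totalDegree h1
  rw [Finsupp.sum_add_index' (by simp) (by simp)] at h2
  simp at h2
  omega

lemma hasFDerivAt_eval {E σ : Type*} [NormedAddCommGroup E] [NormedSpace ℝ E] [Fintype σ]
    (v : σ → E → ℝ) (v' : σ → E →L[ℝ] ℝ) (a : E) (hv : ∀ s, HasFDerivAt (v s) (v' s) a)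
    (p : MvPolynomial σ ℝ) :
    HasFDerivAt (fun a => MvPolynomial.eval (fun s => v s a) p)
      (∑ s, MvPolynomial.eval (fun s => v s a) (MvPolynomial.pderiv s p) • v' s) a := by
  classical
  induction p using MvPolynomial.induction_on with
  | C r => simpa using hasFDerivAt_const r a
  | add p q hp hq =>
    simp only [map_add, add_smul, Finset.sum_add_distrib]
    exact hp.add hq
  | mul_X p i hp =>
    have h := hp.mul (hv i)
    simp only [map_mul, MvPolynomial.eval_X]
    refine h.congr_fderiv (Eq.symm ?_)
    simp only [MvPolynomial.pderiv_mul, MvPolynomial.pderiv_X, map_add, map_mul,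
      MvPolynomial.eval_X, add_smul, Finset.sum_add_distrib, Finset.smul_sum, smul_smul]
    rw [add_comm]
    congr 1
    · rw [Finset.sum_eq_single i]
      · simp
      · intro b _ hb
        simp [Pi.single_apply, hb.symm]
      · simp
    · exact Finset.sum_congr rfl fun s _ => by rw [mul_comm]

lemma gradient_coord {d : ℕ} (f : EuclideanSpace ℝ (Fin d) → ℝ) (a : EuclideanSpace ℝ (Fin d))
    (i : Fin d) : gradient f a i = fderiv ℝ f a (EuclideanSpace.single i 1) := by
  rw [← toDual_gradient, InnerProductSpace.toDual_apply_apply, EuclideanSpace.inner_single_right]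
  simp

/-- The coordinates of the gradient are polynomials of degree at most `Δ + M - 1`. -/
lemma gradient_poly {d q M Δ : ℕ} (hΔ : 1 ≤ Δ) (hM : 1 ≤ M)
    (c : Fin q → (EuclideanSpace ℝ (Fin d) → ℝ)) (hc : IsPfaffianChain M c)
    (f : EuclideanSpace ℝ (Fin d) → ℝ)
    (Q : MvPolynomial (Fin d ⊕ Fin q) ℝ) (hQ : Q.totalDegree ≤ Δ)
    (hfQ : ∀ a : EuclideanSpace ℝ (Fin d),
      f a = MvPolynomial.eval (Sum.elim (fun i => a i) (fun k => c k a)) Q) :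
    ∃ G : Fin d → MvPolynomial (Fin d ⊕ Fin q) ℝ, ∀ i, (G i).totalDegree ≤ Δ + M - 1 ∧
      ∀ a, gradient f a i =
        MvPolynomial.eval (Sum.elim (fun i => a i) (fun k => c k a)) (G i) := by
  obtain ⟨hC, P, hP⟩ := hc
  refine ⟨fun i => MvPolynomial.pderiv (Sum.inl i) Q +
    ∑ k, MvPolynomial.pderiv (Sum.inr k) Q * P i k, fun i => ⟨?_, fun a => ?_⟩⟩
  · refine (MvPolynomial.totalDegree_add _ _).trans (max_le ?_ ?_)
    · have := totalDegree_pderiv_le' (Sum.inl i) Q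
      omega
    · refine MvPolynomial.totalDegree_finsetSum_le fun k _ => ?_
      refine (MvPolynomial.totalDegree_mul _ _).trans ?_
      have := totalDegree_pderiv_le' (Sum.inr k) Q
      have := (hP i k).1
      omega
  · let v : Fin d ⊕ Fin q → EuclideanSpace ℝ (Fin d) → ℝ := Sum.elim (fun i a => a i) c
    let v' : Fin d ⊕ Fin q → EuclideanSpace ℝ (Fin d) →L[ℝ] ℝ :=
      Sum.elim (fun i => EuclideanSpace.proj i) (fun k => fderiv ℝ (c k) a)
    have hv : ∀ s, HasFDerivAt (v s) (v' s) a := by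
      rintro (s | s)
      · exact (EuclideanSpace.proj s : EuclideanSpace ℝ (Fin d) →L[ℝ] ℝ).hasFDerivAt
      · exact ((hC s).differentiable one_ne_zero a).hasFDerivAt
    have hve : ∀ b, (fun s => v s b) = Sum.elim (fun i => b i) (fun k => c k b) := by
      intro b; funext s; cases s <;> rfl
    have h := hasFDerivAt_eval v v' a hv Q
    have hf : f = fun a => MvPolynomial.eval (fun s => v s a) Q := by
      funext b; rw [hfQ b, hve b]
    rw [← hf] at h
    rw [gradient_coord, h.fderiv]
    have hsum : ∀ (w : Fin d ⊕ Fin q → ℝ) (b : EuclideanSpace ℝ (Fin d)),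
        (∑ s, w s • v' s) b = ∑ s, w s * v' s b := by
      intro w b
      simp
    rw [hsum]
    simp only [hve, Fintype.sum_sum_type, map_add, map_sum, map_mul]
    congr 1
    · rw [Finset.sum_eq_single i]
      · simp [v']
      · intro b _ hb
        simp [v', hb]
      · simp
    · refine Finset.sum_congr rfl fun k _ => ?_
      rw [← (hP i k).2.2 a]; rfl

/-- Adding the compositions of a Pfaffian chain with a curve whose coordinates are in the chain. -/
lemma ChainSet.comp {d q M n : ℕ} {S : Set (ℝ → ℝ)} (hS : ChainSet n S)
    (c : Fin q → (EuclideanSpace ℝ (Fin d) → ℝ)) (hc : IsPfaffianChain M c)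
    (y : ℝ → EuclideanSpace ℝ (Fin d)) (hy : ∀ j, (fun η => y η j) ∈ polyAlg S) :
    ChainSet (n + q) (S ∪ Set.range fun k η => c k (y η)) := by
  obtain ⟨hC, P, hP⟩ := hc
  have hyC : ContDiff ℝ 1 y := contDiff_euclidean.2 fun j => (hS.contDiff_deriv (hy j)).1
  refine hS.append _ (fun k => (hC k).comp hyC) fun k => ?_
  have hsub : polyAlg S ≤ polyAlg (S ∪ (fun k η => c k (y η)) '' {k' | k' ≤ k}) :=
    polyAlg_mono Set.subset_union_left
  have e : deriv (fun η => c k (y η)) = ∑ j, deriv (fun η => y η j) *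
      fun η => MvPolynomial.eval
        (fun s => (Sum.elim (fun j η => y η j) (fun k η => c k (y η)) : _ → ℝ → ℝ) s η)
        (P j k) := by
    funext η
    have h1 : HasDerivAt y (deriv y η) η := (hyC.differentiable one_ne_zero η).hasDerivAt
    have h2 : HasFDerivAt (c k) (fderiv ℝ (c k) (y η)) (y η) :=
      ((hC k).differentiable one_ne_zero (y η)).hasFDerivAt
    have h3 := (h2.comp_hasDerivAt η h1).deriv
    have h4 : ∀ j, deriv (fun η => y η j) η = deriv y η j := fun j =>
      ((EuclideanSpace.proj j : EuclideanSpace ℝ (Fin d) →L[ℝ] ℝ).hasFDerivAt.comp_hasDerivAt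
        η h1).deriv
    refine h3.trans ?_
    have h5 : deriv y η = ∑ j, (deriv y η j) • EuclideanSpace.single j (1 : ℝ) := by
      ext i
      simp [Pi.single_apply]
    rw [h5, map_sum, Finset.sum_apply]
    refine Finset.sum_congr rfl fun j _ => ?_
    rw [map_smul, (hP j k).2.2, Pi.mul_apply, h4, smul_eq_mul]
    congr 3
    funext s
    cases s <;> rfl
  rw [e]
  refine sum_mem fun j _ => mul_mem (hsub (hS.contDiff_deriv (hy j)).2) ?_
  refine eval_mem_of_vars _ _ _ fun s hs => ?_
  rcases s with s | s
  · exact hsub (hy s)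
  · exact polyAlg_of_mem (Or.inr ⟨s, (hP j k).2.1 s hs, rfl⟩)

/-- The set of functions of the chain after `m` steps. -/
def gdSet {d q : ℕ} (c : Fin q → (EuclideanSpace ℝ (Fin d) → ℝ))
    (f : EuclideanSpace ℝ (Fin d) → ℝ) (x : EuclideanSpace ℝ (Fin d)) : ℕ → Set (ℝ → ℝ)
  | 0 => Set.range fun k _ => c k x
  | m + 1 => (gdSet c f x m ∪ Set.range fun j η => gdIter f x η (m + 1) j) ∪
      Set.range fun k η => c k (gdIter f x η (m + 1))

lemma gdSet_eq {d q : ℕ} (c : Fin q → (EuclideanSpace ℝ (Fin d) → ℝ))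
    (f : EuclideanSpace ℝ (Fin d) → ℝ) (x : EuclideanSpace ℝ (Fin d)) (m : ℕ) :
    gdSet c f x m =
            ({h : ℝ → ℝ | ∃ k : Fin q, h = fun _ : ℝ => c k x} ∪
             {h : ℝ → ℝ | ∃ l : ℕ, 2 ≤ l ∧ l ≤ m + 1 ∧
                ∃ j : Fin d, h = fun η : ℝ => gdIter f x η (l - 1) j} ∪
             {h : ℝ → ℝ | ∃ l : ℕ, 2 ≤ l ∧ l ≤ m + 1 ∧
                ∃ k : Fin q, h = fun η : ℝ => c k (gdIter f x η (l - 1))}) := by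
  induction m with
  | zero =>
    ext h
    simp only [gdSet, Set.mem_union, Set.mem_ofPred_eq, Set.mem_range]
    constructor
    · rintro ⟨k, rfl⟩; exact Or.inl (Or.inl ⟨k, rfl⟩)
    · rintro ((⟨k, rfl⟩ | ⟨l, h1, h2, _⟩) | ⟨l, h1, h2, _⟩)
      · exact ⟨k, rfl⟩
      · omega
      · omega
  | succ m ih =>
    ext h
    simp only [gdSet, ih, Set.mem_union, Set.mem_ofPred_eq, Set.mem_range]
    constructor
    · rintro ((((⟨k, rfl⟩ | ⟨l, h1, h2, j, rfl⟩) | ⟨l, h1, h2, j, rfl⟩) | ⟨j, rfl⟩) | ⟨k, rfl⟩)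
      · exact Or.inl (Or.inl ⟨k, rfl⟩)
      · exact Or.inl (Or.inr ⟨l, h1, by omega, j, rfl⟩)
      · exact Or.inr ⟨l, h1, by omega, j, rfl⟩
      · exact Or.inl (Or.inr ⟨m + 2, by omega, by omega, j, rfl⟩)
      · exact Or.inr ⟨m + 2, by omega, by omega, k, rfl⟩
    · rintro ((⟨k, rfl⟩ | ⟨l, h1, h2, j, rfl⟩) | ⟨l, h1, h2, k, rfl⟩)
      · exact Or.inl (Or.inl (Or.inl (Or.inl ⟨k, rfl⟩)))
      · by_cases hl : l ≤ m + 1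
        · exact Or.inl (Or.inl (Or.inl (Or.inr ⟨l, h1, hl, j, rfl⟩)))
        · obtain rfl : l = m + 2 := by omega
          exact Or.inl (Or.inr ⟨j, rfl⟩)
      · by_cases hl : l ≤ m + 1
        · exact Or.inl (Or.inl (Or.inr ⟨l, h1, hl, k, rfl⟩))
        · obtain rfl : l = m + 2 := by omega
          exact Or.inr ⟨k, rfl⟩

lemma gdSet_base {d q : ℕ} (c : Fin q → (EuclideanSpace ℝ (Fin d) → ℝ))
    (f : EuclideanSpace ℝ (Fin d) → ℝ) (x : EuclideanSpace ℝ (Fin d)) :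
    ChainSet q (gdSet c f x 0) := by
  have h := chainSet_nil.append (fun (k : Fin q) (_ : ℝ) => c k x) (fun k => contDiff_const)
    (fun k => by
      have : deriv (fun _ : ℝ => c k x) = fun _ => 0 := by funext η; simp
      rw [this]; exact polyAlg_const _ _)
  simpa [gdSet] using h

lemma gdSet_mem {d q : ℕ} (c : Fin q → (EuclideanSpace ℝ (Fin d) → ℝ))
    (f : EuclideanSpace ℝ (Fin d) → ℝ) (x : EuclideanSpace ℝ (Fin d)) (m : ℕ) :
    (∀ j, (fun η => gdIter f x η m j) ∈ polyAlg (gdSet c f x m)) ∧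
    (∀ k, (fun η => c k (gdIter f x η m)) ∈ polyAlg (gdSet c f x m)) := by
  cases m with
  | zero => exact ⟨fun j => polyAlg_const _ (x j), fun k => polyAlg_const _ (c k x)⟩
  | succ m => exact ⟨fun j => polyAlg_of_mem (Or.inl (Or.inr ⟨j, rfl⟩)),
      fun k => polyAlg_of_mem (Or.inr ⟨k, rfl⟩)⟩

lemma gdSet_chain {d q M : ℕ}
    (c : Fin q → (EuclideanSpace ℝ (Fin d) → ℝ)) (hc : IsPfaffianChain M c)
    (f : EuclideanSpace ℝ (Fin d) → ℝ)
    (G : Fin d → MvPolynomial (Fin d ⊕ Fin q) ℝ)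
    (hG : ∀ i a, gradient f a i =
        MvPolynomial.eval (Sum.elim (fun i => a i) (fun k => c k a)) (G i))
    (x : EuclideanSpace ℝ (Fin d)) (m : ℕ) :
    ChainSet (q + (d + q) * m) (gdSet c f x m) := by
  induction m with
  | zero => simpa using gdSet_base c f x
  | succ m ih =>
    obtain ⟨hx, hcx⟩ := gdSet_mem c f x m
    have hnew : ∀ j, (fun η => gdIter f x η (m + 1) j) ∈ polyAlg (gdSet c f x m) := by
      intro j
      have e : (fun η => gdIter f x η (m + 1) j) = (fun η => gdIter f x η m j) -
          (fun η => η) * (fun η => MvPolynomial.eval (fun s => (Sum.elim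
            (fun j η => gdIter f x η m j) (fun k η => c k (gdIter f x η m)) : _ → ℝ → ℝ) s η)
              (G j)) := by
        funext η
        simp only [gdIter, PiLp.sub_apply, PiLp.smul_apply, smul_eq_mul, hG, Pi.sub_apply,
          Pi.mul_apply]
        congr 4
        funext s
        cases s <;> rfl
      rw [e]
      refine sub_mem (hx j) (mul_mem (polyAlg_id _) (eval_mem_of_vars _ _ _ fun s _ => ?_))
      rcases s with s | s
      · exact hx s
      · exact hcx s
    have h1 := ih.append (fun j η => gdIter f x η (m + 1) j)
      (fun j => (ih.contDiff_deriv (hnew j)).1)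
      (fun j => polyAlg_mono Set.subset_union_left (ih.contDiff_deriv (hnew j)).2)
    have h2 := h1.comp c hc (fun η => gdIter f x η (m + 1))
      (fun j => polyAlg_of_mem (Or.inr ⟨j, rfl⟩))
    have e : q + (d + q) * m + d + q = q + (d + q) * (m + 1) := by ring
    rw [e] at h2
    exact h2

/-- For a Pfaffian objective `f` over the chain `c`, the coordinates of the earlier iterates
`x_l(η)` (`2 ≤ l ≤ i−1`), the compositions `f_k(x_l(η))`, and the constants `η ↦ f_k(x)`
form a Pfaffian chain in `η` of length at most `q + (q+1)d(i−2)`, and each coordinate of the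
`i`-th iterate is a polynomial of degree at most `(Δ+M)^(i−2)` in `η` and this chain. -/
theorem gd_pfaffian_iterate_chain
    {d q M Δ : ℕ} (hM : 1 ≤ M) (hΔ : 1 ≤ Δ)
    (c : Fin q → (EuclideanSpace ℝ (Fin d) → ℝ)) (hc : IsPfaffianChain M c)
    (f : EuclideanSpace ℝ (Fin d) → ℝ)
    (Q : MvPolynomial (Fin d ⊕ Fin q) ℝ) (hQ : Q.totalDegree ≤ Δ)
    (hfQ : ∀ a : EuclideanSpace ℝ (Fin d),
      f a = MvPolynomial.eval (Sum.elim (fun i => a i) (fun k => c k a)) Q)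
    (x : EuclideanSpace ℝ (Fin d)) :
    ∀ i : ℕ, 2 ≤ i →
      ∃ n : ℕ, n ≤ q + (q + 1) * d * (i - 2) ∧
        ∃ ch : Fin n → (ℝ → ℝ),
          IsPfaffianChain1 ch ∧
          Set.range ch =
            ({h : ℝ → ℝ | ∃ k : Fin q, h = fun _ : ℝ => c k x} ∪
             {h : ℝ → ℝ | ∃ l : ℕ, 2 ≤ l ∧ l ≤ i - 1 ∧
                ∃ j : Fin d, h = fun η : ℝ => gdIter f x η (l - 1) j} ∪
             {h : ℝ → ℝ | ∃ l : ℕ, 2 ≤ l ∧ l ≤ i - 1 ∧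
                ∃ k : Fin q, h = fun η : ℝ => c k (gdIter f x η (l - 1))}) ∧
          ∀ j : Fin d,
            ∃ Q' : MvPolynomial (Unit ⊕ Fin n) ℝ,
              Q'.totalDegree ≤ (Δ + M) ^ (i - 2) ∧
              ∀ η : ℝ, gdIter f x η (i - 1) j =
                MvPolynomial.eval (Sum.elim (fun _ => η) (fun k => ch k η)) Q' := by
  intro i hi
  obtain ⟨m, rfl⟩ : ∃ m, i = m + 2 := ⟨i - 2, by omega⟩
  obtain ⟨G, hG⟩ := gradient_poly hΔ hM c hc f Q hQ hfQ
  have e1 : m + 2 - 1 = m + 1 := rfl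
  have e2 : m + 2 - 2 = m := rfl
  rw [e1, e2, ← gdSet_eq]
  have hlen : ∃ n, n ≤ q + (q + 1) * d * m ∧ ChainSet n (gdSet c f x m) := by
    rcases Nat.eq_zero_or_pos d with rfl | hd
    · refine ⟨q, by omega, ?_⟩
      have : gdSet c f x m = gdSet c f x 0 := by
        clear hi e1 e2
        induction m with
        | zero => rfl
        | succ m ih =>
          have h0 : ∀ η, gdIter f x η (m + 1) = x := fun η => Subsingleton.elim _ _
          have e : gdSet c f x (m + 1) = (gdSet c f x m ∪
            Set.range fun j η => gdIter f x η (m + 1) j) ∪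
            Set.range fun k η => c k (gdIter f x η (m + 1)) := rfl
          rw [e, ih]
          simp only [h0]
          simp [gdSet]
      rw [this]
      exact gdSet_base c f x
    · refine ⟨_, ?_, gdSet_chain c hc f G (fun i => (hG i).2) x m⟩
      have : d + q ≤ (q + 1) * d := by nlinarith
      have := Nat.mul_le_mul_right m this
      omega
  obtain ⟨n, hn, ch, hch, hr⟩ := hlen
  refine ⟨n, hn, ch, hch, hr, fun j => ?_⟩
  cases m with
  | zero =>
    refine ⟨MvPolynomial.C (x j) - MvPolynomial.X (Sum.inl ()) *
      MvPolynomial.C (gradient f x j), ?_, fun η => ?_⟩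
    · refine (MvPolynomial.totalDegree_sub _ _).trans (max_le (by simp) ?_)
      refine (MvPolynomial.totalDegree_mul _ _).trans ?_
      simp
    · simp [gdIter]
  | succ m =>
    have hs : ∀ s : Fin d ⊕ Fin q, ∃ k : Fin n, ch k = (Sum.elim
        (fun j η => gdIter f x η (m + 1) j) (fun k η => c k (gdIter f x η (m + 1))) :
          _ → ℝ → ℝ) s := by
      intro s
      change _ ∈ Set.range ch
      rw [hr]
      rcases s with s | s
      · exact Or.inl (Or.inr ⟨s, rfl⟩)
      · exact Or.inr ⟨s, rfl⟩
    choose σ hσ using hs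
    refine ⟨MvPolynomial.X (Sum.inr (σ (Sum.inl j))) - MvPolynomial.X (Sum.inl ()) *
      MvPolynomial.rename (fun s => Sum.inr (σ s)) (G j), ?_, fun η => ?_⟩
    · have hle : Δ + M ≤ (Δ + M) ^ (m + 1) := Nat.le_self_pow (by omega) _
      refine (MvPolynomial.totalDegree_sub _ _).trans (max_le ?_ ?_)
      · rw [MvPolynomial.totalDegree_X]; omega
      · refine (MvPolynomial.totalDegree_mul _ _).trans ?_
        have := MvPolynomial.totalDegree_rename_le
          (fun s => (Sum.inr (σ s) : Unit ⊕ Fin n)) (G j)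
        have := (hG j).1
        rw [MvPolynomial.totalDegree_X]
        omega
    · rw [show m + 1 + 1 = (m + 1) + 1 from rfl, gdIter]
      simp only [PiLp.sub_apply, PiLp.smul_apply, smul_eq_mul, (hG j).2, map_sub, map_mul,
        MvPolynomial.eval_X, Sum.elim_inr, Sum.elim_inl, MvPolynomial.eval_rename, hσ]
      congr 4
      funext s
      simp only [Function.comp, Sum.elim_inr, hσ]
      cases s <;> rfl
end

section
/- Fix integers d ≥ 1, H ≥ 1, p ≥ 1, a gradient threshold θ > 0, a degree bound Δ ≥ 1, and a fixed step size η ≥ 0. Consider gradient descent started at the point σ·x̂ for a scale hyperparameter σ > 0: iterates x_1 = σx̂, x_{i+1} = x_i − η∇f(x_i), with cost ℓ(σ, x̂, f) equal to the smallest i ∈ {1,…,H} with ‖∇f(x_i)‖ < θ if one exists, and H otherwise. Let Π be a set of instances (x̂, f) with x̂ ∈ ℝ^d, ‖x̂‖ = 1, and f : ℝ^d → ℝ piecewise polynomial with at most p polynomial boundaries and degree at most Δ, such that no gradient-descent iterate ever lies on a boundary of f. Then for every ε > 0, every δ ∈ (0,1) and every probability distribution D over Π, (ε, δ)-uniform convergence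 of the class {(x̂, f) ↦ ℓ(σ, x̂, f) : σ > 0} holds with m samples, where m = O((H²/ε²)(H·log(2pdΔ) + log(1/δ))). -/
open MeasureTheory

/-- `f : ℝ^d → ℝ` is piecewise polynomial with boundary polynomials `g` (each nonzero, of
degree at most `Δ`): on each connected component of the complement of the zero sets of the
boundaries, `f` agrees with some polynomial of degree at most `Δ`. -/
def IsPWPolyWith {d : ℕ} (p Δ : ℕ) (f : EuclideanSpace ℝ (Fin d) → ℝ)
    (g : Fin p → MvPolynomial (Fin d) ℝ) : Prop :=
  (∀ k, g k ≠ 0 ∧ (g k).totalDegree ≤ Δ) ∧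
  ∀ y : EuclideanSpace ℝ (Fin d),
    (∀ k, MvPolynomial.eval (fun j => y j) (g k) ≠ 0) →
    ∃ q : MvPolynomial (Fin d) ℝ, q.totalDegree ≤ Δ ∧
      ∀ w ∈ connectedComponentIn
          {w : EuclideanSpace ℝ (Fin d) | ∀ k, MvPolynomial.eval (fun j => w j) (g k) ≠ 0} y,
        f w = MvPolynomial.eval (fun j => w j) q

/-- Deviation of the empirical mean of `g` over the sample `s` from its expectation. -/
noncomputable def gdDev {Ω : Type} [MeasurableSpace Ω] (D : Measure Ω) {m : ℕ} (g : Ω → ℝ)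
    (s : Fin m → Ω) : ℝ :=
  (∑ j : Fin m, g (s j)) / m - ∫ z, g z ∂D

theorem gd_integrable {Ω : Type} [MeasurableSpace Ω] (D : Measure Ω) [IsProbabilityMeasure D]
    (g : Ω → ℝ) (hg : Measurable g) (hb : ∀ z, |g z| ≤ 1) : Integrable g D :=
  Integrable.of_bound hg.aestronglyMeasurable 1 (Filter.Eventually.of_forall hb)

theorem gdDev_measurable {Ω : Type} [MeasurableSpace Ω] (D : Measure Ω) {m : ℕ} (g : Ω → ℝ)
    (hg : Measurable g) : Measurable (gdDev D g : (Fin m → Ω) → ℝ) := by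
  unfold gdDev
  fun_prop

theorem gdDev_sub {Ω : Type} [MeasurableSpace Ω] (D : Measure Ω) {m : ℕ} (f g : Ω → ℝ)
    (hf : Integrable f D) (hg : Integrable g D) (s : Fin m → Ω) :
    gdDev D (fun z => f z - g z) s = gdDev D f s - gdDev D g s := by
  unfold gdDev
  rw [integral_sub hf hg, Finset.sum_sub_distrib]
  ring

/-- One sided Bernstein bound. -/
theorem gd_bernstein_one {Ω : Type} [MeasurableSpace Ω] (D : Measure Ω) [IsProbabilityMeasure D]
    {m : ℕ} (hm : 0 < m) (g : Ω → ℝ) (hg : Measurable g) (hb : ∀ z, |g z| ≤ 1)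
    (G : Set Ω) (hG : MeasurableSet G) (hz : ∀ z, z ∉ G → g z = 0)
    (α t : ℝ) (hα : 0 < α) (hD : D.real G ≤ α) (ht : 0 ≤ t) (htα : t ≤ 2 * α) :
    (Measure.pi fun _ : Fin m => D).real {s | t ≤ gdDev D g s} ≤
      Real.exp (-(m * t ^ 2 / (4 * α))) := by
  set l : ℝ := t / (2 * α) with hl
  have hl0 : 0 ≤ l := by positivity
  have hl1 : l ≤ 1 := by rw [hl, div_le_one (by positivity)]; exact htα
  have hmR : (0:ℝ) < m := by exact_mod_cast hm
  have hgi := gd_integrable D g hg hb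
  -- single variable exponential moment
  have h1 : ∫ z, Real.exp (l * g z) ∂D ≤ Real.exp (l * ∫ z, g z ∂D + l ^ 2 * α) := by
    have hpt : ∀ z, Real.exp (l * g z) ≤ 1 + l * g z + l ^ 2 * G.indicator (fun _ => (1:ℝ)) z := by
      intro z
      have hx : |l * g z| ≤ 1 := by
        rw [abs_mul, abs_of_nonneg hl0]
        exact mul_le_one₀ hl1 (abs_nonneg _) (hb z)
      have h2 := (abs_le.1 (Real.abs_exp_sub_one_sub_id_le hx)).2
      by_cases hzG : z ∈ G
      · rw [Set.indicator_of_mem hzG]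
        have h3 : g z ^ 2 ≤ 1 := by
          rw [← sq_abs]; exact pow_le_one₀ (abs_nonneg _) (hb z)
        nlinarith [sq_nonneg l]
      · rw [Set.indicator_of_notMem hzG, hz z hzG]; simp
    have hii : Integrable (fun z => l ^ 2 * G.indicator (fun _ => (1:ℝ)) z) D :=
      ((integrable_const (1:ℝ)).indicator hG).const_mul _
    have hi1 : Integrable (fun z => 1 + l * g z) D := (integrable_const _).add (hgi.const_mul _)
    calc ∫ z, Real.exp (l * g z) ∂D
        ≤ ∫ z, (1 + l * g z + l ^ 2 * G.indicator (fun _ => (1:ℝ)) z) ∂D := by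
          apply integral_mono_of_nonneg
          · exact Filter.Eventually.of_forall fun z => (Real.exp_pos _).le
          · exact hi1.add hii
          · exact Filter.Eventually.of_forall hpt
      _ = 1 + l * ∫ z, g z ∂D + l ^ 2 * D.real G := by
          rw [integral_add hi1 hii, integral_add (integrable_const _) (hgi.const_mul _),
            integral_const_mul, integral_const_mul, integral_indicator hG]
          simp
      _ ≤ (l * ∫ z, g z ∂D + l ^ 2 * α) + 1 := by nlinarith [sq_nonneg l]
      _ ≤ _ := Real.add_one_le_exp _
  have hmgf : ProbabilityTheory.mgf (fun s : Fin m → Ω => ∑ j, g (s j))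
      (Measure.pi fun _ : Fin m => D) l ≤ Real.exp (m * (l * ∫ z, g z ∂D + l ^ 2 * α)) := by
    unfold ProbabilityTheory.mgf
    simp_rw [Finset.mul_sum, Real.exp_sum]
    rw [integral_fintype_prod_eq_pow (ι := Fin m) (fun z => Real.exp (l * g z)), Fintype.card_fin,
      Real.exp_nat_mul]
    apply pow_le_pow_left₀ _ h1
    exact integral_nonneg fun z => (Real.exp_pos _).le
  have hint : Integrable (fun s : Fin m → Ω => Real.exp (l * ∑ j, g (s j)))
      (Measure.pi fun _ : Fin m => D) := by
    refine Integrable.of_bound (C := Real.exp (l * m)) ?_ (Filter.Eventually.of_forall fun s => ?_)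
    · apply Measurable.aestronglyMeasurable
      fun_prop
    · rw [Real.norm_eq_abs, Real.abs_exp]
      apply Real.exp_le_exp.2
      apply mul_le_mul_of_nonneg_left _ hl0
      calc ∑ j, g (s j) ≤ ∑ j : Fin m, (1:ℝ) :=
            Finset.sum_le_sum fun j _ => (abs_le.1 (hb (s j))).2
        _ = m := by simp
  have key := ProbabilityTheory.measure_ge_le_exp_mul_mgf
    (μ := Measure.pi fun _ : Fin m => D) (X := fun s : Fin m → Ω => ∑ j, g (s j))
    (m * (t + ∫ z, g z ∂D)) hl0 hint
  have hset : {s : Fin m → Ω | t ≤ gdDev D g s} =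
      {s : Fin m → Ω | m * (t + ∫ z, g z ∂D) ≤ ∑ j, g (s j)} := by
    ext s
    simp only [Set.mem_ofPred_eq, gdDev]
    rw [le_sub_iff_add_le, le_div_iff₀ hmR, mul_comm]
  rw [hset]
  refine key.trans ?_
  calc _ ≤ Real.exp (-l * (m * (t + ∫ z, g z ∂D))) *
        Real.exp (m * (l * ∫ z, g z ∂D + l ^ 2 * α)) :=
        mul_le_mul_of_nonneg_left hmgf (Real.exp_pos _).le
    _ = _ := by
      rw [← Real.exp_add]
      congr 1
      rw [hl]
      field_simp
      ring

/-- Two sided Bernstein bound. -/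
theorem gd_bernstein {Ω : Type} [MeasurableSpace Ω] (D : Measure Ω) [IsProbabilityMeasure D]
    {m : ℕ} (hm : 0 < m) (g : Ω → ℝ) (hg : Measurable g) (hb : ∀ z, |g z| ≤ 1)
    (G : Set Ω) (hG : MeasurableSet G) (hz : ∀ z, z ∉ G → g z = 0)
    (α t : ℝ) (hα : 0 < α) (hD : D.real G ≤ α) (ht : 0 ≤ t) (htα : t ≤ 2 * α) :
    (Measure.pi fun _ : Fin m => D).real {s | t < |gdDev D g s|} ≤
      2 * Real.exp (-(m * t ^ 2 / (4 * α))) := by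
  have h1 := gd_bernstein_one D hm g hg hb G hG hz α t hα hD ht htα
  have h2 := gd_bernstein_one D hm (fun z => - g z) hg.neg (fun z => by rw [abs_neg]; exact hb z)
    G hG (fun z h => by rw [hz z h, neg_zero]) α t hα hD ht htα
  have hsub : {s : Fin m → Ω | t < |gdDev D g s|} ⊆
      {s | t ≤ gdDev D g s} ∪ {s | t ≤ gdDev D (fun z => - g z) s} := by
    intro s hs
    simp only [Set.mem_ofPred_eq, Set.mem_union] at hs ⊢
    have : gdDev D (fun z => - g z) s = - gdDev D g s := by
      unfold gdDev
      rw [integral_neg, Finset.sum_neg_distrib]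
      ring
    rw [this]
    rcases lt_abs.1 hs with h | h
    · exact Or.inl h.le
    · exact Or.inr h.le
  calc _ ≤ (Measure.pi fun _ : Fin m => D).real
        ({s | t ≤ gdDev D g s} ∪ {s | t ≤ gdDev D (fun z => - g z) s}) :=
        measureReal_mono hsub
    _ ≤ _ := measureReal_union_le _ _
    _ ≤ _ := by linarith

/-- Finite nets with brackets, for a sequence of functions with few changes. -/
theorem gd_group {Ω : Type} [MeasurableSpace Ω] (D : Measure Ω) [IsProbabilityMeasure D]
    (f : ℕ → Ω → ℝ) (hf : ∀ i, Measurable (f i)) (n : ℕ) (M : ℝ)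
    (hM : ∀ z, ((((Finset.range n).filter fun i => f i z ≠ f (i + 1) z).card : ℕ) : ℝ) ≤ M)
    (α : ℝ) (hα : 0 < α) :
    ∃ (T : Finset ℕ) (π : ℕ → ℕ) (G : ℕ → Set Ω), (∀ i ≤ n, π i ∈ T) ∧ (∀ t ∈ T, t ≤ n) ∧
      (T.card : ℝ) ≤ M / α + 1 ∧ (∀ t, MeasurableSet (G t)) ∧ (∀ t, D.real (G t) ≤ α) ∧
      ∀ i ≤ n, ∀ z, z ∉ G (π i) → f i z = f (π i) z := by
  classical
  set Cs : ℕ → Set Ω := fun l => {z | f l z ≠ f (l + 1) z} with hCs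
  have hCm : ∀ l, MeasurableSet (Cs l) := fun l =>
    (measurableSet_eq_fun (hf l) (hf (l + 1))).compl
  set c : ℕ → ℝ := fun i => ∑ l ∈ Finset.range i, D.real (Cs l) with hc
  have hcmono : Monotone c := by
    apply monotone_nat_of_le_succ
    intro i
    simp only [hc, Finset.sum_range_succ]
    linarith [measureReal_nonneg (μ := D) (s := Cs i)]
  have hc0 : ∀ i, 0 ≤ c i := fun i => Finset.sum_nonneg fun _ _ => measureReal_nonneg
  have hcn : c n ≤ M := by
    have h1 : c n = ∫ z, ∑ l ∈ Finset.range n, (Cs l).indicator (fun _ => (1:ℝ)) z ∂D := by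
      rw [integral_finsetSum]
      · simp only [hc]
        refine Finset.sum_congr rfl fun l _ => ?_
        rw [integral_indicator (hCm l)]
        simp
      · intro l _
        exact (integrable_const (1:ℝ)).indicator (hCm l)
    rw [h1]
    calc _ ≤ ∫ z : Ω, M ∂D := by
          apply integral_mono_of_nonneg
          · exact Filter.Eventually.of_forall fun z => Finset.sum_nonneg fun l _ =>
              Set.indicator_nonneg (fun _ _ => zero_le_one) _
          · exact integrable_const _
          · refine Filter.Eventually.of_forall fun z => ?_
            refine le_trans (le_of_eq ?_) (hM z)
            simp only [Finset.card_filter, Nat.cast_sum]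
            refine Finset.sum_congr rfl fun l _ => ?_
            by_cases h : f l z = f (l + 1) z
            · simp [hCs, h]
            · simp [hCs, h]
      _ = M := by simp
  set grp : ℕ → ℕ := fun i => ⌊c i / α⌋₊ with hgrp
  have hgm : Monotone grp := fun i j hij =>
    Nat.floor_mono (div_le_div_of_nonneg_right (hcmono hij) hα.le)
  set ρ : ℕ → ℕ := fun g => sInf {j | grp j = g} with hρ
  have hρ1 : ∀ i, grp (ρ (grp i)) = grp i := fun i =>
    Nat.sInf_mem (s := {j | grp j = grp i}) ⟨i, rfl⟩
  have hρ2 : ∀ i, ρ (grp i) ≤ i := fun i => Nat.sInf_le (s := {j | grp j = grp i}) rfl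
  set L : ℕ → Finset ℕ := fun t =>
    (Finset.range n).filter fun l => grp l = grp t ∧ grp (l + 1) = grp t with hL
  refine ⟨((Finset.range (n + 1)).image grp).image ρ, fun i => ρ (grp i),
    fun t => ⋃ l ∈ L t, Cs l, ?_, ?_, ?_, ?_, ?_, ?_⟩
  · intro i hi
    exact Finset.mem_image_of_mem _ (Finset.mem_image_of_mem _ (Finset.mem_range.2 (by omega)))
  · intro t ht
    simp only [Finset.mem_image, Finset.mem_range] at ht
    obtain ⟨a, ⟨i, hi, rfl⟩, rfl⟩ := ht
    have := hρ2 i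
    omega
  · have h1 : ((Finset.range (n + 1)).image grp) ⊆ Finset.range (⌊M / α⌋₊ + 1) := by
      intro a ha
      simp only [Finset.mem_image, Finset.mem_range] at ha ⊢
      obtain ⟨i, hi, rfl⟩ := ha
      have : grp i ≤ ⌊M / α⌋₊ := Nat.floor_mono
        (div_le_div_of_nonneg_right ((hcmono (by omega : i ≤ n)).trans hcn) hα.le)
      omega
    have h2 := Finset.card_image_le (s := (Finset.range (n + 1)).image grp) (f := ρ)
    have h3 := Finset.card_le_card h1
    rw [Finset.card_range] at h3
    have h4 : (⌊M / α⌋₊ : ℝ) ≤ M / α :=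
      Nat.floor_le (div_nonneg ((hc0 n).trans hcn) hα.le)
    have h5 : (((((Finset.range (n + 1)).image grp).image ρ).card : ℕ) : ℝ) ≤ (⌊M / α⌋₊ : ℝ) + 1 := by
      exact_mod_cast h2.trans h3
    linarith
  · intro t
    exact Finset.measurableSet_biUnion _ fun l _ => hCm l
  · intro t
    refine (measureReal_biUnion_finset_le _ _).trans ?_
    rcases (L t).eq_empty_or_nonempty with h | h
    · rw [h]; simpa using hα.le
    · set a := (L t).min' h
      set b := (L t).max' h
      have ha : a ∈ L t := Finset.min'_mem _ _
      have hb : b ∈ L t := Finset.max'_mem _ _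
      have hab : a ≤ b := Finset.min'_le _ _ hb
      simp only [hL, Finset.mem_filter] at ha hb
      have h1 : ∑ p ∈ L t, D.real (Cs p) ≤ ∑ p ∈ Finset.Ico a (b + 1), D.real (Cs p) := by
        apply Finset.sum_le_sum_of_subset_of_nonneg
        · intro x hx
          have h1 := Finset.min'_le _ _ hx
          have h2 := Finset.le_max' _ _ hx
          simp only [Finset.mem_Ico]
          constructor
          · exact h1
          · exact Nat.lt_succ_of_le h2
        · intros; exact measureReal_nonneg
      rw [Finset.sum_Ico_eq_sub _ (by omega)] at h1
      refine h1.trans ?_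
      change c (b + 1) - c a ≤ α
      have h2 : ⌊c a / α⌋₊ = ⌊c (b + 1) / α⌋₊ := ha.2.1.trans hb.2.2.symm
      have h3 := Nat.floor_le (div_nonneg (hc0 a) hα.le)
      have h4 := Nat.lt_floor_add_one (c (b + 1) / α)
      rw [← h2] at h4
      have h5 : c (b + 1) / α - c a / α ≤ 1 := by linarith
      rwa [← sub_div, div_le_one hα] at h5
  · intro i hi z hz
    simp only [Set.mem_iUnion, not_exists] at hz
    have hstep : ∀ j, ρ (grp i) ≤ j → j ≤ i → f j z = f (ρ (grp i)) z := by
      intro j hj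
      induction j, hj using Nat.le_induction with
      | base => intro _; rfl
      | succ j hj ih =>
        intro hji
        rw [← ih (by omega)]
        have hj1 : grp j = grp (ρ (grp i)) := le_antisymm
          ((hgm (by omega : j ≤ i)).trans (hρ1 i).ge) (hgm hj)
        have hj2 : grp (j + 1) = grp (ρ (grp i)) := le_antisymm
          ((hgm hji).trans (hρ1 i).ge) (hgm (by omega))
        have := hz j (by
          simp only [hL, Finset.mem_filter, Finset.mem_range]
          exact ⟨by omega, hj1, hj2⟩)
        by_contra hne
        exact this (fun h => hne h.symm)
    exact hstep i (hρ2 i) le_rfl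

/-- Chaining bound for a sequence of functions with few changes. -/
theorem gd_chain {Ω : Type} [MeasurableSpace Ω] (D : Measure Ω) [IsProbabilityMeasure D]
    (f : ℕ → Ω → ℝ) (hf : ∀ i, Measurable (f i)) (hf0 : ∀ i z, 0 ≤ f i z)
    (hf1 : ∀ i z, f i z ≤ 1) (n : ℕ) (M : ℝ) (hM1 : 1 ≤ M)
    (hM : ∀ z, ((((Finset.range n).filter fun i => f i z ≠ f (i + 1) z).card : ℕ) : ℝ) ≤ M)
    (e δ : ℝ) (he0 : 0 < e) (he1 : e < 1) (hδ0 : 0 < δ) (hδ1 : δ < 1) (m : ℕ) (hm0 : 0 < m)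
    (hm : Real.exp (-(m * e ^ 2 / 2 ^ 14)) ≤ δ / M / 256) :
    (Measure.pi fun _ : Fin m => D).real {s : Fin m → Ω | ∃ i ≤ n, e < |gdDev D (f i) s|} ≤ δ := by
  classical
  have hfb : ∀ i z, |f i z| ≤ 1 := fun i z => abs_le.2 ⟨by linarith [hf0 i z], hf1 i z⟩
  have hfi : ∀ i, Integrable (f i) D := fun i => gd_integrable D _ (hf i) (hfb i)
  choose T π G hπT hTn hTc hGm hGD hfG using
    fun k : ℕ => gd_group D f hf n M hM ((1/16:ℝ) ^ k) (by positivity)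
  have hTc' : ∀ k, ((T k).card : ℝ) ≤ 2 * M * 16 ^ k := by
    intro k
    refine (hTc k).trans ?_
    have h1 : (1:ℝ) ≤ 16 ^ k := one_le_pow₀ (by norm_num)
    rw [one_div, inv_pow, div_inv_eq_mul]
    nlinarith
  set X : ℝ := m * e ^ 2 / 2 ^ 14 with hX
  have hX0 : 0 ≤ X := by positivity
  set P := (Measure.pi fun _ : Fin m => D) with hP
  -- union bound
  have hub : ∀ (k : ℕ) (S : Finset ℕ) (g : ℕ → Set (Fin m → Ω)),
      (S.card : ℝ) ≤ 2 * M * 16 ^ (k + 1) →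
      (∀ i ∈ S, P.real (g i) ≤ 2 * Real.exp (-(X * 4 ^ k))) →
      P.real {s : Fin m → Ω | ∃ i ∈ S, s ∈ g i} ≤ δ / 4 * (1/2) ^ k := by
    intro k S g hS hg
    have h1 : {s : Fin m → Ω | ∃ i ∈ S, s ∈ g i} = ⋃ i ∈ S, g i := by
      ext s; simp
    rw [h1]
    have hq : Real.exp (-(X * 4 ^ k)) ≤ (δ / M / 256) * (1/256) ^ k := by
      have h4 : ∀ k : ℕ, (k:ℝ) + 1 ≤ 4 ^ k := by
        intro k
        have := one_add_mul_le_pow (a := (3:ℝ)) (by norm_num) k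
        norm_num at this
        have hk : (0:ℝ) ≤ k := by positivity
        linarith
      have hpos := Real.exp_pos (-X)
      have hδM : δ / M ≤ 1 := by
        rw [div_le_one (by positivity)]
        linarith
      calc Real.exp (-(X * 4 ^ k)) ≤ Real.exp (((k + 1 : ℕ) : ℝ) * (-X)) := by
            apply Real.exp_le_exp.2
            push_cast
            nlinarith [h4 k]
        _ = Real.exp (-X) * Real.exp (-X) ^ k := by
            rw [Real.exp_nat_mul, pow_succ, mul_comm]
        _ ≤ (δ / M / 256) * (1/256) ^ k := by
            apply mul_le_mul hm _ (by positivity) (by positivity)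
            apply pow_le_pow_left₀ hpos.le
            linarith
    calc P.real (⋃ i ∈ S, g i) ≤ ∑ i ∈ S, P.real (g i) := measureReal_biUnion_finset_le _ _
      _ ≤ ∑ i ∈ S, 2 * Real.exp (-(X * 4 ^ k)) := Finset.sum_le_sum hg
      _ = S.card * (2 * Real.exp (-(X * 4 ^ k))) := by simp
      _ ≤ (2 * M * 16 ^ (k + 1)) * (2 * ((δ / M / 256) * (1/256) ^ k)) := by
          apply mul_le_mul hS _ (by positivity) (by positivity)
          linarith
      _ = δ / 4 * (1 / 16) ^ k := by
          have : (1/256 : ℝ) ^ k = (1/16) ^ k * (1/16) ^ k := by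
            rw [← mul_pow]; norm_num
          rw [this]
          have h3 : (16:ℝ) ^ k * (1/16) ^ k = 1 := by rw [← mul_pow]; norm_num
          have hM0 : M ≠ 0 := by positivity
          rw [pow_succ]
          field_simp
          linear_combination (256 : ℝ) * h3
      _ ≤ δ / 4 * (1/2) ^ k := by
          apply mul_le_mul_of_nonneg_left _ (by positivity)
          apply pow_le_pow_left₀ (by norm_num)
          norm_num
  -- the number of levels
  obtain ⟨K, hK1, hK2⟩ : ∃ K : ℕ, (1/16:ℝ) ^ K ≤ e / 8 ∧ e * 16 ^ K ≤ 128 := by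
    have hex : ∃ K : ℕ, (1/16:ℝ) ^ K ≤ e / 8 := by
      obtain ⟨K, hK⟩ := exists_pow_lt_of_lt_one (by positivity : 0 < e / 8)
        (by norm_num : (1/16:ℝ) < 1)
      exact ⟨K, hK.le⟩
    refine ⟨Nat.find hex, Nat.find_spec hex, ?_⟩
    rcases Nat.eq_zero_or_pos (Nat.find hex) with h | h
    · rw [h]; linarith
    · obtain ⟨j, hj⟩ := Nat.exists_eq_succ_of_ne_zero h.ne'
      have h2 := Nat.find_min hex (m := j) (by omega)
      push Not at h2
      rw [hj, pow_succ]
      have h3 : (16:ℝ) ^ j * (1/16) ^ j = 1 := by rw [← mul_pow]; norm_num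
      have h4 : (0:ℝ) < 16 ^ j := by positivity
      nlinarith [mul_lt_mul_of_pos_left h2 h4]
  have hB : ∀ k ≤ K, ∀ g : Ω → ℝ, Measurable g → (∀ z, |g z| ≤ 1) → ∀ G' : Set Ω,
      MeasurableSet G' → (∀ z, z ∉ G' → g z = 0) → D.real G' ≤ (1/16) ^ k →
      P.real {s : Fin m → Ω | e / 64 * (1/2) ^ k < |gdDev D g s|} ≤ 2 * Real.exp (-(X * 4 ^ k)) := by
    intro k hk g hg hb G' hG' hz hD
    have h16 : (16:ℝ) ^ k * (1/16) ^ k = 1 := by rw [← mul_pow]; norm_num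
    have h84 : (1/2:ℝ) ^ k = 8 ^ k * (1/16) ^ k := by rw [← mul_pow]; norm_num
    have hp : (0:ℝ) < (1/16) ^ k := by positivity
    have he8 : e * 8 ^ k ≤ 128 := by
      refine le_trans ?_ hK2
      apply mul_le_mul_of_nonneg_left _ he0.le
      calc (8:ℝ) ^ k ≤ 16 ^ k := pow_le_pow_left₀ (by norm_num) (by norm_num) _
        _ ≤ 16 ^ K := pow_le_pow_right₀ (by norm_num) hk
    have := gd_bernstein D hm0 g hg hb G' hG' hz ((1/16) ^ k) (e / 64 * (1/2) ^ k) hp hD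
      (by positivity) (by rw [h84]; nlinarith)
    refine this.trans (le_of_eq ?_)
    congr 3
    have h4 : ((1/2:ℝ) ^ k) ^ 2 = 4 ^ k * (1/16) ^ k := by
      rw [← pow_mul, mul_comm k 2, pow_mul, ← mul_pow]; norm_num
    rw [mul_pow, h4, hX]
    field_simp
    norm_num
  have hind : ∀ k ≤ K, P.real {s : Fin m → Ω | ∃ t ∈ T k, s ∈ {s : Fin m → Ω | e / 32 * (2 - (1/2) ^ k) < |gdDev D (f t) s|}} ≤
      δ / 4 + δ / 2 * (1 - (1/2) ^ k) := by
    intro k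
    induction k with
    | zero =>
      intro _
      have h1 := hub 0 (T 0) (fun t => {s : Fin m → Ω | e / 32 * (2 - (1/2) ^ 0) < |gdDev D (f t) s|})
        ((hTc' 0).trans (by rw [pow_succ]; nlinarith [pow_pos (by norm_num : (0:ℝ) < 16) 0])) (by
          intro t _
          refine le_trans ?_ (hB 0 (Nat.zero_le _) (f t) (hf t) (hfb t) Set.univ
            MeasurableSet.univ (by simp) (by simp))
          refine measureReal_mono ?_
          intro s hs
          simp only [Set.mem_ofPred_eq, pow_zero] at hs ⊢
          linarith)
      refine h1.trans (by simp)
    | succ k ih =>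
      intro hk
      have ih' := ih (by omega)
      have h1 := hub k (T (k+1))
        (fun t => {s : Fin m → Ω | e / 64 * (1/2) ^ k < |gdDev D (fun z => f t z - f (π k t) z) s|})
        (hTc' (k+1)) (by
          intro t ht
          refine hB k (by omega) _ ((hf t).sub (hf _)) ?_ (G k (π k t)) (hGm _ _) ?_ (hGD _ _)
          · intro z
            rw [abs_le]
            constructor <;> linarith [hf0 t z, hf1 t z, hf0 (π k t) z, hf1 (π k t) z]
          · intro z hz
            rw [hfG k t (hTn _ _ ht) z hz, sub_self])
      have hsub : {s : Fin m → Ω | ∃ t ∈ T (k+1), s ∈ {s : Fin m → Ω | e / 32 * (2 - (1/2) ^ (k+1)) < |gdDev D (f t) s|}} ⊆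
          {s : Fin m → Ω | ∃ t ∈ T k, s ∈ {s : Fin m → Ω | e / 32 * (2 - (1/2) ^ k) < |gdDev D (f t) s|}} ∪
          {s : Fin m → Ω | ∃ t ∈ T (k+1), s ∈ {s : Fin m → Ω | e / 64 * (1/2) ^ k <
            |gdDev D (fun z => f t z - f (π k t) z) s|}} := by
        rintro s ⟨t, ht, hs⟩
        by_contra hcon
        simp only [Set.mem_union, Set.mem_ofPred_eq, not_or, not_exists, not_and, not_lt] at hcon hs
        have h2 := hcon.1 (π k t) (hπT k t (hTn _ _ ht))
        have h3 := hcon.2 t ht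
        rw [gdDev_sub D _ _ (hfi _) (hfi _)] at h3
        have h4 := abs_add_le (gdDev D (f t) s - gdDev D (f (π k t)) s) (gdDev D (f (π k t)) s)
        rw [sub_add_cancel] at h4
        rw [pow_succ] at hs
        linarith
      refine (measureReal_mono hsub).trans ((measureReal_union_le _ _).trans ?_)
      rw [pow_succ]
      linarith
  have hfin := hub K (T K)
      (fun t => {s : Fin m → Ω | e / 64 * (1/2) ^ K < |gdDev D ((G K t).indicator fun _ => (1:ℝ)) s|})
      ((hTc' K).trans (by
        apply mul_le_mul_of_nonneg_left _ (by positivity)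
        exact pow_le_pow_right₀ (by norm_num) (by omega))) (by
      intro t _
      refine hB K le_rfl _ (measurable_const.indicator (hGm K t)) ?_ (G K t) (hGm _ _) ?_ (hGD _ _)
      · intro z
        by_cases h : z ∈ G K t <;> simp [h]
      · intro z hz
        simp [hz])
  have hsub : {s : Fin m → Ω | ∃ i ≤ n, e < |gdDev D (f i) s|} ⊆
      {s : Fin m → Ω | ∃ t ∈ T K, s ∈ {s : Fin m → Ω | e / 32 * (2 - (1/2) ^ K) < |gdDev D (f t) s|}} ∪
      {s : Fin m → Ω | ∃ t ∈ T K, s ∈ {s : Fin m → Ω | e / 64 * (1/2) ^ K <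
        |gdDev D ((G K t).indicator fun _ => (1:ℝ)) s|}} := by
    rintro s ⟨i, hi, hs⟩
    by_contra hcon
    simp only [Set.mem_union, Set.mem_ofPred_eq, not_or, not_exists, not_and, not_lt] at hcon hs
    have h2 := hcon.1 (π K i) (hπT K i hi)
    have h3 := hcon.2 (π K i) (hπT K i hi)
    set Gi := G K (π K i) with hGi
    have hmR : (0:ℝ) < m := by exact_mod_cast hm0
    have hpt : ∀ z, |f i z - f (π K i) z| ≤ Gi.indicator (fun _ => (1:ℝ)) z := by
      intro z
      by_cases h : z ∈ Gi
      · rw [Set.indicator_of_mem h, abs_le]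
        constructor <;> linarith [hf0 i z, hf1 i z, hf0 (π K i) z, hf1 (π K i) z]
      · rw [hfG K i hi z h]; simp [h]
    have hGint : Integrable (Gi.indicator fun _ => (1:ℝ)) D :=
      (integrable_const (1:ℝ)).indicator (hGm _ _)
    have hint : ∫ z, Gi.indicator (fun _ => (1:ℝ)) z ∂D = D.real Gi := by
      rw [integral_indicator (hGm _ _)]; simp; rfl
    have hGD' : D.real Gi ≤ e / 8 := (hGD _ _).trans hK1
    have h5 : |gdDev D (fun z => f i z - f (π K i) z) s| ≤
        (∑ j, Gi.indicator (fun _ => (1:ℝ)) (s j)) / m + D.real Gi := by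
      unfold gdDev
      refine (abs_sub _ _).trans (add_le_add ?_ ?_)
      · rw [abs_div, abs_of_pos hmR]
        apply div_le_div_of_nonneg_right _ hmR.le
        exact (Finset.abs_sum_le_sum_abs _ _).trans (Finset.sum_le_sum fun j _ => hpt _)
      · rw [← hint]
        refine (abs_integral_le_integral_abs).trans ?_
        apply integral_mono_of_nonneg
        · exact Filter.Eventually.of_forall fun z => abs_nonneg _
        · exact hGint
        · exact Filter.Eventually.of_forall hpt
    have h6 : (∑ j, Gi.indicator (fun _ => (1:ℝ)) (s j)) / m ≤ e / 64 * (1/2) ^ K + D.real Gi := by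
      have := (abs_le.1 h3).2
      unfold gdDev at this
      rw [hint] at this
      linarith
    rw [gdDev_sub D _ _ (hfi _) (hfi _)] at h5
    have h4 := abs_add_le (gdDev D (f i) s - gdDev D (f (π K i)) s) (gdDev D (f (π K i)) s)
    rw [sub_add_cancel] at h4
    have h7 : (1/2:ℝ) ^ K ≤ 1 := pow_le_one₀ (by norm_num) (by norm_num)
    have h8 : (0:ℝ) < (1/2:ℝ) ^ K := by positivity
    nlinarith
  refine (measureReal_mono hsub).trans ((measureReal_union_le _ _).trans ?_)
  have h1 := hind K le_rfl
  have h7 : (1/2:ℝ) ^ K ≤ 1 := pow_le_one₀ (by norm_num) (by norm_num)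
  have h8 : (0:ℝ) < (1/2:ℝ) ^ K := by positivity
  nlinarith

/-- Uniform deviation over a finite set of parameters. -/
theorem gd_finite {Ω : Type} [MeasurableSpace Ω] (D : Measure Ω) [IsProbabilityMeasure D]
    (h : ℝ → Ω → ℝ) (hm : ∀ σ, 0 < σ → Measurable (h σ)) (h0 : ∀ σ z, 0 ≤ h σ z)
    (h1 : ∀ σ z, h σ z ≤ 1) (F : Ω → Finset ℝ) (B : ℕ) (hB1 : 1 ≤ B)
    (hFB : ∀ z, (F z).card ≤ B)
    (hF : ∀ z σ τ, 0 < σ → σ ≤ τ → h σ z ≠ h τ z → ∃ b ∈ F z, σ ≤ b ∧ b ≤ τ)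
    (e δ : ℝ) (he0 : 0 < e) (he1 : e < 1) (hδ0 : 0 < δ) (hδ1 : δ < 1) (m : ℕ) (hm0 : 0 < m)
    (hme : Real.exp (-(m * e ^ 2 / 2 ^ 14)) ≤ δ / (2 * B) / 256)
    (S : Finset ℝ) (hS : ∀ σ ∈ S, 0 < σ) :
    (Measure.pi fun _ : Fin m => D).real {s : Fin m → Ω | ∃ σ ∈ S, e < |gdDev D (h σ) s|} ≤ δ := by
  classical
  rcases S.eq_empty_or_nonempty with rfl | hne
  · simpa using hδ0.le
  obtain ⟨n, hn⟩ : ∃ n, S.card = n + 1 := Nat.exists_eq_succ_of_ne_zero (Finset.card_pos.2 hne).ne'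
  set x : ℕ → ℝ := fun i => S.orderEmbOfFin hn ⟨min i n, by omega⟩ with hx
  have hxS : ∀ i, x i ∈ S := fun i => Finset.orderEmbOfFin_mem _ _ _
  have hxlt : ∀ i j, i < j → j ≤ n → x i < x j := by
    intro i j hij hj
    refine (S.orderEmbOfFin hn).strictMono ?_
    rw [Fin.mk_lt_mk]
    omega
  have key := gd_chain D (fun i => h (x i)) (fun i => hm _ (hS _ (hxS i))) (fun i => h0 _)
    (fun i => h1 _) n (2 * B) (by
      have : (1:ℝ) ≤ B := by exact_mod_cast hB1
      linarith) (by
      intro z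
      have hex : ∀ i : ℕ, ∃ b : ℝ, i ∈ (Finset.range n).filter
          (fun i => h (x i) z ≠ h (x (i+1)) z) → b ∈ F z ∧ x i ≤ b ∧ b ≤ x (i+1) := by
        intro i
        by_cases hi : i ∈ (Finset.range n).filter (fun i => h (x i) z ≠ h (x (i+1)) z)
        · have hi' := hi
          rw [Finset.mem_filter, Finset.mem_range] at hi'
          obtain ⟨b, hb, hb'⟩ := hF z (x i) (x (i+1)) (hS _ (hxS i))
            (hxlt i (i+1) (by omega) (by omega)).le hi'.2
          exact ⟨b, fun _ => ⟨hb, hb'⟩⟩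
        · exact ⟨0, fun h => absurd h hi⟩
      choose b hb using hex
      have hcard : ((Finset.range n).filter (fun i => h (x i) z ≠ h (x (i+1)) z)).card ≤
          (F z ×ˢ (Finset.univ : Finset Bool)).card := by
        apply Finset.card_le_card_of_injOn (fun i => (b i, decide (b i = x i)))
        · intro i hi
          simp only [Finset.coe_product, Set.mem_prod]
          exact ⟨(hb i hi).1, Finset.mem_coe.2 (Finset.mem_univ _)⟩
        · have aux : ∀ i j, i ∈ (Finset.range n).filter (fun i => h (x i) z ≠ h (x (i+1)) z) →
              j ∈ (Finset.range n).filter (fun i => h (x i) z ≠ h (x (i+1)) z) → i < j →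
              b i = b j → decide (b i = x i) = decide (b j = x j) → False := by
            intro i j hi hj hij hbb hdd
            have hi2 := hb i hi
            have hj2 := hb j hj
            rw [Finset.mem_filter, Finset.mem_range] at hi hj
            have h3 : x (i+1) ≤ x j := by
              rcases Nat.lt_or_ge (i+1) j with h | h
              · exact (hxlt _ _ h (by omega)).le
              · have : i + 1 = j := by omega
                rw [this]
            have h4 := hxlt i (i+1) (by omega) (by omega)
            have h5 : b j = x j := by linarith [hi2.2.2, hj2.2.1]
            rw [decide_eq_decide] at hdd
            have h6 := hdd.2 h5
            linarith [hi2.2.2, hj2.2.1]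
          intro i hi j hj hij
          simp only [Prod.mk.injEq] at hij
          rcases lt_trichotomy i j with hlt | rfl | hlt
          · exact (aux i j hi hj hlt hij.1 hij.2).elim
          · rfl
          · exact (aux j i hj hi hlt hij.1.symm hij.2.symm).elim
      rw [Finset.card_product] at hcard
      have h2 : ((Finset.range n).filter (fun i => h (x i) z ≠ h (x (i+1)) z)).card ≤ 2 * B := by
        refine hcard.trans ?_
        simp only [Finset.card_univ, Fintype.card_bool]
        have := hFB z
        omega
      exact_mod_cast h2) e δ he0 he1 hδ0 hδ1 m hm0 hme
  refine le_trans (measureReal_mono ?_) key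
  rintro s ⟨σ, hσ, hs⟩
  have hr : σ ∈ Set.range (S.orderEmbOfFin hn) := by
    rw [Finset.range_orderEmbOfFin]; exact hσ
  obtain ⟨i, rfl⟩ := hr
  refine ⟨i, by omega, ?_⟩
  have : x i = S.orderEmbOfFin hn i := by
    simp only [hx]
    congr 1
    apply Fin.ext
    simp
    omega
  simp only [this]
  exact hs

/-- Uniform deviation over a countable set of parameters. -/
theorem gd_countable {Ω : Type} [MeasurableSpace Ω] (D : Measure Ω) [IsProbabilityMeasure D]
    (h : ℝ → Ω → ℝ) (hm : ∀ σ, 0 < σ → Measurable (h σ)) (h0 : ∀ σ z, 0 ≤ h σ z)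
    (h1 : ∀ σ z, h σ z ≤ 1) (F : Ω → Finset ℝ) (B : ℕ) (hB1 : 1 ≤ B)
    (hFB : ∀ z, (F z).card ≤ B)
    (hF : ∀ z σ τ, 0 < σ → σ ≤ τ → h σ z ≠ h τ z → ∃ b ∈ F z, σ ≤ b ∧ b ≤ τ)
    (e δ : ℝ) (he0 : 0 < e) (he1 : e < 1) (hδ0 : 0 < δ) (hδ1 : δ < 1) (m : ℕ) (hm0 : 0 < m)
    (hme : Real.exp (-(m * e ^ 2 / 2 ^ 14)) ≤ δ / (2 * B) / 256)
    (S : Set ℝ) (hSc : S.Countable) (hS : ∀ σ ∈ S, 0 < σ) :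
    (Measure.pi fun _ : Fin m => D) {s : Fin m → Ω | ∃ σ ∈ S, e < |gdDev D (h σ) s|} ≤
      ENNReal.ofReal δ := by
  classical
  rcases S.eq_empty_or_nonempty with rfl | hne
  · simp
  obtain ⟨u, rfl⟩ := hSc.exists_eq_range hne
  have hU : {s : Fin m → Ω | ∃ σ ∈ Set.range u, e < |gdDev D (h σ) s|} =
      ⋃ N : ℕ, {s : Fin m → Ω | ∃ σ ∈ (Finset.range N).image u, e < |gdDev D (h σ) s|} := by
    ext s
    simp only [Set.mem_ofPred_eq, Set.mem_iUnion, Set.mem_range, Finset.mem_image,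
      Finset.mem_range]
    constructor
    · rintro ⟨_, ⟨i, rfl⟩, hi⟩
      exact ⟨i + 1, _, ⟨i, by omega, rfl⟩, hi⟩
    · rintro ⟨N, _, ⟨i, _, rfl⟩, hi⟩
      exact ⟨_, ⟨i, rfl⟩, hi⟩
  rw [hU, Monotone.measure_iUnion]
  · refine iSup_le fun N => ?_
    have := gd_finite D h hm h0 h1 F B hB1 hFB hF e δ he0 he1 hδ0 hδ1 m hm0 hme
      ((Finset.range N).image u) (by
        intro σ hσ
        rw [Finset.mem_image] at hσ
        obtain ⟨i, _, rfl⟩ := hσ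
        exact hS _ ⟨i, rfl⟩)
    rw [measureReal_def] at this
    exact (ENNReal.le_ofReal_iff_toReal_le (measure_ne_top _ _) hδ0.le).2 this
  · intro N N' hN s hs
    obtain ⟨σ, hσ, hs⟩ := hs
    exact ⟨σ, Finset.image_subset_image (Finset.range_mono hN) hσ, hs⟩

/-- A null set lemma for product measures. -/
theorem gd_null {Ω : Type} [MeasurableSpace Ω] (D : Measure Ω) [IsProbabilityMeasure D]
    (R : Ω → Ω → Prop) (hR : ∀ z, D {z' | R z z'} = 0) (m : ℕ) :
    ∀ (Z : Set Ω), D Z = 0 → ∀ A : Set (Fin m → Ω), MeasurableSet A →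
      (∀ s ∈ A, (∃ i, s i ∈ Z) ∨ ∃ i j, i < j ∧ R (s i) (s j)) →
      (Measure.pi fun _ : Fin m => D) A = 0 := by
  induction m with
  | zero =>
    intro Z _ A _ hs
    have : A = ∅ := by
      apply Set.eq_empty_of_forall_notMem
      intro s hsA
      rcases hs s hsA with ⟨i, _⟩ | ⟨i, _⟩ <;> exact i.elim0
    rw [this, measure_empty]
  | succ m ih =>
    intro Z hZ A hA hs
    have hmp := measurePreserving_piFinSuccAbove (fun _ : Fin (m+1) => D) 0
    rw [← hmp.symm.measure_preimage_equiv A, Measure.measure_prod_null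
      ((MeasurableEquiv.measurable _) hA)]
    have hz := measure_eq_zero_iff_ae_notMem.1 hZ
    filter_upwards [hz] with z hz
    simp only [Pi.zero_apply]
    refine ih (Z ∪ {z' | R z z'}) (measure_union_null hZ (hR z)) _ ?_ ?_
    · exact measurable_prodMk_left ((MeasurableEquiv.measurable _) hA)
    · intro t ht
      rcases hs _ ht with ⟨i, hi⟩ | ⟨i, j, hij, hRij⟩
      · left
        induction i using Fin.cases with
        | zero => exact absurd hi hz
        | succ i => exact ⟨i, Or.inl hi⟩
      · induction j using Fin.cases with
        | zero => exact absurd hij (Fin.not_lt_zero _)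
        | succ j =>
          induction i using Fin.cases with
          | zero => exact Or.inl ⟨j, Or.inr hRij⟩
          | succ i => exact Or.inr ⟨i, j, Fin.succ_lt_succ_iff.1 hij, hRij⟩

/-- Uniform deviation over all positive parameters. -/
theorem gd_uniform {Ω : Type} [MeasurableSpace Ω] (D : Measure Ω) [IsProbabilityMeasure D]
    (h : ℝ → Ω → ℝ) (hm : ∀ σ, 0 < σ → Measurable (h σ)) (h0 : ∀ σ z, 0 ≤ h σ z)
    (h1 : ∀ σ z, h σ z ≤ 1) (F : Ω → Finset ℝ) (B : ℕ) (hB1 : 1 ≤ B)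
    (hFB : ∀ z, (F z).card ≤ B)
    (hF : ∀ z σ τ, 0 < σ → σ ≤ τ → h σ z ≠ h τ z → ∃ b ∈ F z, σ ≤ b ∧ b ≤ τ)
    (e δ : ℝ) (he0 : 0 < e) (he1 : e < 1) (hδ0 : 0 < δ) (hδ1 : δ < 1) (m : ℕ) (hm0 : 0 < m)
    (hme : Real.exp (-(m * e ^ 2 / 2 ^ 14)) ≤ δ / (2 * B) / 256)
    (e' : ℝ) (he' : e + 1 / m ≤ e')
    (hA : MeasurableSet {s : Fin m → Ω | ∀ σ, 0 < σ → |gdDev D (h σ) s| ≤ e'}) :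
    (Measure.pi fun _ : Fin m => D) {s : Fin m → Ω | ∀ σ, 0 < σ → |gdDev D (h σ) s| ≤ e'}ᶜ ≤
      ENNReal.ofReal δ := by
  classical
  have hmR : (0:ℝ) < m := by exact_mod_cast hm0
  have hee : e < e' := by
    have : (0:ℝ) < 1 / m := by positivity
    linarith
  choose r _ hrgt hrt using Real.exists_seq_rat_strictAnti_tendsto
  have hr0 : ∀ σ, 0 < σ → ∀ n, (0:ℝ) < r σ n := fun σ hσ n => hσ.trans (hrgt σ n)
  set Sg : ℝ → Set Ω := fun σ => {z | ∃ᶠ n in Filter.atTop, h σ z ≠ h (r σ n) z} with hSg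
  have hSgm : ∀ σ, 0 < σ → MeasurableSet (Sg σ) := by
    intro σ hσ
    have : Sg σ = ⋂ N : ℕ, ⋃ n : ℕ, ⋃ _ : N ≤ n, {z | h σ z ≠ h (r σ n) z} := by
      ext z
      simp [hSg, Filter.frequently_atTop]
    rw [this]
    refine MeasurableSet.iInter fun N => MeasurableSet.iUnion fun n => MeasurableSet.iUnion fun _ =>
      (measurableSet_eq_fun (hm _ hσ) (hm _ (hr0 σ hσ n))).compl
  have hSgF : ∀ σ, 0 < σ → ∀ z ∈ Sg σ, σ ∈ F z := by
    intro σ hσ z hz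
    by_contra hcon
    have hev : ∀ᶠ n in Filter.atTop, ∀ b ∈ F z, ¬ (σ ≤ b ∧ b ≤ (r σ n : ℝ)) := by
      rw [Filter.eventually_all_finset]
      intro b hb
      have hne : b ≠ σ := fun h => hcon (h ▸ hb)
      rcases lt_or_gt_of_ne hne with hlt | hgt
      · exact Filter.Eventually.of_forall fun n hn => absurd hn.1 (not_le.2 hlt)
      · filter_upwards [(hrt σ).eventually_lt_const hgt] with n hn hc
        exact absurd hc.2 (not_le.2 hn)
    apply hz
    filter_upwards [hev] with n hn
    intro hne
    obtain ⟨b, hb, hb'⟩ := hF z σ (r σ n) hσ (hrgt σ n).le hne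
    exact hn b hb hb'
  -- countably many non-null parameters
  have hcount : (Function.support fun σ : {σ : ℝ // 0 < σ} => D (Sg σ)).Countable := by
    apply Summable.countable_support_ennreal
    refine ne_top_of_le_ne_top (ENNReal.natCast_ne_top B) ?_
    rw [ENNReal.tsum_eq_iSup_sum]
    refine iSup_le fun S => ?_
    calc ∑ σ ∈ S, D (Sg σ) = ∫⁻ z, ∑ σ ∈ S, (Sg σ).indicator 1 z ∂D := by
          rw [lintegral_finsetSum]
          · exact Finset.sum_congr rfl fun σ _ => (lintegral_indicator_one (hSgm σ σ.2)).symm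
          · intro σ _
            exact measurable_one.indicator (hSgm σ σ.2)
      _ ≤ ∫⁻ z, (B : ENNReal) ∂D := by
          apply lintegral_mono
          intro z
          have h2 : ∑ σ ∈ S, (Sg σ).indicator (1 : Ω → ENNReal) z =
              ((S.filter fun σ : {σ : ℝ // 0 < σ} => z ∈ Sg σ).card : ENNReal) := by
            rw [Finset.card_filter, Nat.cast_sum]
            refine Finset.sum_congr rfl fun σ _ => ?_
            by_cases hz : z ∈ Sg σ <;> simp [hz]
          simp only [h2]
          have h3 : (S.filter fun σ : {σ : ℝ // 0 < σ} => z ∈ Sg σ).card ≤ (F z).card := by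
            apply Finset.card_le_card_of_injOn (fun σ : {σ : ℝ // 0 < σ} => (σ : ℝ))
            · intro σ hσ
              have hσ' := (Finset.mem_filter.1 (Finset.mem_coe.1 hσ)).2
              exact hSgF σ σ.2 z hσ'
            · exact Subtype.val_injective.injOn
          exact_mod_cast h3.trans (hFB z)
      _ = B := by simp
  set S0 : Set ℝ := {σ | 0 < σ ∧ (σ ∈ Set.range (fun q : ℚ => (q:ℝ)) ∨ D (Sg σ) ≠ 0)} with hS0
  have hS0c : S0.Countable := by
    refine ((Set.countable_range (fun q : ℚ => (q:ℝ))).union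
      (hcount.image Subtype.val)).mono ?_
    rintro σ ⟨hσ, hq | hq⟩
    · exact Or.inl hq
    · exact Or.inr ⟨⟨σ, hσ⟩, hq, rfl⟩
  have hN0 := gd_countable D h hm h0 h1 F B hB1 hFB hF e δ he0 he1 hδ0 hδ1 m hm0 hme S0 hS0c
    (fun σ hσ => hσ.1)
  set N0 : Set (Fin m → Ω) := {s | ∃ σ ∈ S0, e < |gdDev D (h σ) s|} with hN0d
  have hN0m : MeasurableSet N0 := by
    have : N0 = ⋃ σ ∈ S0, {s | e < |gdDev D (h σ) s|} := by
      ext s; simp [hN0d]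
    rw [this]
    refine MeasurableSet.biUnion hS0c fun σ hσ => ?_
    exact measurableSet_lt measurable_const (gdDev_measurable D _ (hm σ hσ.1)).abs
  set A : Set (Fin m → Ω) := {s | ∀ σ, 0 < σ → |gdDev D (h σ) s| ≤ e'} with hAd
  have hnull : (Measure.pi fun _ : Fin m => D) (Aᶜ \ N0) = 0 := by
    refine gd_null D (fun z z' => ∃ σ, 0 < σ ∧ D (Sg σ) = 0 ∧ z ∈ Sg σ ∧ z' ∈ Sg σ) ?_ m ∅
      measure_empty _ (hA.compl.diff hN0m) ?_
    · intro z
      have hsub : {z' | ∃ σ, 0 < σ ∧ D (Sg σ) = 0 ∧ z ∈ Sg σ ∧ z' ∈ Sg σ} ⊆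
          ⋃ σ ∈ (F z).filter (fun σ => D (Sg σ) = 0), Sg σ := by
        rintro z' ⟨σ, hσ, hD, hz, hz'⟩
        simp only [Set.mem_iUnion]
        exact ⟨σ, Finset.mem_filter.2 ⟨hSgF σ hσ z hz, hD⟩, hz'⟩
      refine measure_mono_null hsub ?_
      refine (measure_biUnion_null_iff (Finset.countable_toSet _)).2 ?_
      intro σ hσ
      exact (Finset.mem_filter.1 (Finset.mem_coe.1 hσ)).2
    · rintro s ⟨hsA, hsN⟩
      right
      by_contra hcon
      apply hsA
      intro σ hσ
      by_cases hσS : σ ∈ S0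
      · by_contra hlt
        exact hsN ⟨σ, hσS, hee.trans (not_le.1 hlt)⟩
      have hD : D (Sg σ) = 0 := by
        by_contra hne
        exact hσS ⟨hσ, Or.inr hne⟩
      have huniq : ∀ i j, s i ∈ Sg σ → s j ∈ Sg σ → i = j := by
        intro i j hi hj
        rcases lt_trichotomy i j with hlt | heq | hlt
        · exact (hcon ⟨i, j, hlt, σ, hσ, hD, hi, hj⟩).elim
        · exact heq
        · exact (hcon ⟨j, i, hlt, σ, hσ, hD, hj, hi⟩).elim
      have hdev : ∀ n, |gdDev D (h (r σ n)) s| ≤ e := by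
        intro n
        by_contra hlt
        exact hsN ⟨r σ n, ⟨hr0 σ hσ n, Or.inl ⟨r σ n, rfl⟩⟩, not_le.1 hlt⟩
      have hev1 : ∀ᶠ n in Filter.atTop, ∀ j, s j ∉ Sg σ → h σ (s j) = h (r σ n) (s j) := by
        rw [Filter.eventually_all]
        intro j
        by_cases hj : s j ∈ Sg σ
        · exact Filter.Eventually.of_forall fun n hn => absurd hj hn
        · have : ∀ᶠ n in Filter.atTop, h σ (s j) = h (r σ n) (s j) := by
            simpa [hSg, Filter.not_frequently] using hj
          exact this.mono fun n hn _ => hn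
      have hint : Filter.Tendsto (fun n => ∫ z, h (r σ n) z ∂D) Filter.atTop
          (nhds (∫ z, h σ z ∂D)) := by
        refine tendsto_integral_of_dominated_convergence (fun _ => 1)
          (fun n => (hm _ (hr0 σ hσ n)).aestronglyMeasurable) (integrable_const _) ?_ ?_
        · intro n
          refine Filter.Eventually.of_forall fun z => ?_
          rw [Real.norm_eq_abs, abs_of_nonneg (h0 _ _)]
          exact h1 _ _
        · filter_upwards [measure_eq_zero_iff_ae_notMem.1 hD] with z hz
          have : ∀ᶠ n in Filter.atTop, h σ z = h (r σ n) z := by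
            simpa [hSg, Filter.not_frequently] using hz
          exact tendsto_const_nhds.congr' this
      have hlim : Filter.Tendsto (fun n => |(∑ j, h σ (s j)) / m - ∫ z, h (r σ n) z ∂D|)
          Filter.atTop (nhds |gdDev D (h σ) s|) := (tendsto_const_nhds.sub hint).abs
      refine le_of_tendsto hlim ?_
      filter_upwards [hev1] with n hn
      have hsum : |∑ j, (h σ (s j) - h (r σ n) (s j))| ≤ 1 := by
        by_cases hex : ∃ i, s i ∈ Sg σ
        · obtain ⟨i, hi⟩ := hex
          rw [Finset.sum_eq_single i]
          · rw [abs_le]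
            constructor <;> linarith [h0 σ (s i), h1 σ (s i), h0 (r σ n) (s i), h1 (r σ n) (s i)]
          · intro j _ hji
            rw [hn j (fun hj => hji (huniq j i hj hi)), sub_self]
          · simp
        · rw [Finset.sum_eq_zero]
          · simp
          · intro j _
            rw [hn j (fun hj => hex ⟨j, hj⟩), sub_self]
      have heq : (∑ j, h σ (s j)) / m - ∫ z, h (r σ n) z ∂D =
          (∑ j, (h σ (s j) - h (r σ n) (s j))) / m + gdDev D (h (r σ n)) s := by
        unfold gdDev
        rw [Finset.sum_sub_distrib]
        ring
      rw [heq]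
      refine (abs_add_le _ _).trans ?_
      have : |(∑ j, (h σ (s j) - h (r σ n) (s j))) / (m:ℝ)| ≤ 1 / m := by
        rw [abs_div, abs_of_pos hmR]
        exact div_le_div_of_nonneg_right hsum hmR.le
      linarith [hdev n]
  calc (Measure.pi fun _ : Fin m => D) Aᶜ
      ≤ (Measure.pi fun _ : Fin m => D) (N0 ∪ (Aᶜ \ N0)) := by
        apply measure_mono
        intro s hs
        by_cases hN : s ∈ N0
        · exact Or.inl hN
        · exact Or.inr ⟨hs, hN⟩
    _ ≤ _ := measure_union_le _ _
    _ ≤ ENNReal.ofReal δ := by rw [hnull, add_zero]; exact hN0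

theorem gd_totalDegree_pderiv {d : ℕ} (j : Fin d) (q : MvPolynomial (Fin d) ℝ) :
    (MvPolynomial.pderiv j q).totalDegree ≤ q.totalDegree := by
  classical
  conv_lhs => rw [q.as_sum, map_sum]
  refine MvPolynomial.totalDegree_finsetSum_le fun s hs => ?_
  rw [MvPolynomial.pderiv_monomial]
  refine (MvPolynomial.totalDegree_monomial_le _ _).trans ?_
  refine le_trans ?_ (MvPolynomial.le_totalDegree hs)
  have h : s - Finsupp.single j 1 ≤ s := tsub_le_self
  rw [Finsupp.sum_fintype _ _ (fun _ => rfl), Finsupp.sum_fintype _ _ (fun _ => rfl)]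
  exact Finset.sum_le_sum fun i _ => h i

theorem gd_hasFDerivAt {d : ℕ} (q : MvPolynomial (Fin d) ℝ) (w : EuclideanSpace ℝ (Fin d)) :
    HasFDerivAt (fun w : EuclideanSpace ℝ (Fin d) => MvPolynomial.eval (fun j => w j) q)
      (∑ j, (MvPolynomial.eval (fun j => w j) (MvPolynomial.pderiv j q)) •
        (EuclideanSpace.proj j : EuclideanSpace ℝ (Fin d) →L[ℝ] ℝ)) w := by
  classical
  induction q using MvPolynomial.induction_on with
  | C a => simpa using hasFDerivAt_const a w
  | add p q hp hq =>
    have := hp.add hq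
    simp only [map_add, add_smul, Finset.sum_add_distrib]
    exact this
  | mul_X p n hp =>
    have hX : HasFDerivAt (fun w : EuclideanSpace ℝ (Fin d) => w n)
      (EuclideanSpace.proj n : EuclideanSpace ℝ (Fin d) →L[ℝ] ℝ) w :=
      (EuclideanSpace.proj n : EuclideanSpace ℝ (Fin d) →L[ℝ] ℝ).hasFDerivAt
    have := hp.mul hX
    simp only [map_mul, MvPolynomial.eval_X]
    refine this.congr_fderiv ?_
    ext v
    simp [MvPolynomial.pderiv_X, add_mul, Finset.sum_add_distrib,
      Pi.single_apply, Finset.mul_sum, apply_ite]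
    ring_nf

theorem gd_gradient_eval {d : ℕ} (q : MvPolynomial (Fin d) ℝ) (w : EuclideanSpace ℝ (Fin d))
    (j : Fin d) :
    gradient (fun w : EuclideanSpace ℝ (Fin d) => MvPolynomial.eval (fun j => w j) q) w j =
      MvPolynomial.eval (fun j => w j) (MvPolynomial.pderiv j q) := by
  classical
  have h1 := (gd_hasFDerivAt q w).fderiv
  have h3 : (InnerProductSpace.toDual ℝ _ (gradient (fun w : EuclideanSpace ℝ (Fin d) =>
      MvPolynomial.eval (fun j => w j) q) w)) (EuclideanSpace.single j (1:ℝ)) =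
      gradient (fun w : EuclideanSpace ℝ (Fin d) => MvPolynomial.eval (fun j => w j) q) w j := by
    rw [InnerProductSpace.toDual_apply_apply, EuclideanSpace.inner_single_right]
    simp
  rw [← h3, toDual_gradient, h1]
  simp [PiLp.single_apply]

open Polynomial in
theorem gd_eval_aeval {d : ℕ} (c : Fin d → ℝ[X]) (σ : ℝ) (q : MvPolynomial (Fin d) ℝ) :
    MvPolynomial.eval (fun j => (c j).eval σ) q = (MvPolynomial.aeval c q).eval σ := by
  induction q using MvPolynomial.induction_on with
  | C a => simp
  | add p q hp hq => simp [hp, hq]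
  | mul_X p n hp => simp [hp]

open Polynomial in
/-- Along a polynomial curve avoiding the boundaries, the gradient is polynomial. -/
theorem gd_step {d p Δ : ℕ} (f : EuclideanSpace ℝ (Fin d) → ℝ)
    (g : Fin p → MvPolynomial (Fin d) ℝ) (hf : IsPWPolyWith p Δ f g)
    (y : ℝ → EuclideanSpace ℝ (Fin d)) (c : Fin d → ℝ[X]) (N : ℕ)
    (hc : ∀ j, (c j).natDegree ≤ N) (hy : ∀ σ, 0 < σ → ∀ j, y σ j = (c j).eval σ)
    (hav : ∀ σ, 0 < σ → ∀ k, MvPolynomial.eval (fun j => y σ j) (g k) ≠ 0) :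
    ∃ G : Fin d → ℝ[X], (∀ j, (G j).natDegree ≤ Δ * N) ∧
      ∀ σ, 0 < σ → ∀ j, gradient f (y σ) j = (G j).eval σ := by
  classical
  set U : Set (EuclideanSpace ℝ (Fin d)) :=
    {w | ∀ k, MvPolynomial.eval (fun j => w j) (g k) ≠ 0} with hU
  have hUo : IsOpen U := by
    have : U = ⋂ k, {w : EuclideanSpace ℝ (Fin d) |
        MvPolynomial.eval (fun j => w j) (g k) ≠ 0} := by
      ext w; simp [hU]
    rw [this]
    refine isOpen_iInter_of_finite fun k => ?_
    refine isOpen_ne_fun ?_ continuous_const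
    exact continuous_iff_continuousAt.2 fun w => (gd_hasFDerivAt (g k) w).continuousAt
  obtain ⟨q, hq, hqf⟩ := hf.2 (y 1) (hav 1 one_pos)
  set K := connectedComponentIn U (y 1) with hK
  have hKo : IsOpen K := hUo.connectedComponentIn
  have hyc : ContinuousOn y (Set.Ioi 0) := by
    have : ContinuousOn (fun σ => (WithLp.toLp 2 (fun j => (c j).eval σ) :
        EuclideanSpace ℝ (Fin d))) (Set.Ioi 0) := by
      apply Continuous.continuousOn
      refine (PiLp.continuous_toLp 2 _).comp (continuous_pi fun j => (c j).continuous)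
    refine this.congr fun σ hσ => ?_
    ext j
    exact hy σ hσ j
  have hpre : IsPreconnected (y '' Set.Ioi 0) := isPreconnected_Ioi.image _ hyc
  have hsub : y '' Set.Ioi 0 ⊆ K := by
    apply hpre.subset_connectedComponentIn ⟨1, Set.mem_Ioi.2 one_pos, rfl⟩
    rintro _ ⟨σ, hσ, rfl⟩
    exact hav σ hσ
  refine ⟨fun j => MvPolynomial.aeval c (MvPolynomial.pderiv j q), ?_, ?_⟩
  · intro j
    exact MvPolynomial.aeval_natDegree_le _ ((gd_totalDegree_pderiv j q).trans hq) _ hc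
  · intro σ hσ j
    have hmem : y σ ∈ K := hsub ⟨σ, hσ, rfl⟩
    have hev : f =ᶠ[nhds (y σ)] fun w => MvPolynomial.eval (fun j => w j) q := by
      filter_upwards [hKo.mem_nhds hmem] with w hw
      exact hqf w hw
    rw [hev.gradient_eq, gd_gradient_eval]
    have h3 : (fun j => y σ j) = fun j => (c j).eval σ := funext fun j => hy σ hσ j
    rw [h3]
    exact gd_eval_aeval c σ _

open Polynomial in
theorem gd_iter_poly {d p Δ : ℕ} (hΔ : 1 ≤ Δ) (f : EuclideanSpace ℝ (Fin d) → ℝ)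
    (g : Fin p → MvPolynomial (Fin d) ℝ) (hf : IsPWPolyWith p Δ f g)
    (xh : EuclideanSpace ℝ (Fin d)) (η : ℝ) (H : ℕ)
    (hav : ∀ σ : ℝ, 0 < σ → ∀ i ≤ H, ∀ k,
      MvPolynomial.eval (fun j => gdIter f (σ • xh) η i j) (g k) ≠ 0) :
    ∀ i ≤ H, ∃ c : Fin d → ℝ[X], (∀ j, (c j).natDegree ≤ Δ ^ i) ∧
      ∀ σ : ℝ, 0 < σ → ∀ j, gdIter f (σ • xh) η i j = (c j).eval σ := by
  intro i
  induction i with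
  | zero =>
    intro _
    refine ⟨fun j => C (xh j) * X, fun j => ?_, fun σ _ j => ?_⟩
    · refine (Polynomial.natDegree_C_mul_le _ _).trans ?_
      simp
    · simp only [gdIter, PiLp.smul_apply, smul_eq_mul, eval_mul, eval_C, eval_X]
      exact mul_comm _ _
  | succ i ih =>
    intro hi
    obtain ⟨c, hc, hcy⟩ := ih (by omega)
    obtain ⟨G, hG, hGy⟩ := gd_step f g hf (fun σ => gdIter f (σ • xh) η i) c (Δ ^ i) hc hcy
      (fun σ hσ k => hav σ hσ i (by omega) k)
    refine ⟨fun j => c j - C η * G j, fun j => ?_, fun σ hσ j => ?_⟩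
    · refine (Polynomial.natDegree_sub_le _ _).trans (max_le ?_ ?_)
      · exact (hc j).trans (Nat.pow_le_pow_right hΔ (by omega))
      · refine (Polynomial.natDegree_C_mul_le _ _).trans ?_
        rw [pow_succ, mul_comm]
        exact hG j
    · simp only [gdIter, PiLp.sub_apply, PiLp.smul_apply, smul_eq_mul]
      rw [hcy σ hσ j, hGy σ hσ j]
      simp

open Polynomial in
theorem gd_threshold {d p Δ : ℕ} (hΔ : 1 ≤ Δ) (f : EuclideanSpace ℝ (Fin d) → ℝ)
    (g : Fin p → MvPolynomial (Fin d) ℝ) (hf : IsPWPolyWith p Δ f g)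
    (xh : EuclideanSpace ℝ (Fin d)) (η θ : ℝ) (hθ : 0 < θ) (H : ℕ)
    (hav : ∀ σ : ℝ, 0 < σ → ∀ i ≤ H, ∀ k,
      MvPolynomial.eval (fun j => gdIter f (σ • xh) η i j) (g k) ≠ 0) (i : ℕ) :
    ∃ T : ℝ[X], i < H → (T.natDegree ≤ 2 * Δ ^ H ∧
      ∀ σ : ℝ, 0 < σ → (‖gradient f (gdIter f (σ • xh) η i)‖ < θ ↔ T.eval σ < 0)) := by
  by_cases hi : i < H
  · obtain ⟨c, hc, hcy⟩ := gd_iter_poly hΔ f g hf xh η H hav i hi.le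
    obtain ⟨G, hG, hGy⟩ := gd_step f g hf (fun σ => gdIter f (σ • xh) η i) c (Δ ^ i) hc hcy
      (fun σ hσ k => hav σ hσ i hi.le k)
    refine ⟨∑ j, G j ^ 2 - C (θ ^ 2), fun _ => ⟨?_, ?_⟩⟩
    · refine (Polynomial.natDegree_sub_le _ _).trans (max_le ?_ ?_)
      · refine Polynomial.natDegree_sum_le_of_forall_le _ _ fun j _ => ?_
        refine Polynomial.natDegree_pow_le.trans ?_
        refine Nat.mul_le_mul_left _ ((hG j).trans ?_)
        rw [mul_comm, ← pow_succ]
        exact Nat.pow_le_pow_right hΔ (by omega)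
      · simp
    · intro σ hσ
      rw [EuclideanSpace.norm_eq, Real.sqrt_lt' hθ]
      simp only [Real.norm_eq_abs, sq_abs, hGy σ hσ, eval_sub, eval_finsetSum, eval_pow, eval_C]
      exact sub_neg.symm
  · exact ⟨0, fun h => absurd h hi⟩

open Polynomial in
theorem gd_roots {d p Δ : ℕ} (hΔ : 1 ≤ Δ) (f : EuclideanSpace ℝ (Fin d) → ℝ)
    (g : Fin p → MvPolynomial (Fin d) ℝ) (hf : IsPWPolyWith p Δ f g)
    (xh : EuclideanSpace ℝ (Fin d)) (η θ : ℝ) (hθ : 0 < θ) (H : ℕ)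
    (hav : ∀ σ : ℝ, 0 < σ → ∀ i ≤ H, ∀ k,
      MvPolynomial.eval (fun j => gdIter f (σ • xh) η i j) (g k) ≠ 0) :
    ∃ F : Finset ℝ, F.card ≤ H * (2 * Δ ^ H) ∧ ∀ σ τ : ℝ, 0 < σ → σ ≤ τ →
      gdCost H θ f (σ • xh) η ≠ gdCost H θ f (τ • xh) η → ∃ b ∈ F, σ ≤ b ∧ b ≤ τ := by
  classical
  choose T hT using gd_threshold hΔ f g hf xh η θ hθ H hav
  refine ⟨(Finset.range H).biUnion fun i => (T i).roots.toFinset, ?_, ?_⟩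
  · have := Finset.card_biUnion_le_card_mul (Finset.range H) (fun i => (T i).roots.toFinset)
      (2 * Δ ^ H) (by
        intro i hi
        exact (Multiset.toFinset_card_le _).trans ((Polynomial.card_roots' _).trans
          (hT i (Finset.mem_range.1 hi)).1))
    simpa using this
  · intro σ τ hσ hστ hne
    by_contra hcon
    push Not at hcon
    have hτ : 0 < τ := hσ.trans_le hστ
    have hroot : ∀ i < H, T i ≠ 0 → ∀ b, σ ≤ b → b ≤ τ → (T i).eval b ≠ 0 := by
      intro i hi h0 b hb1 hb2 hb
      have := hcon b (Finset.mem_biUnion.2 ⟨i, Finset.mem_range.2 hi, by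
        rw [Multiset.mem_toFinset, Polynomial.mem_roots h0]; exact hb⟩) hb1
      linarith
    have hsign : ∀ i < H, ((T i).eval σ < 0 ↔ (T i).eval τ < 0) := by
      intro i hi
      by_cases h0 : T i = 0
      · simp [h0]
      have hcont : ContinuousOn (fun x => (T i).eval x) (Set.Icc σ τ) :=
        (T i).continuous.continuousOn
      constructor
      · intro h1
        by_contra h2
        obtain ⟨b, hb, hb0⟩ := intermediate_value_Icc hστ hcont ⟨h1.le, not_lt.1 h2⟩
        exact hroot i hi h0 b hb.1 hb.2 hb0
      · intro h1
        by_contra h2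
        obtain ⟨b, hb, hb0⟩ := intermediate_value_Icc' hστ hcont ⟨h1.le, not_lt.1 h2⟩
        exact hroot i hi h0 b hb.1 hb.2 hb0
    apply hne
    unfold gdCost
    congr 2
    ext i
    simp only [Set.mem_ofPred_eq]
    refine and_congr_right fun h1 => and_congr_right fun h2 => ?_
    rw [(hT (i-1) (by omega)).2 σ hσ, (hT (i-1) (by omega)).2 τ hτ]
    exact hsign _ (by omega)

theorem gd_cost_le {d : ℕ} (H : ℕ) (θ : ℝ) (f : EuclideanSpace ℝ (Fin d) → ℝ)
    (x : EuclideanSpace ℝ (Fin d)) (η : ℝ) : gdCost H θ f x η ≤ H :=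
  Nat.sInf_le (Or.inr rfl)

/-- Numerical part: the sample size is large enough. -/
theorem gd_numeric (d H p Δ : ℕ) (hd : 1 ≤ d) (hH : 1 ≤ H) (hp : 1 ≤ p) (hΔ : 1 ≤ Δ)
    (ε δ : ℝ) (hε : 0 < ε) (hδ0 : 0 < δ) (hδ1 : δ < 1) (he1 : ε / H < 1) (m : ℕ)
    (hm : 2 ^ 20 * ((H : ℝ) ^ 2 / ε ^ 2 *
      ((H : ℝ) * Real.log (2 * p * d * Δ) + Real.log (1 / δ))) ≤ m) :
    0 < m ∧ Real.exp (-(m * (ε / H / 2) ^ 2 / 2 ^ 14)) ≤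
      δ / (2 * ((H * (2 * Δ ^ H) : ℕ) : ℝ)) / 256 ∧ ε / H / 2 + 1 / m ≤ ε / H := by
  have hHR : (1:ℝ) ≤ H := by exact_mod_cast hH
  have hdR : (1:ℝ) ≤ d := by exact_mod_cast hd
  have hpR : (1:ℝ) ≤ p := by exact_mod_cast hp
  have hΔR : (1:ℝ) ≤ Δ := by exact_mod_cast hΔ
  set e := ε / H with he
  have he0 : 0 < e := by positivity
  set L := (H : ℝ) * Real.log (2 * p * d * Δ) + Real.log (1 / δ) with hL
  have hlogδ : 0 ≤ Real.log (1 / δ) := Real.log_nonneg (by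
    rw [le_div_iff₀ hδ0]; linarith)
  have hlog2 : Real.log 2 ≤ Real.log (2 * Δ) := Real.log_le_log (by norm_num) (by linarith)
  have hlogΔ : Real.log (2 * Δ) ≤ Real.log (2 * p * d * Δ) := by
    apply Real.log_le_log (by positivity)
    have : (1:ℝ) ≤ p * d := one_le_mul_of_one_le_of_one_le hpR hdR
    nlinarith
  have hl2 : (0.69 : ℝ) < Real.log 2 := by linarith [Real.log_two_gt_d9]
  have hHlog : (H:ℝ) * Real.log (2 * Δ) ≤ H * Real.log (2 * p * d * Δ) :=
    mul_le_mul_of_nonneg_left hlogΔ (by linarith)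
  have hHl : (0.69 : ℝ) ≤ H * Real.log (2 * Δ) := by nlinarith
  have hL1 : (0.69 : ℝ) ≤ L := by linarith
  have hme : 2 ^ 20 * L ≤ m * e ^ 2 := by
    have h1 : (H : ℝ) ^ 2 / ε ^ 2 * e ^ 2 = 1 := by
      rw [he]; field_simp
    have h2 := mul_le_mul_of_nonneg_right hm (sq_nonneg e)
    calc 2 ^ 20 * L = 2 ^ 20 * L * ((H : ℝ) ^ 2 / ε ^ 2 * e ^ 2) := by rw [h1, mul_one]
      _ = 2 ^ 20 * ((H : ℝ) ^ 2 / ε ^ 2 * L) * e ^ 2 := by ring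
      _ ≤ _ := h2
  have hmpos : (0:ℝ) < m := by
    by_contra h
    have : (m:ℝ) * e ^ 2 ≤ 0 := mul_nonpos_of_nonpos_of_nonneg (not_lt.1 h) (sq_nonneg e)
    linarith
  refine ⟨by exact_mod_cast hmpos, ?_, ?_⟩
  · have hpow : ((2 * ((H * (2 * Δ ^ H) : ℕ) : ℝ)) * 256) ≤ (2 * (Δ:ℝ)) ^ (11 * H) := by
      have h1 : (H:ℝ) ≤ 2 ^ H := by exact_mod_cast (Nat.lt_two_pow_self (n := H)).le
      have h2 : (1024:ℝ) ≤ 2 ^ (10 * H) := by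
        calc (1024:ℝ) = 2 ^ 10 := by norm_num
          _ ≤ 2 ^ (10 * H) := pow_le_pow_right₀ (by norm_num) (by omega)
      have h3 : (Δ:ℝ) ^ H ≤ Δ ^ (11 * H) := pow_le_pow_right₀ hΔR (by omega)
      push_cast
      calc (2 * ((H:ℝ) * (2 * (Δ:ℝ) ^ H))) * 256 = 1024 * (H:ℝ) * Δ ^ H := by ring
        _ ≤ 2 ^ (10 * H) * 2 ^ H * Δ ^ (11 * H) := by gcongr
        _ = (2 * (Δ:ℝ)) ^ (11 * H) := by
          rw [mul_pow, ← pow_add]; congr 2; ring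
    have hBpos : (0:ℝ) < 2 * ((H * (2 * Δ ^ H) : ℕ) : ℝ) * 256 := by
      push_cast; positivity
    have h4 : δ / (2 * (Δ:ℝ)) ^ (11 * H) ≤ δ / (2 * ((H * (2 * Δ ^ H) : ℕ) : ℝ)) / 256 := by
      rw [div_div]
      exact div_le_div_of_nonneg_left hδ0.le hBpos hpow
    refine le_trans ?_ h4
    have hpos : 0 < δ / (2 * (Δ:ℝ)) ^ (11 * H) := by positivity
    rw [← Real.le_log_iff_exp_le hpos, Real.log_div hδ0.ne' (by positivity), Real.log_pow]
    have h5 : Real.log (1 / δ) = - Real.log δ := by rw [one_div, Real.log_inv]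
    push_cast
    have h6 : (m:ℝ) * (e / 2) ^ 2 / 2 ^ 14 = m * e ^ 2 / 2 ^ 16 := by ring
    rw [h6]
    have h7 : 16 * L ≤ m * e ^ 2 / 2 ^ 16 := by
      rw [le_div_iff₀ (by norm_num)]
      linarith
    nlinarith
  · have h8 : 2 ≤ m * e := by
      have : (m:ℝ) * e ^ 2 ≤ m * e := by nlinarith [mul_pos hmpos he0]
      linarith
    have h9 : 1 / (m:ℝ) ≤ e / 2 := by
      rw [div_le_div_iff₀ hmpos (by norm_num)]
      linarith
    linarith

/-- Uniform convergence for tuning the initialization-scale hyperparameter `σ > 0` of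
gradient descent (with fixed step size `η`, initial point `σ·x̂`) over
piecewise-polynomial instances, with sample complexity
`m = O((H²/ε²)(H log(2pdΔ) + log(1/δ)))`. -/
theorem gd_pwpoly_initscale_uniform_convergence :
    ∃ C : ℝ, 0 < C ∧
      ∀ (d H p Δ : ℕ), 1 ≤ d → 1 ≤ H → 1 ≤ p → 1 ≤ Δ →
      ∀ θ : ℝ, 0 < θ →
      ∀ η : ℝ, 0 ≤ η →
      ∀ (Ω : Type) (_ : MeasurableSpace Ω)
        (inst : Ω → (EuclideanSpace ℝ (Fin d)) × (EuclideanSpace ℝ (Fin d) → ℝ)),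
        (∀ z : Ω, ‖(inst z).1‖ = 1) →
        (∀ z : Ω, ∃ g : Fin p → MvPolynomial (Fin d) ℝ,
          IsPWPolyWith p Δ (inst z).2 g ∧
          ∀ σ : ℝ, 0 < σ → ∀ i ≤ H, ∀ k,
            MvPolynomial.eval
              (fun j => gdIter (inst z).2 (σ • (inst z).1) η i j) (g k) ≠ 0) →
        (∀ σ : ℝ, 0 < σ →
          Measurable fun z : Ω => (gdCost H θ (inst z).2 (σ • (inst z).1) η : ℝ)) →
      ∀ (D : Measure Ω), IsProbabilityMeasure D →
      ∀ ε δ : ℝ, 0 < ε → 0 < δ → δ < 1 →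
        (∀ (m : ℕ) (t : ℝ), MeasurableSet {s : Fin m → Ω | ∀ σ : ℝ, 0 < σ →
          |(∑ j : Fin m, (gdCost H θ (inst (s j)).2 (σ • (inst (s j)).1) η : ℝ)) / m
            - ∫ z, (gdCost H θ (inst z).2 (σ • (inst z).1) η : ℝ) ∂D| ≤ t}) →
      ∀ m : ℕ,
        C * ((H : ℝ) ^ 2 / ε ^ 2 *
            ((H : ℝ) * Real.log (2 * p * d * Δ) + Real.log (1 / δ))) ≤ m →
        ENNReal.ofReal (1 - δ) ≤
          (Measure.pi fun _ : Fin m => D)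
            {s : Fin m → Ω | ∀ σ : ℝ, 0 < σ →
              |(∑ j : Fin m, (gdCost H θ (inst (s j)).2 (σ • (inst (s j)).1) η : ℝ)) / m
                - ∫ z, (gdCost H θ (inst z).2 (σ • (inst z).1) η : ℝ) ∂D| ≤ ε} := by
  classical
  refine ⟨2 ^ 20, by norm_num, ?_⟩
  intro d H p Δ hd hH hp hΔ θ hθ η hη Ω mΩ inst hnorm hinst hmeas D hD ε δ hε hδ0 hδ1 hset m hm
  have hHR : (1:ℝ) ≤ H := by exact_mod_cast hH
  have hH0 : (0:ℝ) < H := by linarith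
  set c : ℝ → Ω → ℝ := fun σ z => (gdCost H θ (inst z).2 (σ • (inst z).1) η : ℝ) with hc
  have hc0 : ∀ σ z, 0 ≤ c σ z := fun σ z => Nat.cast_nonneg _
  have hcH : ∀ σ z, c σ z ≤ H := fun σ z => by
    simp only [hc]
    exact_mod_cast gd_cost_le H θ (inst z).2 (σ • (inst z).1) η
  set A : Set (Fin m → Ω) := {s | ∀ σ : ℝ, 0 < σ →
    |(∑ j : Fin m, c σ (s j)) / m - ∫ z, c σ z ∂D| ≤ ε} with hA
  have hAm : MeasurableSet A := hset m ε
  change ENNReal.ofReal (1 - δ) ≤ (Measure.pi fun _ : Fin m => D) A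
  rcases lt_or_ge (ε / H) 1 with he1 | he1
  · obtain ⟨hm0, hme, he'⟩ := gd_numeric d H p Δ hd hH hp hΔ ε δ hε hδ0 hδ1 he1 m hm
    have hex : ∀ z, ∃ F : Finset ℝ, F.card ≤ H * (2 * Δ ^ H) ∧ ∀ σ τ : ℝ, 0 < σ → σ ≤ τ →
        gdCost H θ (inst z).2 (σ • (inst z).1) η ≠ gdCost H θ (inst z).2 (τ • (inst z).1) η →
        ∃ b ∈ F, σ ≤ b ∧ b ≤ τ := by
      intro z
      obtain ⟨g, hg, hav⟩ := hinst z
      exact gd_roots hΔ (inst z).2 g hg (inst z).1 η θ hθ H hav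
    choose F hFB hF using hex
    have hAeq : A = {s : Fin m → Ω | ∀ σ, 0 < σ →
        |gdDev D (fun z => c σ z / H) s| ≤ ε / H} := by
      ext s
      refine forall_congr' fun σ => forall_congr' fun _ => ?_
      have : gdDev D (fun z => c σ z / H) s =
          ((∑ j : Fin m, c σ (s j)) / m - ∫ z, c σ z ∂D) / H := by
        unfold gdDev
        rw [integral_div, ← Finset.sum_div]
        ring
      rw [this, abs_div, abs_of_pos hH0, div_le_div_iff_of_pos_right hH0]
    have hbad := gd_uniform D (fun σ z => c σ z / H) (fun σ hσ => (hmeas σ hσ).div_const _)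
      (fun σ z => div_nonneg (hc0 σ z) hH0.le) (fun σ z => (div_le_one hH0).2 (hcH σ z))
      F (H * (2 * Δ ^ H)) (Nat.mul_pos hH (Nat.mul_pos (by norm_num) (Nat.pow_pos hΔ))) hFB
      (by
        intro z σ τ hσ hστ hne
        refine hF z σ τ hσ hστ fun heq => hne ?_
        simp only [hc, heq])
      (ε / H / 2) δ (by positivity) (by linarith) hδ0 hδ1 m hm0 hme (ε / H) he'
      (by rw [← hAeq]; exact hAm)
    rw [← hAeq, prob_compl_eq_one_sub hAm] at hbad
    rw [ENNReal.ofReal_sub 1 hδ0.le, ENNReal.ofReal_one]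
    have h1 : (Measure.pi fun _ : Fin m => D) A ≤ 1 := prob_le_one
    exact tsub_le_iff_left.2 (tsub_le_iff_right.1 hbad)
  · have hεH : (H:ℝ) ≤ ε := by
      rwa [one_le_div hH0] at he1
    have hAu : A = Set.univ := by
      refine Set.eq_univ_of_forall fun s σ hσ => ?_
      have h1 : 0 ≤ (∑ j : Fin m, c σ (s j)) / m :=
        div_nonneg (Finset.sum_nonneg fun j _ => hc0 _ _) (Nat.cast_nonneg _)
      have h2 : (∑ j : Fin m, c σ (s j)) / m ≤ H := by
        apply div_le_of_le_mul₀ (Nat.cast_nonneg _) hH0.le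
        refine (Finset.sum_le_sum fun j _ => hcH σ (s j)).trans ?_
        simp [mul_comm]
      have h3 : 0 ≤ ∫ z, c σ z ∂D := integral_nonneg fun z => hc0 _ _
      have h4 : ∫ z, c σ z ∂D ≤ H := by
        calc ∫ z, c σ z ∂D ≤ ∫ z : Ω, (H:ℝ) ∂D := by
              apply integral_mono_of_nonneg
              · exact Filter.Eventually.of_forall fun z => hc0 _ _
              · exact integrable_const _
              · exact Filter.Eventually.of_forall fun z => hcH _ _
          _ = H := by simp
      rw [abs_le]
      constructor <;> linarith
    rw [hAu, measure_univ]
    exact ENNReal.ofReal_le_one.2 (by linarith)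
end
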